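/- Let u ∈ H³(−1,1) be real-valued with a unique critical point y_c ∈ (−1,1) satisfying u'(y_c) = 0 and u''(y_c) ≠ 0, and with u'(−1) ≠ 0 and u'(1) ≠ 0. Then there exist constants ε₂ > 0, K ≥ 3 and C > 0 (depending only on u, and in particular independent of k, c and Im c) such that for every k = (k₁,k₃) ∈ ℤ² with |k| ≥ K (where |k|² = k₁² + k₃²), every c ∈ ℂ with Re c in the range of u and 0 < |Im c| ≤ ε₂, every g ∈ H¹(−1,1), and every solution ψ ∈ H¹(−1,1) ∩ H²(−1,1) of the Rayleigh equation (u(y)−c)(∂_y² − |k|²)ψ − u''(y)ψ = g on (−1,1) with ψ(±1) = 0, one has ‖∂_yψ‖_{L²(−1,1)} + |k|‖ψ‖_{L²(−1,1)} ≤ C( ‖∂_y g‖_{L²(−1,1)} + |k|‖g‖_{L²(−1,1)} ). -/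

import Mathlib

open Real MeasureTheory

noncomputable section

/-- `|k| = sqrt (k₁² + k₃²)` for `k = (k₁,k₃) ∈ ℤ²`. -/
def kabs (k₁ k₃ : ℤ) : ℝ := Real.sqrt ((k₁ : ℝ) ^ 2 + (k₃ : ℝ) ^ 2)

/-- The `L²` norm on the interval `(-1,1)`. -/
def l2 (f : ℝ → ℂ) : ℝ := Real.sqrt (∫ y in (-1:ℝ)..1, ‖f y‖ ^ 2)

section AuxA
open Set

theorem ra_cs {a b : ℝ} (hab : a ≤ b) {p q : ℝ → ℝ} (hp : Continuous p) (hq : Continuous q) :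
    ∫ x in a..b, p x * q x ≤ √(∫ x in a..b, p x ^ 2) * √(∫ x in a..b, q x ^ 2) := by
  set P := ∫ x in a..b, p x ^ 2 with hP
  set Q := ∫ x in a..b, q x ^ 2 with hQ
  set B := ∫ x in a..b, p x * q x with hB
  have hP0 : 0 ≤ P := intervalIntegral.integral_nonneg hab (fun x _ => sq_nonneg _)
  have key : ∀ t : ℝ, 0 ≤ Q * (t * t) + (2 * B) * t + P := by
    intro t
    have h1 : ∫ x in a..b, (p x + t * q x) ^ 2 = Q * (t * t) + (2 * B) * t + P := by
      have : ∀ x, (p x + t * q x) ^ 2 = (t * t) * q x ^ 2 + (2 * t) * (p x * q x) + p x ^ 2 := by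
        intro x; ring
      simp_rw [this]
      rw [intervalIntegral.integral_add, intervalIntegral.integral_add,
        intervalIntegral.integral_const_mul, intervalIntegral.integral_const_mul]
      · ring
      all_goals apply Continuous.intervalIntegrable; fun_prop
    rw [← h1]
    exact intervalIntegral.integral_nonneg hab (fun x _ => sq_nonneg _)
  have hd := discrim_le_zero key
  rw [discrim] at hd
  rw [← Real.sqrt_mul hP0]
  apply Real.le_sqrt_of_sq_le
  nlinarith

theorem ra_csn {a b : ℝ} (hab : a ≤ b) {p q : ℝ → ℂ} (hp : Continuous p) (hq : Continuous q) :
    ∫ x in a..b, ‖p x‖ * ‖q x‖ ≤ √(∫ x in a..b, ‖p x‖ ^ 2) * √(∫ x in a..b, ‖q x‖ ^ 2) :=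
  ra_cs hab hp.norm hq.norm

/-- Hoelder 1/2 bound. -/
theorem ra_hold {φ φ' : ℝ → ℂ} (hd : ∀ y, HasDerivAt φ (φ' y) y) (hc : Continuous φ') {a b : ℝ}
    (hab : a ≤ b) : ‖φ b - φ a‖ ≤ √(b - a) * √(∫ x in a..b, ‖φ' x‖ ^ 2) := by
  have h1 : ∫ x in a..b, φ' x = φ b - φ a :=
    intervalIntegral.integral_eq_sub_of_hasDerivAt (fun x _ => hd x) (hc.intervalIntegrable _ _)
  rw [← h1]
  calc ‖∫ x in a..b, φ' x‖ ≤ ∫ x in a..b, ‖φ' x‖ :=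
        intervalIntegral.norm_integral_le_integral_norm hab
    _ = ∫ x in a..b, (fun _ => (1:ℝ)) x * ‖φ' x‖ := by simp
    _ ≤ _ := ra_cs hab continuous_const hc.norm
    _ = _ := by simp

theorem ra_sub {a b c d : ℝ} {φ : ℝ → ℂ} (hc : Continuous φ) (h1 : a ≤ c) (h2 : c ≤ d)
    (h3 : d ≤ b) : ∫ x in c..d, ‖φ x‖ ^ 2 ≤ ∫ x in a..b, ‖φ x‖ ^ 2 := by
  apply intervalIntegral.integral_mono_interval h1 h2 h3
  · exact Filter.Eventually.of_forall fun x => sq_nonneg _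
  · apply Continuous.intervalIntegrable; fun_prop

/-- two-sided Hoelder with ambient interval -/
theorem ra_hold' {φ φ' : ℝ → ℂ} (hd : ∀ y, HasDerivAt φ (φ' y) y) (hc : Continuous φ') {a b : ℝ}
    {s t : ℝ} (hs : s ∈ Icc a b) (ht : t ∈ Icc a b) :
    ‖φ s - φ t‖ ≤ √(|s - t|) * √(∫ x in a..b, ‖φ' x‖ ^ 2) := by
  rcases le_total t s with h | h
  · rw [abs_of_nonneg (by linarith)]
    refine (ra_hold hd hc h).trans ?_
    gcongr
    exact ra_sub hc ht.1 h hs.2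
  · rw [abs_sub_comm, norm_sub_rev, abs_of_nonneg (by linarith)]
    refine (ra_hold hd hc h).trans ?_
    gcongr
    exact ra_sub hc hs.1 h ht.2

/-- averaging -/
theorem ra_avg {φ φ' : ℝ → ℂ} (hd : ∀ y, HasDerivAt φ (φ' y) y) (hc : Continuous φ') {p q y : ℝ}
    (hy : y ∈ Icc p q) :
    (q - p) * ‖φ y‖ ^ 2 ≤ 2 * (∫ x in p..q, ‖φ x‖ ^ 2)
      + 2 * (q - p) ^ 2 * ∫ x in p..q, ‖φ' x‖ ^ 2 := by
  have hpq : p ≤ q := hy.1.trans hy.2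
  set D := ∫ x in p..q, ‖φ' x‖ ^ 2
  have hD : 0 ≤ D := intervalIntegral.integral_nonneg hpq (fun x _ => sq_nonneg _)
  have hφ : Continuous φ := continuous_iff_continuousAt.2 fun x => (hd x).continuousAt
  have h1 : ∀ x ∈ Icc p q, ‖φ y‖ ^ 2 ≤ 2 * ‖φ x‖ ^ 2 + 2 * (q - p) * D := by
    intro x hx
    have h2 := ra_hold' hd hc hy hx
    have h3 : ‖φ y‖ ≤ ‖φ x‖ + ‖φ y - φ x‖ := by
      have := norm_add_le (φ x) (φ y - φ x); simpa using this
    have h4 : ‖φ y - φ x‖ ^ 2 ≤ (q - p) * D := by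
      calc ‖φ y - φ x‖ ^ 2 ≤ (√(|y - x|) * √D) ^ 2 := by gcongr
        _ = |y - x| * D := by rw [mul_pow, Real.sq_sqrt (abs_nonneg _), Real.sq_sqrt hD]
        _ ≤ _ := by
          gcongr
          rw [abs_le]; constructor <;> linarith [hx.1, hx.2, hy.1, hy.2]
    have h5 : ‖φ y‖ ^ 2 ≤ (‖φ x‖ + ‖φ y - φ x‖) ^ 2 := by gcongr
    nlinarith [sq_nonneg (‖φ x‖ - ‖φ y - φ x‖)]
  have h2 : ∫ x in p..q, ‖φ y‖ ^ 2 ≤ ∫ x in p..q, (2 * ‖φ x‖ ^ 2 + 2 * (q - p) * D) := by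
    apply intervalIntegral.integral_mono_on hpq _ _ h1
    all_goals apply Continuous.intervalIntegrable; fun_prop
  rw [intervalIntegral.integral_add, intervalIntegral.integral_const_mul] at h2
  · simp only [intervalIntegral.integral_const, smul_eq_mul] at h2
    nlinarith
  all_goals apply Continuous.intervalIntegrable; fun_prop

/-- sup bound -/
theorem ra_sup {φ φ' : ℝ → ℂ} (hd : ∀ y, HasDerivAt φ (φ' y) y) (hc : Continuous φ') {k y : ℝ}
    (hk : 1 ≤ k) (hy : y ∈ Icc (-1:ℝ) 1) :
    k * ‖φ y‖ ^ 2 ≤ 2 * ((∫ x in (-1:ℝ)..1, ‖φ' x‖ ^ 2) + k ^ 2 * ∫ x in (-1:ℝ)..1, ‖φ x‖ ^ 2) := by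
  have hφ : Continuous φ := continuous_iff_continuousAt.2 fun x => (hd x).continuousAt
  have hk0 : 0 < k := by linarith
  have hk1 : 1 / k ≤ 1 := by rw [div_le_one hk0]; exact hk
  have hk2 : 0 < 1 / k := by positivity
  obtain ⟨p, q, hpq, hp, hq, hyp⟩ : ∃ p q : ℝ, q - p = 1 / k ∧ -1 ≤ p ∧ q ≤ 1 ∧ y ∈ Icc p q := by
    rcases le_total y 0 with h | h
    · exact ⟨y, y + 1 / k, by ring, hy.1, by linarith, by constructor <;> linarith⟩
    · exact ⟨y - 1 / k, y, by ring, by linarith, hy.2, by constructor <;> linarith⟩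
  have h := ra_avg hd hc hyp
  rw [hpq] at h
  have h1 := ra_sub hφ hp (hyp.1.trans hyp.2) hq
  have h2 := ra_sub hc hp (hyp.1.trans hyp.2) hq
  have e : k * ‖φ y‖ ^ 2 = k ^ 2 * (1 / k * ‖φ y‖ ^ 2) := by field_simp
  rw [e]
  calc _ ≤ k ^ 2 * (2 * (∫ x in p..q, ‖φ x‖ ^ 2)
      + 2 * (1 / k) ^ 2 * ∫ x in p..q, ‖φ' x‖ ^ 2) := by gcongr
    _ = 2 * ((∫ x in p..q, ‖φ' x‖ ^ 2) + k ^ 2 * ∫ x in p..q, ‖φ x‖ ^ 2) := by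
      field_simp; ring
    _ ≤ _ := by gcongr

theorem ra_sing0 {t : ℝ} (_ : 0 ≤ t) :
    ∫ s in (0:ℝ)..t, s ^ (-(1/2) : ℝ) = 2 * √t := by
  rw [integral_rpow (by left; norm_num)]
  norm_num
  rw [Real.sqrt_eq_rpow]; ring

theorem ra_singabs {t : ℝ} (ht : 0 ≤ t) :
    IntervalIntegrable (fun s : ℝ => |s| ^ (-(1/2) : ℝ)) volume (-t) t ∧
    ∫ s in (-t)..t, |s| ^ (-(1/2) : ℝ) = 4 * √t := by
  have i1 : IntervalIntegrable (fun s : ℝ => |s| ^ (-(1/2) : ℝ)) volume 0 t := by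
    refine (intervalIntegral.intervalIntegrable_rpow' (r := -(1/2)) (by norm_num)).congr ?_
    intro x hx
    rw [uIoc_of_le ht] at hx
    simp [abs_of_pos hx.1]
  have i2 : IntervalIntegrable (fun s : ℝ => |s| ^ (-(1/2) : ℝ)) volume (-t) 0 := by
    have := ((IntervalIntegrable.iff_comp_neg (by finiteness)).1 i1).symm
    simpa using this
  refine ⟨i2.trans i1, ?_⟩
  rw [← intervalIntegral.integral_add_adjacent_intervals i2 i1]
  have e1 : ∫ s in (0:ℝ)..t, |s| ^ (-(1/2) : ℝ) = 2 * √t := by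
    rw [← ra_sing0 ht]
    apply intervalIntegral.integral_congr
    intro x hx
    rw [uIcc_of_le ht] at hx
    simp [abs_of_nonneg hx.1]
  have e2 : ∫ s in (-t)..0, |s| ^ (-(1/2) : ℝ) = 2 * √t := by
    rw [← e1]
    have := intervalIntegral.integral_comp_neg (a := 0) (b := t) (fun s : ℝ => |s| ^ (-(1/2) : ℝ))
    simp only [abs_neg, neg_zero] at this
    exact this.symm
  rw [e1, e2]; ring

theorem ra_sing {p q y0 K t : ℝ} {Φ : ℝ → ℂ} (hpq : p ≤ q) (hp : y0 - t ≤ p) (hq : q ≤ y0 + t)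
    (hK : 0 ≤ K) (hΦ : ∀ y ∈ Icc p q, y ≠ y0 → ‖Φ y‖ * √(|y - y0|) ≤ K) :
    ‖∫ y in p..q, Φ y‖ ≤ 4 * K * √t := by
  have ht : 0 ≤ t := by linarith
  obtain ⟨i1, e1⟩ := ra_singabs ht
  have i2 : IntervalIntegrable (fun y : ℝ => K * |y - y0| ^ (-(1/2) : ℝ)) volume (y0 - t) (y0 + t) := by
    have := (i1.comp_sub_right y0).const_mul K
    have e : -t + y0 = y0 - t := by ring
    rw [e, add_comm t] at this
    exact this
  have i3 : IntervalIntegrable (fun y : ℝ => K * |y - y0| ^ (-(1/2) : ℝ)) volume p q := by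
    apply i2.mono_set
    rw [uIcc_of_le hpq, uIcc_of_le (by linarith)]
    exact Icc_subset_Icc hp hq
  calc ‖∫ y in p..q, Φ y‖ ≤ ∫ y in p..q, K * |y - y0| ^ (-(1/2) : ℝ) := by
        apply intervalIntegral.norm_integral_le_of_norm_le hpq _ i3
        have : ∀ᵐ y : ℝ, y ≠ y0 := by
          simp [ae_iff, measure_singleton]
        filter_upwards [this] with y hy hyp
        have h := hΦ y ⟨hyp.1.le, hyp.2⟩ hy
        have hpos : 0 < |y - y0| := abs_pos.2 (sub_ne_zero.2 hy)
        rw [Real.rpow_neg hpos.le, ← Real.sqrt_eq_rpow, ← div_eq_mul_inv, le_div_iff₀ (by positivity)]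
        exact h
    _ ≤ ∫ y in (y0 - t)..(y0 + t), K * |y - y0| ^ (-(1/2) : ℝ) := by
        apply intervalIntegral.integral_mono_interval hp hpq hq _ i2
        exact Filter.Eventually.of_forall fun x => by positivity
    _ = 4 * K * √t := by
        rw [intervalIntegral.integral_const_mul]
        rw [intervalIntegral.integral_comp_sub_right (fun y : ℝ => |y| ^ (-(1/2) : ℝ)) y0]
        have e : y0 - t - y0 = -t := by ring
        rw [e, add_sub_cancel_left, e1]; ring

end AuxA

section AuxB
open Set

theorem ra_den_ge (x ε : ℝ) : |x| ≤ ‖((x:ℝ):ℂ) - ε * Complex.I‖ ∧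
    |ε| ≤ ‖((x:ℝ):ℂ) - ε * Complex.I‖ ∧ ‖((x:ℝ):ℂ) - ε * Complex.I‖ ^ 2 = x ^ 2 + ε ^ 2 := by
  refine ⟨?_, ?_, ?_⟩
  · have := Complex.abs_re_le_norm (((x:ℝ):ℂ) - ε * Complex.I); simpa using this
  · have := Complex.abs_im_le_norm (((x:ℝ):ℂ) - ε * Complex.I); simpa using this
  · rw [← Complex.normSq_eq_norm_sq, Complex.normSq_apply]; simp; ring

theorem ra_hold_cont {F : ℝ → ℂ} {H : ℝ} (h : ∀ s t, ‖F s - F t‖ ≤ H * √(|s - t|)) :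
    Continuous F := by
  rw [continuous_iff_continuousAt]
  intro t
  rw [ContinuousAt, tendsto_iff_norm_sub_tendsto_zero]
  apply squeeze_zero (fun _ => norm_nonneg _) (fun s => h s t)
  have : Continuous fun s : ℝ => H * √(|s - t|) := by fun_prop
  have h2 := this.tendsto t
  simpa using h2

theorem ra_far {p q c Λ S : ℝ} {F D : ℝ → ℂ} (hpq : p ≤ q) (hc : 0 < c) (hΛ : 0 < Λ)
    (hS : ∀ t ∈ Icc p q, ‖F t‖ ≤ S)
    (hD : ∀ t ∈ Icc p q, F t ≠ 0 → c * (Λ ^ 2 + t ^ 2) ≤ ‖D t‖) :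
    ‖∫ t in p..q, F t / D t‖ ≤ π / c * (S / Λ) := by
  have hS0 : 0 ≤ S := (norm_nonneg _).trans (hS p ⟨le_rfl, hpq⟩)
  calc ‖∫ t in p..q, F t / D t‖ ≤ ∫ t in p..q, S / c * (Λ ^ 2 + t ^ 2)⁻¹ := by
        apply intervalIntegral.norm_integral_le_of_norm_le hpq
        · refine Filter.Eventually.of_forall fun t ht => ?_
          have ht' : t ∈ Icc p q := ⟨ht.1.le, ht.2⟩
          by_cases h : F t = 0
          · simp only [h, zero_div, norm_zero]; positivity
          · rw [norm_div]
            have h1 := hD t ht' h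
            have h2 : 0 < c * (Λ ^ 2 + t ^ 2) := by positivity
            calc ‖F t‖ / ‖D t‖ ≤ S / (c * (Λ ^ 2 + t ^ 2)) := by
                  gcongr
                  exact hS t ht'
              _ = _ := by field_simp
        · apply Continuous.intervalIntegrable
          have : ∀ t : ℝ, Λ ^ 2 + t ^ 2 ≠ 0 := fun t => by positivity
          fun_prop (disch := assumption)
    _ = S / c * (Λ⁻¹ * (arctan (q / Λ) - arctan (p / Λ))) := by
        rw [intervalIntegral.integral_const_mul, integral_inv_sq_add_sq hΛ.ne']
    _ ≤ S / c * (Λ⁻¹ * π) := by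
        gcongr
        linarith [arctan_lt_pi_div_two (q / Λ), neg_pi_div_two_lt_arctan (p / Λ)]
    _ = _ := by field_simp

theorem ra_near {t0 δ m M ε L2 H S : ℝ} {v : ℝ → ℝ} {F : ℝ → ℂ} (ht0 : 0 < t0) (hδ : 0 < δ)
    (hδt : δ ≤ t0) (hm : 0 < m) (hM : 0 < M) (hε : ε ≠ 0) (hv : Continuous v)
    (hF : ∀ s t, ‖F s - F t‖ ≤ H * √(|s - t|)) (hS : ∀ t, ‖F t‖ ≤ S)
    (hlow : ∀ s, |s| ≤ δ → m / 2 * t0 * |s| ≤ |v (t0 + s) - L2|)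
    (hsd : ∀ s, 0 ≤ s → s ≤ δ → |v (t0 + s) + v (t0 - s) - 2 * L2| ≤ M * s ^ 2) :
    ‖∫ t in (t0 - δ)..(t0 + δ), F t / (((v t - L2 : ℝ) : ℂ) - ε * Complex.I)‖
      ≤ (8 / m + 4 * M / m ^ 2 + 2 * π / m) * (H / √t0 + S / t0) := by
  set D : ℝ → ℂ := fun t => ((v t - L2 : ℝ) : ℂ) - ε * Complex.I with hDdef
  have hFc := ra_hold_cont hF
  have hD0 : ∀ t, D t ≠ 0 := by
    intro t h
    have := (ra_den_ge (v t - L2) ε).2.1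
    simp only [hDdef] at h
    rw [h, norm_zero] at this
    exact hε (abs_nonpos_iff.1 this)
  have hDc : Continuous D := by simp only [hDdef]; fun_prop
  have hFD : Continuous fun t => F t / D t := hFc.div hDc hD0
  have hS0 : 0 ≤ S := (norm_nonneg _).trans (hS 0)
  have hH0 : 0 ≤ H := by
    have := (norm_nonneg _).trans (hF 1 0)
    simpa using this
  set c1 := m / 2 * t0 with hc1
  have hc1p : 0 < c1 := by positivity
  have hεp : 0 < |ε| := abs_pos.2 hε
  have split : ∫ t in (t0 - δ)..(t0 + δ), F t / D t
      = ∫ s in (0:ℝ)..δ, (F (t0 + s) / D (t0 + s) + F (t0 - s) / D (t0 - s)) := by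
    rw [intervalIntegral.integral_add]
    · rw [intervalIntegral.integral_comp_add_left (fun t => F t / D t),
        intervalIntegral.integral_comp_sub_left (fun t => F t / D t)]
      rw [add_zero, sub_zero]
      exact (intervalIntegral.integral_add_adjacent_intervals (hFD.intervalIntegrable _ _)
          (hFD.intervalIntegrable _ _)).symm.trans (add_comm _ _)
    · exact (hFD.comp (continuous_const.add continuous_id)).intervalIntegrable _ _
    · exact (hFD.comp (continuous_const.sub continuous_id)).intervalIntegrable _ _
  rw [split]
  set maj : ℝ → ℝ := fun s => (2 * H / c1) * s ^ (-(1/2) : ℝ) + (S * M / c1 ^ 2 +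
    (2 * S * |ε| / c1 ^ 2) * ((|ε| / c1) ^ 2 + s ^ 2)⁻¹) with hmaj
  have hne : ∀ s : ℝ, (|ε| / c1) ^ 2 + s ^ 2 ≠ 0 := fun s => by positivity
  have ii1 : IntervalIntegrable (fun s : ℝ => (2 * H / c1) * s ^ (-(1/2) : ℝ)) volume 0 δ :=
    (intervalIntegral.intervalIntegrable_rpow' (by norm_num)).const_mul _
  have cc2 : Continuous (fun s : ℝ => (2 * S * |ε| / c1 ^ 2) * ((|ε| / c1) ^ 2 + s ^ 2)⁻¹) := by
    fun_prop (disch := assumption)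
  have cc3 : Continuous (fun s : ℝ => S * M / c1 ^ 2 +
    (2 * S * |ε| / c1 ^ 2) * ((|ε| / c1) ^ 2 + s ^ 2)⁻¹) := continuous_const.add cc2
  have hmi : IntervalIntegrable maj volume 0 δ := ii1.add (cc3.intervalIntegrable _ _)
  have step1 : ‖∫ s in (0:ℝ)..δ, (F (t0 + s) / D (t0 + s) + F (t0 - s) / D (t0 - s))‖
      ≤ ∫ s in (0:ℝ)..δ, maj s := by
    apply intervalIntegral.norm_integral_le_of_norm_le hδ.le _ hmi
    refine Filter.Eventually.of_forall fun s hs => ?_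
    have hs0 : 0 < s := hs.1
    obtain ⟨p1, p2, p3⟩ := ra_den_ge (v (t0 + s) - L2) ε
    obtain ⟨q1, q2, q3⟩ := ra_den_ge (v (t0 - s) - L2) ε
    change _ ≤ ‖D (t0 + s)‖ at p1 p2
    change _ ≤ ‖D (t0 - s)‖ at q1 q2
    change ‖D (t0 + s)‖ ^ 2 = _ at p3
    change ‖D (t0 - s)‖ ^ 2 = _ at q3
    have l1 := hlow s (by rw [abs_of_pos hs0]; exact hs.2)
    have l2 := hlow (-s) (by rw [abs_neg, abs_of_pos hs0]; exact hs.2)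
    rw [abs_neg, ← sub_eq_add_neg] at l2
    rw [abs_of_pos hs0] at l1 l2
    have l3 := hsd s hs0.le hs.2
    have prod : c1 ^ 2 * s ^ 2 + ε ^ 2 ≤ ‖D (t0 + s)‖ * ‖D (t0 - s)‖ := by
      have a1 : c1 ^ 2 * s ^ 2 + ε ^ 2 ≤ ‖D (t0 + s)‖ ^ 2 := by
        rw [p3, ← sq_abs (v (t0 + s) - L2), ← mul_pow]; gcongr
      have a2 : c1 ^ 2 * s ^ 2 + ε ^ 2 ≤ ‖D (t0 - s)‖ ^ 2 := by
        rw [q3, ← sq_abs (v (t0 - s) - L2), ← mul_pow]; gcongr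
      apply le_of_sq_le_sq ?_ (by positivity)
      rw [mul_pow ‖D (t0 + s)‖, sq (c1 ^ 2 * s ^ 2 + ε ^ 2)]
      gcongr
    have hA : 0 < c1 ^ 2 * s ^ 2 + ε ^ 2 := by positivity
    have Dp := hD0 (t0 + s)
    have Dm := hD0 (t0 - s)
    have dec : F (t0 + s) / D (t0 + s) + F (t0 - s) / D (t0 - s)
       = (F (t0 + s) - F t0) / D (t0 + s) + (F (t0 - s) - F t0) / D (t0 - s)
         + F t0 * ((D (t0 + s) + D (t0 - s)) / (D (t0 + s) * D (t0 - s))) := by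
      field_simp; ring
    have sumD : ‖D (t0 + s) + D (t0 - s)‖ ≤ M * s ^ 2 + 2 * |ε| := by
      have : D (t0 + s) + D (t0 - s) = ((v (t0 + s) + v (t0 - s) - 2 * L2 : ℝ) : ℂ)
        - ((2 * ε : ℝ) : ℂ) * Complex.I := by
        simp only [hDdef]; push_cast; ring
      rw [this]
      refine (norm_sub_le _ _).trans ?_
      rw [norm_mul, Complex.norm_real, Complex.norm_real, Complex.norm_I, mul_one, Real.norm_eq_abs,
        Real.norm_eq_abs, abs_mul, abs_of_pos (by norm_num : (0:ℝ) < 2)]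
      gcongr
    have hsq : s ^ (-(1/2) : ℝ) = √s / s := by
      rw [Real.rpow_neg hs0.le, ← Real.sqrt_eq_rpow]
      rw [inv_eq_one_div, div_eq_div_iff (by positivity) (by positivity), Real.mul_self_sqrt hs0.le]; simp
    have b1 : ‖(F (t0 + s) - F t0) / D (t0 + s)‖ ≤ H * √s / (c1 * s) := by
      rw [norm_div]
      have := hF (t0 + s) t0
      rw [add_sub_cancel_left, abs_of_pos hs0] at this
      gcongr
      exact l1.trans p1
    have b2 : ‖(F (t0 - s) - F t0) / D (t0 - s)‖ ≤ H * √s / (c1 * s) := by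
      rw [norm_div]
      have := hF (t0 - s) t0
      rw [show t0 - s - t0 = -s by ring, abs_neg, abs_of_pos hs0] at this
      gcongr
      exact l2.trans q1
    have b3 : ‖F t0 * ((D (t0 + s) + D (t0 - s)) / (D (t0 + s) * D (t0 - s)))‖
        ≤ S * ((M * s ^ 2 + 2 * |ε|) / (c1 ^ 2 * s ^ 2 + ε ^ 2)) := by
      rw [norm_mul, norm_div, norm_mul]
      gcongr
      exact hS t0
    have b4 : (M * s ^ 2 + 2 * |ε|) / (c1 ^ 2 * s ^ 2 + ε ^ 2) ≤
        M / c1 ^ 2 + 2 * |ε| / c1 ^ 2 * ((|ε| / c1) ^ 2 + s ^ 2)⁻¹ := by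
      have e1 : 2 * |ε| / c1 ^ 2 * ((|ε| / c1) ^ 2 + s ^ 2)⁻¹ = 2 * |ε| / (c1 ^ 2 * s ^ 2 + ε ^ 2) := by
        rw [div_pow, sq_abs, ← div_eq_mul_inv, div_div]
        congr 1
        field_simp; ring
      rw [e1, add_div]
      gcongr ?_ + _
      rw [div_le_div_iff₀ hA (by positivity)]
      nlinarith [sq_nonneg ε]
    rw [dec]
    refine (norm_add₃_le).trans ?_
    simp only [hmaj]
    rw [hsq]
    have b5 := mul_le_mul_of_nonneg_left b4 hS0
    have e6 : 2 * H / c1 * (√s / s) = H * √s / (c1 * s) + H * √s / (c1 * s) := by field_simp; ring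
    rw [e6]
    have e7 : S * (M / c1 ^ 2 + 2 * |ε| / c1 ^ 2 * ((|ε| / c1) ^ 2 + s ^ 2)⁻¹) =
      S * M / c1 ^ 2 + 2 * S * |ε| / c1 ^ 2 * ((|ε| / c1) ^ 2 + s ^ 2)⁻¹ := by ring
    linarith
  refine step1.trans ?_
  have step2 : ∫ s in (0:ℝ)..δ, maj s = (2 * H / c1) * (2 * √δ) + (S * M / c1 ^ 2 * δ +
      (2 * S * |ε| / c1 ^ 2) * ((|ε| / c1)⁻¹ * (arctan (δ / (|ε| / c1)) - arctan (0 / (|ε| / c1))))) := by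
    simp only [hmaj]
    rw [intervalIntegral.integral_add ii1 (cc3.intervalIntegrable _ _),
      intervalIntegral.integral_add (by simp) (cc2.intervalIntegrable _ _),
      intervalIntegral.integral_const_mul, intervalIntegral.integral_const_mul, ra_sing0 hδ.le,
      integral_inv_sq_add_sq (by positivity)]
    simp only [intervalIntegral.integral_const, smul_eq_mul]
    ring
  rw [step2, zero_div, arctan_zero, sub_zero]
  have hat : arctan (δ / (|ε| / c1)) ≤ π / 2 := (arctan_lt_pi_div_two _).le
  have r1 : (2 * H / c1) * (2 * √δ) ≤ 8 / m * (H / √t0) := by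
    calc (2 * H / c1) * (2 * √δ) ≤ (2 * H / c1) * (2 * √t0) := by gcongr
      _ = 8 / m * (H / √t0) := by
        rw [hc1]
        have h1 : √t0 * √t0 = t0 := Real.mul_self_sqrt ht0.le
        have h2 : √t0 ≠ 0 := by positivity
        field_simp
        nlinarith
  have r2 : S * M / c1 ^ 2 * δ ≤ 4 * M / m ^ 2 * (S / t0) := by
    calc S * M / c1 ^ 2 * δ ≤ S * M / c1 ^ 2 * t0 := by gcongr
      _ = _ := by rw [hc1]; field_simp; ring
  have r3 : (2 * S * |ε| / c1 ^ 2) * ((|ε| / c1)⁻¹ * arctan (δ / (|ε| / c1))) ≤ 2 * π / m * (S / t0) := by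
    calc _ ≤ (2 * S * |ε| / c1 ^ 2) * ((|ε| / c1)⁻¹ * (π / 2)) := by gcongr
      _ = _ := by rw [hc1]; field_simp
  have hh : 0 ≤ H / √t0 := by positivity
  have hs : 0 ≤ S / t0 := by positivity
  have k1 : 0 ≤ 4 * M / m ^ 2 * (H / √t0) := by positivity
  have k2 : 0 ≤ 2 * π / m * (H / √t0) := by positivity
  have k3 : 0 ≤ 8 / m * (S / t0) := by positivity
  nlinarith

end AuxB

section AuxC
open Set

set_option maxHeartbeats 2000000 in
theorem ra_half {b d m M B : ℝ} (hd : 0 < d) (hdb : d < b) (hm : 0 < m) (hM : 1 ≤ M) (hB : 0 < B) :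
    ∃ C : ℝ, 0 < C ∧ ∀ (v : ℝ → ℝ) (F : ℝ → ℂ) (L2 ε H S : ℝ), Continuous v → v 0 = 0 →
      (∀ s t, 0 ≤ s → s ≤ t → t ≤ b → m / 2 * (t ^ 2 - s ^ 2) ≤ v t - v s) →
      (∀ t, 0 ≤ t → t ≤ b → v t ≤ M / 2 * t ^ 2) →
      (∀ t s, 0 ≤ s → s ≤ t → t + s ≤ b → |v (t + s) + v (t - s) - 2 * v t| ≤ M * s ^ 2) →
      0 ≤ L2 → L2 ≤ B → ε ≠ 0 → |ε| ≤ B →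
      (∀ s t, ‖F s - F t‖ ≤ H * √(|s - t|)) → (∀ t, ‖F t‖ ≤ S) →
      (∀ t, b - d ≤ t → F t = 0) →
      ‖∫ t in (0:ℝ)..b, F t / (((v t - L2 : ℝ) : ℂ) - ε * Complex.I)‖
        ≤ C * (H / √(√(L2 + |ε|)) + S / √(L2 + |ε|)) := by
  have hb : 0 < b := hd.trans hdb
  set θ := d / (2 * b) with hθ
  have hθ0 : 0 < θ := by positivity
  have hθ2 : θ ≤ 1 / 2 := by
    rw [hθ, div_le_div_iff₀ (by positivity) (by norm_num)]; linarith
  set ca := min 1 (m / 2) / 4 with hca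
  set cb := m / 2 * d * b / (2 * B + b ^ 2) with hcb
  set cc := m * θ / (6 * M) with hcc
  set c0 := min ca (min cb cc) with hc0
  have hM0 : 0 < M := by linarith
  have hca0 : 0 < ca := by simp only [hca]; positivity
  have hcb0 : 0 < cb := by positivity
  have hcc0 : 0 < cc := by positivity
  have hc00 : 0 < c0 := by simp only [hc0]; positivity
  have hc0a : c0 ≤ ca := min_le_left _ _
  have hc0b : c0 ≤ cb := (min_le_right _ _).trans (min_le_left _ _)
  have hc0c : c0 ≤ cc := (min_le_right _ _).trans (min_le_right _ _)
  set CN := 8 / m + 4 * M / m ^ 2 + 2 * π / m with hCN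
  have hCN0 : 0 < CN := by positivity
  refine ⟨2 * (π / c0) + CN * M, by positivity, ?_⟩
  intro v F L2 ε H S hv hv0 hlow hup hsd hL0 hLB hε hεB hF hS hFz
  have hεp : 0 < |ε| := abs_pos.2 hε
  set Λ := √(L2 + |ε|) with hΛ
  have hΛ0 : 0 < Λ := by positivity
  have hΛ2 : Λ ^ 2 = L2 + |ε| := Real.sq_sqrt (by positivity)
  have hS0 : 0 ≤ S := (norm_nonneg _).trans (hS 0)
  have hH0 : 0 ≤ H := by
    have := (norm_nonneg _).trans (hF 1 0)
    simpa using this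
  have hFc := ra_hold_cont hF
  set D : ℝ → ℂ := fun t => ((v t - L2 : ℝ) : ℂ) - ε * Complex.I with hDdef
  have hD0 : ∀ t, D t ≠ 0 := by
    intro t h
    have := (ra_den_ge (v t - L2) ε).2.1
    simp only [hDdef] at h
    rw [h, norm_zero] at this
    exact hε (abs_nonpos_iff.1 this)
  have hDc : Continuous D := by simp only [hDdef]; fun_prop
  have hFD : Continuous fun t => F t / D t := hFc.div hDc hD0
  have hDge : ∀ t, |v t - L2| ≤ ‖D t‖ := fun t => (ra_den_ge (v t - L2) ε).1
  have hDge' : ∀ t, |ε| ≤ ‖D t‖ := fun t => (ra_den_ge (v t - L2) ε).2.1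
  have e0 : 0 ≤ H / √Λ := by positivity
  have e1 : 0 ≤ S / Λ := by positivity
  have e2 : 0 ≤ π / c0 := by positivity
  have hFb : ∀ t, F t ≠ 0 → t < b - d := fun t h => by
    by_contra h'; exact h (hFz t (by linarith))
  -- all-far case
  have allfar : (∀ t ∈ Icc 0 b, F t ≠ 0 → c0 * (Λ ^ 2 + t ^ 2) ≤ ‖D t‖) →
      ‖∫ t in (0:ℝ)..b, F t / D t‖ ≤ (2 * (π / c0) + CN * M) * (H / √Λ + S / Λ) := by
    intro h
    refine (ra_far hb.le hc00 hΛ0 (fun t _ => hS t) h).trans ?_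
    have : 0 ≤ CN * M * (H / √Λ + S / Λ) := by positivity
    linarith [mul_nonneg e2 e0, mul_nonneg e2 e1]
  by_cases hcase : L2 ≤ |ε|
  · apply allfar
    intro t ht _
    have h1 := hlow 0 t le_rfl ht.1 ht.2
    rw [hv0] at h1
    have h2 := le_abs_self (v t - L2)
    have h3 := hDge t
    have h4 := hDge' t
    have h5 : c0 ≤ 1 / 4 := hc0a.trans (by
      rw [hca]; have := min_le_left 1 (m/2); linarith)
    have h6 : c0 ≤ m / 8 := hc0a.trans (by
      rw [hca]; have := min_le_right 1 (m/2); linarith)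
    have h7 : c0 * Λ ^ 2 ≤ 1 / 4 * Λ ^ 2 := by gcongr
    have h8 : c0 * t ^ 2 ≤ m / 8 * t ^ 2 := by gcongr
    linarith
  push Not at hcase
  by_cases hroot : v b < L2
  · apply allfar
    intro t ht hFt
    have htb := hFb t hFt
    have h1 := hlow t b ht.1 ht.2 le_rfl
    have h2 := neg_le_abs (v t - L2)
    have h3 := hDge t
    have h4 : m / 2 * (d * b) ≤ m / 2 * (b ^ 2 - t ^ 2) := by
      have h40 : d * b ≤ (b - t) * (b + t) :=
        mul_le_mul (by linarith) (by linarith [ht.1]) hb.le (by linarith)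
      have h41 : (b - t) * (b + t) = b ^ 2 - t ^ 2 := by ring
      rw [← h41]
      exact mul_le_mul_of_nonneg_left h40 (by positivity)
    have h5 : c0 * (Λ ^ 2 + t ^ 2) ≤ cb * (2 * B + b ^ 2) := by
      have := ht.1
      gcongr
      · linarith
      · exact ht.2
    have h6 : cb * (2 * B + b ^ 2) = m / 2 * (d * b) := by rw [hcb]; field_simp
    linarith
  push Not at hroot
  obtain ⟨t0, ht0, hvt0⟩ : ∃ t0 ∈ Icc 0 b, v t0 = L2 := by
    have := intermediate_value_Icc hb.le hv.continuousOn
    exact this ⟨by rw [hv0]; exact hL0, hroot⟩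
  have hL2p : 0 < L2 := lt_of_le_of_lt (abs_nonneg _) hcase
  have ht0p : 0 < t0 := by
    rcases ht0.1.lt_or_eq with h | h
    · exact h
    · exfalso; rw [← h, hv0] at hvt0; linarith
  have ht0Λ : Λ ^ 2 ≤ M * t0 ^ 2 := by
    have := hup t0 ht0.1 ht0.2
    linarith
  have hgap : ∀ t ∈ Icc 0 b, m / 2 * (|t - t0| * (t + t0)) ≤ |v t - L2| := by
    intro t ht
    rw [← hvt0]
    rcases le_total t t0 with h | h
    · have := hlow t t0 ht.1 h ht0.2
      rw [abs_of_nonpos (by linarith : t - t0 ≤ 0)]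
      refine le_trans ?_ (neg_le_abs _)
      linarith
    · have := hlow t0 t ht0.1 h ht.2
      rw [abs_of_nonneg (by linarith : 0 ≤ t - t0)]
      refine le_trans ?_ (le_abs_self _)
      linarith
  have hfar : ∀ t ∈ Icc 0 b, θ * t0 ≤ |t - t0| → c0 * (Λ ^ 2 + t ^ 2) ≤ ‖D t‖ := by
    intro t ht hh
    have h1 := (hgap t ht).trans (hDge t)
    have ht0' := ht.1
    have h2 : θ / 3 * (t + t0) ≤ |t - t0| := by
      rcases le_total t (2 * t0) with h | h
      · linarith [mul_le_mul_of_nonneg_left h hθ0.le]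
      · rw [abs_of_nonneg (by linarith)]; linarith [mul_le_mul_of_nonneg_right hθ2 (by linarith : 0 ≤ t + t0)]
    have h3 : m / 2 * (θ / 3 * (t + t0) * (t + t0)) ≤ m / 2 * (|t - t0| * (t + t0)) := by
      gcongr
    have h4 : c0 * (Λ ^ 2 + t ^ 2) ≤ cc * (M * t0 ^ 2 + M * t ^ 2) := by
      gcongr
      exact le_mul_of_one_le_left (sq_nonneg t) hM
    have h5 : cc * (M * t0 ^ 2 + M * t ^ 2) = m * θ / 6 * (t0 ^ 2 + t ^ 2) := by
      rw [hcc]; field_simp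
    have h6 : m * θ / 6 * (t0 ^ 2 + t ^ 2) ≤ m / 2 * (θ / 3 * (t + t0) * (t + t0)) := by
      have : 0 ≤ m * θ * (t * t0) := by positivity
      linarith
    linarith
  have hθt : θ * t0 ≤ d / 2 := by
    calc θ * t0 ≤ θ * b := by gcongr; exact ht0.2
      _ = d / 2 := by rw [hθ]; field_simp
  by_cases hend : b - d / 2 < t0
  · apply allfar
    intro t ht hFt
    apply hfar t ht
    have := hFb t hFt
    rw [abs_of_nonpos (by linarith)]
    linarith
  push Not at hend
  set δ := θ * t0 with hδ
  have hδ0 : 0 < δ := by positivity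
  have hδt : δ ≤ t0 / 2 := by linarith [mul_le_mul_of_nonneg_right hθ2 ht0p.le]
  have s1 : ∫ t in (0:ℝ)..b, F t / D t = (∫ t in (0:ℝ)..(t0 - δ), F t / D t)
      + (∫ t in (t0 - δ)..(t0 + δ), F t / D t) + ∫ t in (t0 + δ)..b, F t / D t := by
    rw [intervalIntegral.integral_add_adjacent_intervals, intervalIntegral.integral_add_adjacent_intervals]
    all_goals exact hFD.intervalIntegrable _ _
  have f1 : ‖∫ t in (0:ℝ)..(t0 - δ), F t / D t‖ ≤ π / c0 * (S / Λ) := by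
    apply ra_far (by linarith) hc00 hΛ0 (fun t _ => hS t)
    intro t ht _
    apply hfar t ⟨ht.1, by linarith [ht.2]⟩
    rw [abs_of_nonpos (by linarith [ht.2])]; linarith [ht.2]
  have f2 : ‖∫ t in (t0 + δ)..b, F t / D t‖ ≤ π / c0 * (S / Λ) := by
    apply ra_far (by linarith) hc00 hΛ0 (fun t _ => hS t)
    intro t ht _
    apply hfar t ⟨by linarith [ht.1], ht.2⟩
    rw [abs_of_nonneg (by linarith [ht.1])]; linarith [ht.1]
  have f3 : ‖∫ t in (t0 - δ)..(t0 + δ), F t / D t‖ ≤ CN * (H / √t0 + S / t0) := by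
    apply ra_near ht0p hδ0 (by linarith) hm hM0 hε hv hF hS
    · intro s hs
      rw [abs_le] at hs
      have := hgap (t0 + s) ⟨by linarith [hs.1], by linarith [hs.2]⟩
      rw [add_sub_cancel_left] at this
      refine le_trans ?_ this
      have : |s| * t0 ≤ |s| * (t0 + s + t0) := by gcongr; linarith [hs.1]
      linarith [mul_le_mul_of_nonneg_left this (by linarith : 0 ≤ m / 2)]
    · intro s hs0 hs
      rw [← hvt0]
      exact hsd t0 s hs0 (by linarith) (by linarith)
  have ht0Λ' : Λ ≤ M * t0 := by
    apply le_of_sq_le_sq ?_ (by positivity)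
    linarith [le_mul_of_one_le_left (by positivity : 0 ≤ M * t0 ^ 2) hM]
  have g1 : S / t0 ≤ M * (S / Λ) := by
    rw [div_le_iff₀ ht0p]
    calc S = S / Λ * Λ := by field_simp
      _ ≤ S / Λ * (M * t0) := by gcongr
      _ = _ := by ring
  have g2 : H / √t0 ≤ M * (H / √Λ) := by
    have h1 : √Λ ≤ M * √t0 := by
      apply Real.sqrt_le_iff.2 ⟨by positivity, ?_⟩
      rw [mul_pow, Real.sq_sqrt ht0p.le]
      linarith [le_mul_of_one_le_left (by positivity : 0 ≤ M * t0) hM]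
    have h2 : 0 < √Λ := by positivity
    rw [div_le_iff₀ (by positivity)]
    calc H = H / √Λ * √Λ := by field_simp
      _ ≤ H / √Λ * (M * √t0) := by gcongr
      _ = _ := by ring
  rw [s1]
  refine (norm_add₃_le).trans ?_
  have g3 : CN * (H / √t0 + S / t0) ≤ CN * (M * (H / √Λ) + M * (S / Λ)) := by gcongr
  linarith [mul_nonneg e2 e0]

end AuxC

section AuxD
open Set

/-- Denominator `u - c` with `c = cr + i ε`. -/
def rf (u : ℝ → ℝ) (cr ε y : ℝ) : ℂ := ((u y - cr : ℝ) : ℂ) - ε * Complex.I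

/-- Geometric data on the shear profile near and away from its critical point. -/
structure RGeo (u u1 u2 u3 ρ ρ1 : ℝ → ℝ) (yc m M d r : ℝ) : Prop where
  hu : ∀ y, HasDerivAt u (u1 y) y
  hu1 : ∀ y, HasDerivAt u1 (u2 y) y
  hu2 : ∀ y, HasDerivAt u2 (u3 y) y
  hu3 : Continuous u3
  hρ : ∀ y, HasDerivAt ρ (ρ1 y) y
  hρ1 : Continuous ρ1
  m0 : 0 < m
  m1 : m ≤ 1
  M1 : 1 ≤ M
  d0 : 0 < d
  r0 : 0 < r
  hl : -1 ≤ yc - 2 * r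
  hr : yc + 2 * r ≤ 1
  low : ∀ y ∈ Icc (-1 - d) (1 + d), m * (y - yc) ^ 2 ≤ u1 y * (y - yc)
  up : ∀ y ∈ Icc (-1 - d) (1 + d), |u1 y| ≤ M * |y - yc|
  b2 : ∀ y ∈ Icc (-1 - d) (1 + d), |u2 y| ≤ M
  b3 : ∀ y ∈ Icc (-1:ℝ) 1, |u3 y| ≤ M
  pos : ∀ y, |y - yc| ≤ 2 * r → m ≤ u2 y
  pic : ∀ y, |y - yc| ≤ 2 * r → u2 y * (y - yc) ^ 2 ≤ 2 * (u1 y * (y - yc))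
  rone : ∀ y, |y - yc| ≤ r → ρ y * u2 y = 1
  rl : ρ (-1) = 0
  rr : ρ 1 = 0
  rb : ∀ y ∈ Icc (-1:ℝ) 1, |ρ y| ≤ M
  rb1 : ∀ y ∈ Icc (-1:ℝ) 1, |ρ1 y| ≤ M

/-- One-sided geometry: consequences of derivative bounds for a half-line profile. -/
theorem ra_side {v v1 v2 : ℝ → ℝ} {b m M : ℝ} (hv : ∀ t, HasDerivAt v (v1 t) t)
    (hv1 : ∀ t, HasDerivAt v1 (v2 t) t) (hlow : ∀ t, 0 ≤ t → t ≤ b → m * t ≤ v1 t)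
    (hup : ∀ t, 0 ≤ t → t ≤ b → v1 t ≤ M * t) (hb2 : ∀ t, 0 ≤ t → t ≤ b → |v2 t| ≤ M) :
    (∀ s t, 0 ≤ s → s ≤ t → t ≤ b → m / 2 * (t ^ 2 - s ^ 2) ≤ v t - v s) ∧
    (∀ s t, 0 ≤ s → s ≤ t → t ≤ b → v t - v s ≤ M / 2 * (t ^ 2 - s ^ 2)) ∧
    (∀ t s, 0 ≤ s → s ≤ t → t + s ≤ b → |v (t + s) + v (t - s) - 2 * v t| ≤ M * s ^ 2) := by
  have mono : ∀ (w w1 : ℝ → ℝ) (p q : ℝ), p ≤ q → (∀ t, HasDerivAt w (w1 t) t) →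
      (∀ t, p ≤ t → t ≤ q → 0 ≤ w1 t) → w p ≤ w q := by
    intro w w1 p q hpq hw h0
    have hm : MonotoneOn w (Icc p q) := by
      apply monotoneOn_of_deriv_nonneg (convex_Icc p q)
      · exact fun t _ => (hw t).continuousAt.continuousWithinAt
      · exact fun t _ => (hw t).differentiableAt.differentiableWithinAt
      · intro t ht
        rw [interior_Icc] at ht
        rw [(hw t).deriv]
        exact h0 t ht.1.le ht.2.le
    exact hm ⟨le_rfl, hpq⟩ ⟨hpq, le_rfl⟩ hpq
  refine ⟨?_, ?_, ?_⟩
  · intro s t hs hst htb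
    have := mono (fun t => v t - m / 2 * t ^ 2) (fun t => v1 t - m * t) s t hst
      (fun t => by
        have := (hv t).sub ((hasDerivAt_pow 2 t).const_mul (m / 2))
        exact this.congr_deriv (by norm_num; ring))
      (fun t h1 h2 => by
        have := hlow t (hs.trans h1) (h2.trans htb)
        linarith)
    linarith
  · intro s t hs hst htb
    have := mono (fun t => M / 2 * t ^ 2 - v t) (fun t => M * t - v1 t) s t hst
      (fun t => by
        have := ((hasDerivAt_pow 2 t).const_mul (M / 2)).sub (hv t)
        exact this.congr_deriv (by norm_num; ring))
      (fun t h1 h2 => by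
        have := hup t (hs.trans h1) (h2.trans htb)
        linarith)
    linarith
  · intro t s hs hst htb
    have lip : ∀ s', 0 ≤ s' → s' ≤ s → |v1 (t + s') - v1 (t - s')| ≤ M * (2 * s') := by
      intro s' h0 h1
      have := (convex_Icc (0:ℝ) b).norm_image_sub_le_of_norm_hasDerivWithin_le (f := v1) (f' := v2)
        (C := M) (x := t - s') (y := t + s') (fun x _ => (hv1 x).hasDerivWithinAt)
        (fun x hx => hb2 x hx.1 hx.2) ⟨by linarith, by linarith⟩ ⟨by linarith, by linarith⟩
      rw [Real.norm_eq_abs, Real.norm_eq_abs] at this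
      rwa [show t + s' - (t - s') = 2 * s' by ring, abs_of_nonneg (by linarith : 0 ≤ 2 * s')] at this
    have hda : ∀ s', HasDerivAt (fun s => v (t + s) + v (t - s) - 2 * v t) (v1 (t + s') - v1 (t - s')) s' := by
      intro s'
      have h1 : HasDerivAt (fun s => v (t + s)) (v1 (t + s')) s' := (hv (t + s')).comp_const_add t s'
      have h2 : HasDerivAt (fun s => v (t - s)) (-v1 (t - s')) s' := (hv (t - s')).comp_const_sub t s'
      have := (h1.add h2).sub_const (2 * v t)
      rwa [← sub_eq_add_neg] at this
    have hq : ∀ s' : ℝ, HasDerivAt (fun s => M * s ^ 2) (M * (2 * s')) s' := by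
      intro s'
      have := (hasDerivAt_pow 2 s').const_mul M
      simpa using this
    rw [abs_le]
    constructor
    · have := mono _ _ 0 s hs (fun s' => (hq s').add (hda s')) (fun s' h0 h1 => by
        have := neg_le_of_abs_le (lip s' h0 h1); linarith)
      simp only [Pi.add_apply, add_zero, sub_zero] at this
      linarith
    · have := mono _ _ 0 s hs (fun s' => (hq s').sub (hda s')) (fun s' h0 h1 => by
        have := le_of_abs_le (lip s' h0 h1); linarith)
      simp only [Pi.sub_apply, add_zero, sub_zero] at this
      linarith

theorem rf_ne {u : ℝ → ℝ} {cr ε : ℝ} (hε : ε ≠ 0) (y : ℝ) : rf u cr ε y ≠ 0 := by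
  intro h
  have := (ra_den_ge (u y - cr) ε).2.1
  unfold rf at h
  rw [h, norm_zero] at this
  exact hε (abs_nonpos_iff.1 this)

theorem rf_cont {u : ℝ → ℝ} (hu : Continuous u) (cr ε : ℝ) : Continuous (rf u cr ε) := by
  unfold rf; fun_prop

variable {u u1 u2 u3 ρ ρ1 : ℝ → ℝ} {yc m M d r : ℝ}

theorem RGeo.cu (g : RGeo u u1 u2 u3 ρ ρ1 yc m M d r) : Continuous u :=
  continuous_iff_continuousAt.2 fun y => (g.hu y).continuousAt
theorem RGeo.cu1 (g : RGeo u u1 u2 u3 ρ ρ1 yc m M d r) : Continuous u1 :=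
  continuous_iff_continuousAt.2 fun y => (g.hu1 y).continuousAt
theorem RGeo.cu2 (g : RGeo u u1 u2 u3 ρ ρ1 yc m M d r) : Continuous u2 :=
  continuous_iff_continuousAt.2 fun y => (g.hu2 y).continuousAt
theorem RGeo.cρ (g : RGeo u u1 u2 u3 ρ ρ1 yc m M d r) : Continuous ρ :=
  continuous_iff_continuousAt.2 fun y => (g.hρ y).continuousAt

/-- right side profile facts -/
theorem RGeo.right (g : RGeo u u1 u2 u3 ρ ρ1 yc m M d r) :
    (∀ s t, 0 ≤ s → s ≤ t → t ≤ 1 + d - yc → m / 2 * (t ^ 2 - s ^ 2) ≤ u (yc + t) - u (yc + s)) ∧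
    (∀ s t, 0 ≤ s → s ≤ t → t ≤ 1 + d - yc → u (yc + t) - u (yc + s) ≤ M / 2 * (t ^ 2 - s ^ 2)) ∧
    (∀ t s, 0 ≤ s → s ≤ t → t + s ≤ 1 + d - yc →
      |u (yc + (t + s)) + u (yc + (t - s)) - 2 * u (yc + t)| ≤ M * s ^ 2) := by
  have hr := g.hr
  have hl := g.hl
  have hr0 := g.r0
  have hd := g.d0
  apply ra_side (v := fun t => u (yc + t)) (v1 := fun t => u1 (yc + t)) (v2 := fun t => u2 (yc + t))
  · exact fun t => (g.hu (yc + t)).comp_const_add yc t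
  · exact fun t => (g.hu1 (yc + t)).comp_const_add yc t
  · intro t h0 h1
    have := g.low (yc + t) ⟨by linarith, by linarith⟩
    rw [add_sub_cancel_left] at this
    rcases h0.eq_or_lt with h | h
    · have h2 := g.up (yc + t) ⟨by linarith, by linarith⟩
      rw [add_sub_cancel_left, ← h, abs_zero, mul_zero] at h2
      rw [← h, abs_nonpos_iff.1 h2, mul_zero]
    · have e : m * t * t ≤ u1 (yc + t) * t := by linarith
      exact le_of_mul_le_mul_right e h
  · intro t h0 h1
    have := g.up (yc + t) ⟨by linarith, by linarith⟩
    rw [add_sub_cancel_left, abs_of_nonneg h0] at this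
    exact (le_abs_self _).trans this
  · intro t h0 h1
    exact g.b2 (yc + t) ⟨by linarith, by linarith⟩

/-- left side profile facts -/
theorem RGeo.left (g : RGeo u u1 u2 u3 ρ ρ1 yc m M d r) :
    (∀ s t, 0 ≤ s → s ≤ t → t ≤ 1 + d + yc → m / 2 * (t ^ 2 - s ^ 2) ≤ u (yc - t) - u (yc - s)) ∧
    (∀ s t, 0 ≤ s → s ≤ t → t ≤ 1 + d + yc → u (yc - t) - u (yc - s) ≤ M / 2 * (t ^ 2 - s ^ 2)) ∧
    (∀ t s, 0 ≤ s → s ≤ t → t + s ≤ 1 + d + yc →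
      |u (yc - (t + s)) + u (yc - (t - s)) - 2 * u (yc - t)| ≤ M * s ^ 2) := by
  have hr := g.hr
  have hl := g.hl
  have hr0 := g.r0
  have hd := g.d0
  apply ra_side (v := fun t => u (yc - t)) (v1 := fun t => - u1 (yc - t)) (v2 := fun t => u2 (yc - t))
  · exact fun t => (g.hu (yc - t)).comp_const_sub yc t
  · intro t
    have := ((g.hu1 (yc - t)).comp_const_sub yc t).neg
    rwa [neg_neg] at this
  · intro t h0 h1
    have := g.low (yc - t) ⟨by linarith, by linarith⟩
    rw [show yc - t - yc = -t by ring] at this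
    rcases h0.eq_or_lt with h | h
    · have h2 := g.up (yc - t) ⟨by linarith, by linarith⟩
      rw [show yc - t - yc = -t by ring, ← h, neg_zero, abs_zero, mul_zero] at h2
      rw [← h, abs_nonpos_iff.1 h2, mul_zero, neg_zero]
    · have e : m * t * t ≤ - u1 (yc - t) * t := by linarith
      exact le_of_mul_le_mul_right e h
  · intro t h0 h1
    have := g.up (yc - t) ⟨by linarith, by linarith⟩
    rw [show yc - t - yc = -t by ring, abs_neg, abs_of_nonneg h0] at this
    exact (neg_le_abs _).trans this
  · intro t h0 h1
    exact g.b2 (yc - t) ⟨by linarith, by linarith⟩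

/-- Principal value lemma. -/
theorem RGeo.pv (g : RGeo u u1 u2 u3 ρ ρ1 yc m M d r) {B : ℝ} (hB : 0 < B) :
    ∃ C : ℝ, 0 < C ∧ ∀ (F : ℝ → ℂ) (cr ε H S : ℝ), 0 ≤ cr - u yc → cr - u yc ≤ B → ε ≠ 0 → |ε| ≤ B →
      (∀ s t, ‖F s - F t‖ ≤ H * √(|s - t|)) → (∀ t, ‖F t‖ ≤ S) →
      (∀ t, t ∉ Ioo (-1:ℝ) 1 → F t = 0) →
      ‖∫ y in (-1:ℝ)..1, F y / rf u cr ε y‖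
        ≤ C * (H / √(√(cr - u yc + |ε|)) + S / √(cr - u yc + |ε|)) := by
  have hr := g.hr
  have hl := g.hl
  have hr0 := g.r0
  have hd := g.d0
  obtain ⟨C1, hC1, h1⟩ := ra_half (b := 1 + d - yc) hd (by linarith) g.m0 g.M1 hB
  obtain ⟨C2, hC2, h2⟩ := ra_half (b := 1 + d + yc) hd (by linarith) g.m0 g.M1 hB
  refine ⟨C1 + C2, by positivity, ?_⟩
  intro F cr ε H S hL0 hLB hε hεB hF hS hFz
  obtain ⟨r1, r2, r3⟩ := g.right
  obtain ⟨l1, l2, l3⟩ := g.left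
  have hc := g.cu
  have k1 := h1 (fun t => u (yc + t) - u yc) (fun t => F (yc + t)) (cr - u yc) ε H S
    (by fun_prop) (by simp)
    (fun s t a b c => by have := r1 s t a b c; linarith)
    (fun t a b => by have := r2 0 t le_rfl a b; rw [add_zero] at this; linarith)
    (fun t s a b c => by
      have := r3 t s a b c
      rwa [show u (yc + (t + s)) - u yc + (u (yc + (t - s)) - u yc) - 2 * (u (yc + t) - u yc)
        = u (yc + (t + s)) + u (yc + (t - s)) - 2 * u (yc + t) by ring])
    hL0 hLB hε hεB (fun s t => by have := hF (yc + s) (yc + t); rwa [add_sub_add_left_eq_sub] at this)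
    (fun t => hS _) (fun t ht => hFz _ (fun h => by linarith [h.2]))
  have k2 := h2 (fun t => u (yc - t) - u yc) (fun t => F (yc - t)) (cr - u yc) ε H S
    (by fun_prop) (by simp)
    (fun s t a b c => by have := l1 s t a b c; linarith)
    (fun t a b => by have := l2 0 t le_rfl a b; rw [sub_zero] at this; linarith)
    (fun t s a b c => by
      have := l3 t s a b c
      rwa [show u (yc - (t + s)) - u yc + (u (yc - (t - s)) - u yc) - 2 * (u (yc - t) - u yc)
        = u (yc - (t + s)) + u (yc - (t - s)) - 2 * u (yc - t) by ring])
    hL0 hLB hε hεB (fun s t => by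
      have := hF (yc - s) (yc - t)
      rwa [show yc - s - (yc - t) = -(s - t) by ring, abs_neg] at this)
    (fun t => hS _) (fun t ht => hFz _ (fun h => by linarith [h.1]))
  have hFc := ra_hold_cont hF
  set Φ : ℝ → ℂ := fun y => F y / rf u cr ε y with hΦ
  have hΦc : Continuous Φ := hFc.div (rf_cont hc cr ε) (rf_ne hε)
  have i1 : ∫ t in (0:ℝ)..(1 + d - yc), F (yc + t) / (((u (yc + t) - u yc - (cr - u yc) : ℝ) : ℂ) - ε * Complex.I)
      = ∫ y in yc..(1 + d), Φ y := by
    have := intervalIntegral.integral_comp_add_left (a := 0) (b := 1 + d - yc) Φ yc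
    rw [add_zero, show yc + (1 + d - yc) = 1 + d by ring] at this
    rw [← this]
    congr 1; funext t; simp only [hΦ, rf]; rw [sub_sub_sub_cancel_right]
  have i2 : ∫ t in (0:ℝ)..(1 + d + yc), F (yc - t) / (((u (yc - t) - u yc - (cr - u yc) : ℝ) : ℂ) - ε * Complex.I)
      = ∫ y in (-1 - d)..yc, Φ y := by
    have := intervalIntegral.integral_comp_sub_left (a := 0) (b := 1 + d + yc) Φ yc
    rw [sub_zero, show yc - (1 + d + yc) = -1 - d by ring] at this
    rw [← this]
    congr 1; funext t; simp only [hΦ, rf]; rw [sub_sub_sub_cancel_right]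
  have z1 : ∫ y in (1:ℝ)..(1 + d), Φ y = 0 := by
    rw [intervalIntegral.integral_congr (g := fun _ => 0)]
    · simp
    · intro y hy
      rw [uIcc_of_le (by linarith)] at hy
      simp only [hΦ]
      rw [hFz y (fun h => by linarith [h.2, hy.1]), zero_div]
  have z2 : ∫ y in (-1 - d)..(-1), Φ y = 0 := by
    rw [intervalIntegral.integral_congr (g := fun _ => 0)]
    · simp
    · intro y hy
      rw [uIcc_of_le (by linarith)] at hy
      simp only [hΦ]
      rw [hFz y (fun h => by linarith [h.1, hy.2]), zero_div]
  have hI : ∀ a b, IntervalIntegrable Φ volume a b := fun a b => hΦc.intervalIntegrable a b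
  have e : ∫ y in (-1:ℝ)..1, Φ y = (∫ y in (-1 - d)..yc, Φ y) + ∫ y in yc..(1 + d), Φ y := by
    rw [intervalIntegral.integral_add_adjacent_intervals (hI _ _) (hI _ _)]
    rw [← intervalIntegral.integral_add_adjacent_intervals (hI (-1 - d) 1) (hI 1 (1 + d)),
      ← intervalIntegral.integral_add_adjacent_intervals (hI (-1 - d) (-1)) (hI (-1) 1), z1, z2]
    simp
  rw [e, ← i1, ← i2]
  refine (norm_add_le _ _).trans ?_
  rw [add_mul]
  linarith [k1, k2]

end AuxD

section AuxE
open Set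

/-- squared `k`-weighted `H¹` norm -/
def rN (k : ℝ) (φ φ1 : ℝ → ℂ) : ℝ :=
  (∫ y in (-1:ℝ)..1, ‖φ1 y‖ ^ 2) + k ^ 2 * ∫ y in (-1:ℝ)..1, ‖φ y‖ ^ 2

theorem rI_nonneg (φ : ℝ → ℂ) {a b : ℝ} (h : a ≤ b) : 0 ≤ ∫ y in a..b, ‖φ y‖ ^ 2 :=
  intervalIntegral.integral_nonneg h (fun _ _ => by positivity)

theorem rN_nonneg (k : ℝ) (φ φ1 : ℝ → ℂ) : 0 ≤ rN k φ φ1 := by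
  have h1 := rI_nonneg φ (show (-1:ℝ) ≤ 1 by norm_num)
  have h2 := rI_nonneg φ1 (show (-1:ℝ) ≤ 1 by norm_num)
  unfold rN; positivity

theorem rN_d (k : ℝ) (φ φ1 : ℝ → ℂ) : ∫ y in (-1:ℝ)..1, ‖φ1 y‖ ^ 2 ≤ rN k φ φ1 := by
  have h1 := rI_nonneg φ (show (-1:ℝ) ≤ 1 by norm_num)
  unfold rN
  have : 0 ≤ k ^ 2 * ∫ y in (-1:ℝ)..1, ‖φ y‖ ^ 2 := by positivity
  linarith

theorem rN_0 (k : ℝ) (φ φ1 : ℝ → ℂ) : k ^ 2 * ∫ y in (-1:ℝ)..1, ‖φ y‖ ^ 2 ≤ rN k φ φ1 := by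
  have h1 := rI_nonneg φ1 (show (-1:ℝ) ≤ 1 by norm_num)
  unfold rN
  linarith

/-- sup bound -/
theorem rN_sup {k : ℝ} (hk : 1 ≤ k) {φ φ1 : ℝ → ℂ} (hd : ∀ y, HasDerivAt φ (φ1 y) y)
    (hc : Continuous φ1) {y : ℝ} (hy : y ∈ Icc (-1:ℝ) 1) :
    ‖φ y‖ ≤ 2 / √k * √(rN k φ φ1) := by
  have h := ra_sup hd hc hk hy
  have hk0 : 0 < k := by linarith
  have hN := rN_nonneg k φ φ1
  apply le_of_sq_le_sq ?_ (by positivity)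
  rw [mul_pow, div_pow, Real.sq_sqrt hk0.le, Real.sq_sqrt hN, div_mul_eq_mul_div, le_div_iff₀ hk0]
  change k * ‖φ y‖ ^ 2 ≤ 2 * rN k φ φ1 at h
  linarith

theorem rN_hold {k : ℝ} {φ φ1 : ℝ → ℂ} (hd : ∀ y, HasDerivAt φ (φ1 y) y)
    (hc : Continuous φ1) {s t : ℝ} (hs : s ∈ Icc (-1:ℝ) 1) (ht : t ∈ Icc (-1:ℝ) 1) :
    ‖φ s - φ t‖ ≤ √(rN k φ φ1) * √(|s - t|) := by
  refine (ra_hold' hd hc hs ht).trans ?_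
  rw [mul_comm]
  gcongr
  exact rN_d k φ φ1

theorem rcont {φ φ1 : ℝ → ℂ} (hd : ∀ y, HasDerivAt φ (φ1 y) y) : Continuous φ :=
  continuous_iff_continuousAt.2 fun y => (hd y).continuousAt

/-- Cauchy-Schwarz for the bilinear form -/
theorem rN_cs {k : ℝ} {φ φ1 T T1 : ℝ → ℂ} (h0 : Continuous φ) (h1 : Continuous φ1)
    (t0 : Continuous T) (t1 : Continuous T1) :
    ‖(∫ y in (-1:ℝ)..1, φ1 y * T1 y) + (k:ℂ) ^ 2 * ∫ y in (-1:ℝ)..1, φ y * T y‖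
      ≤ √(rN k φ φ1) * √(rN k T T1) := by
  have e : ∀ {p q : ℝ → ℂ}, Continuous p → Continuous q → ‖∫ y in (-1:ℝ)..1, p y * q y‖
      ≤ √(∫ y in (-1:ℝ)..1, ‖p y‖ ^ 2) * √(∫ y in (-1:ℝ)..1, ‖q y‖ ^ 2) := by
    intro p q hp hq
    refine (intervalIntegral.norm_integral_le_integral_norm (by norm_num)).trans ?_
    simp only [norm_mul]
    exact ra_csn (by norm_num) hp hq
  have e1 := e h1 t1
  have e2 := e h0 t0
  set a := √(∫ y in (-1:ℝ)..1, ‖φ1 y‖ ^ 2) with ha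
  set b := √(∫ y in (-1:ℝ)..1, ‖T1 y‖ ^ 2) with hb
  set c := √(∫ y in (-1:ℝ)..1, ‖φ y‖ ^ 2) with hc
  set d := √(∫ y in (-1:ℝ)..1, ‖T y‖ ^ 2) with hd
  have a2 : rN k φ φ1 = a ^ 2 + k ^ 2 * c ^ 2 := by
    rw [ha, hc, Real.sq_sqrt (rI_nonneg _ (by norm_num)), Real.sq_sqrt (rI_nonneg _ (by norm_num))]; rfl
  have b2 : rN k T T1 = b ^ 2 + k ^ 2 * d ^ 2 := by
    rw [hb, hd, Real.sq_sqrt (rI_nonneg _ (by norm_num)), Real.sq_sqrt (rI_nonneg _ (by norm_num))]; rfl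
  have ha0 : 0 ≤ a := Real.sqrt_nonneg _
  have hb0 : 0 ≤ b := Real.sqrt_nonneg _
  have hc0 : 0 ≤ c := Real.sqrt_nonneg _
  have hd0 : 0 ≤ d := Real.sqrt_nonneg _
  clear_value a b c d
  refine (norm_add_le _ _).trans ?_
  rw [norm_mul, norm_pow, Complex.norm_real, Real.norm_eq_abs, sq_abs]
  have hk2 : k ^ 2 * ‖∫ y in (-1:ℝ)..1, φ y * T y‖ ≤ k ^ 2 * (c * d) := by gcongr
  refine (add_le_add e1 hk2).trans ?_
  rw [← Real.sqrt_mul (rN_nonneg _ _ _)]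
  apply Real.le_sqrt_of_sq_le
  rw [a2, b2]
  have := mul_nonneg (sq_nonneg k) (sq_nonneg (a * d - b * c))
  linarith

/-- A solution of the Rayleigh equation -/
structure RSol (u u2 : ℝ → ℝ) (cr ε k : ℝ) (ψ ψ1 ψ2 g g1 : ℝ → ℂ) : Prop where
  hψ : ∀ y, HasDerivAt ψ (ψ1 y) y
  hψ1 : ∀ y, HasDerivAt ψ1 (ψ2 y) y
  hψ2 : Continuous ψ2
  hg : ∀ y, HasDerivAt g (g1 y) y
  hg1 : Continuous g1
  eq : ∀ y ∈ Icc (-1:ℝ) 1, ψ2 y - (k:ℂ) ^ 2 * ψ y = ((u2 y : ℂ) * ψ y + g y) / rf u cr ε y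
  bl : ψ (-1) = 0
  br : ψ 1 = 0
  hε : ε ≠ 0
  hk : 3 ≤ k

variable {u u1 u2 u3 ρ ρ1 : ℝ → ℝ} {yc m M d r cr ε k : ℝ} {ψ ψ1 ψ2 g g1 : ℝ → ℂ}

theorem RSol.c1 (s : RSol u u2 cr ε k ψ ψ1 ψ2 g g1) : Continuous ψ1 := rcont s.hψ1
theorem RSol.c0 (s : RSol u u2 cr ε k ψ ψ1 ψ2 g g1) : Continuous ψ := rcont s.hψ
theorem RSol.cg (s : RSol u u2 cr ε k ψ ψ1 ψ2 g g1) : Continuous g := rcont s.hg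

/-- weak formulation -/
theorem RSol.pair (s : RSol u u2 cr ε k ψ ψ1 ψ2 g g1) {T T1 : ℝ → ℂ}
    (hT : ∀ y, HasDerivAt T (T1 y) y) (hT1 : Continuous T1) (tl : T (-1) = 0) (tr : T 1 = 0) :
    (∫ y in (-1:ℝ)..1, ψ1 y * T1 y) + (k:ℂ) ^ 2 * ∫ y in (-1:ℝ)..1, ψ y * T y
      = - ∫ y in (-1:ℝ)..1, ((u2 y : ℂ) * ψ y + g y) * T y / rf u cr ε y := by
  have hTc := rcont hT
  have h1 := intervalIntegral.integral_mul_deriv_eq_deriv_mul (a := -1) (b := 1)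
    (u := ψ1) (v := T) (fun x _ => s.hψ1 x) (fun x _ => hT x)
    (s.hψ2.intervalIntegrable _ _) (hT1.intervalIntegrable _ _)
  rw [tl, tr, mul_zero, mul_zero, sub_zero, zero_sub] at h1
  have h2 : ∫ y in (-1:ℝ)..1, ((u2 y : ℂ) * ψ y + g y) * T y / rf u cr ε y
      = ∫ y in (-1:ℝ)..1, (ψ2 y * T y - (k:ℂ) ^ 2 * (ψ y * T y)) := by
    apply intervalIntegral.integral_congr
    intro y hy
    rw [uIcc_of_le (by norm_num)] at hy
    have := s.eq y hy
    simp only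
    rw [mul_div_right_comm, ← this]
    ring
  have i1 : Continuous fun y => ψ2 y * T y := s.hψ2.mul hTc
  have i2 : Continuous fun y => (k:ℂ) ^ 2 * (ψ y * T y) := continuous_const.mul (s.c0.mul hTc)
  rw [h1, h2, intervalIntegral.integral_sub (i1.intervalIntegrable _ _) (i2.intervalIntegrable _ _),
    intervalIntegral.integral_const_mul]
  ring

/-- principal value lemma for functions given on the interval -/
theorem RGeo.pv' (G : RGeo u u1 u2 u3 ρ ρ1 yc m M d r) {B : ℝ} (hB : 0 < B) :
    ∃ C : ℝ, 0 < C ∧ ∀ (F : ℝ → ℂ) (cr ε H S : ℝ), 0 ≤ cr - u yc → cr - u yc ≤ B → ε ≠ 0 → |ε| ≤ B →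
      (∀ s ∈ Icc (-1:ℝ) 1, ∀ t ∈ Icc (-1:ℝ) 1, ‖F s - F t‖ ≤ H * √(|s - t|)) →
      (∀ t ∈ Icc (-1:ℝ) 1, ‖F t‖ ≤ S) → F (-1) = 0 → F 1 = 0 →
      ‖∫ y in (-1:ℝ)..1, F y / rf u cr ε y‖
        ≤ C * (H / √(√(cr - u yc + |ε|)) + S / √(cr - u yc + |ε|)) := by
  obtain ⟨C, hC, h⟩ := G.pv hB
  refine ⟨C, hC, ?_⟩
  intro F cr ε H S hL0 hLB hε hεB hF hS fl fr
  have hH : 0 ≤ H := by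
    have := hF 0 (by norm_num) 1 (by norm_num)
    simp only [zero_sub, abs_neg, abs_one, Real.sqrt_one, mul_one] at this
    exact (norm_nonneg _).trans this
  set p : ℝ → ℝ := fun y => max (-1) (min 1 y) with hp
  have pI : ∀ y, p y ∈ Icc (-1:ℝ) 1 := fun y =>
    ⟨le_max_left _ _, max_le (by norm_num) (min_le_left _ _)⟩
  have pL : ∀ s t, |p s - p t| ≤ |s - t| := by
    intro s t
    refine (abs_max_sub_max_le_max _ _ _ _).trans ?_
    rw [sub_self, abs_zero, max_eq_right (abs_nonneg _)]
    refine (abs_min_sub_min_le_max _ _ _ _).trans ?_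
    rw [sub_self, abs_zero, max_eq_right (abs_nonneg _)]
  have pid : ∀ y ∈ Icc (-1:ℝ) 1, p y = y := by
    intro y hy
    simp only [hp]
    rw [min_eq_right hy.2, max_eq_right hy.1]
  have := h (fun y => F (p y)) cr ε H S hL0 hLB hε hεB
    (fun s t => (hF _ (pI s) _ (pI t)).trans (mul_le_mul_of_nonneg_left (Real.sqrt_le_sqrt (pL s t)) hH))
    (fun t => hS _ (pI t)) (fun t ht => by
      rw [mem_Ioo, not_and_or, not_lt, not_lt] at ht
      rcases ht with h | h
      · have : p t = -1 := by
          simp only [hp]; rw [min_eq_right (by linarith), max_eq_left h]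
        simp only [this, fl]
      · have : p t = 1 := by
          simp only [hp]; rw [min_eq_left h, max_eq_right (by norm_num)]
        simp only [this, fr])
  rwa [intervalIntegral.integral_congr (g := fun y => F y / rf u cr ε y)] at this
  intro y hy
  rw [uIcc_of_le (by norm_num)] at hy
  simp only [pid y hy]

theorem u2_hold (G : RGeo u u1 u2 u3 ρ ρ1 yc m M d r) {s t : ℝ} (hs : s ∈ Icc (-1:ℝ) 1)
    (ht : t ∈ Icc (-1:ℝ) 1) : |u2 s - u2 t| ≤ 2 * M * √(|s - t|) := by
  have h := (convex_Icc (-1:ℝ) 1).norm_image_sub_le_of_norm_hasDerivWithin_le (f := u2) (f' := u3)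
        (C := M) (x := t) (y := s) (fun x _ => (G.hu2 x).hasDerivWithinAt)
        (fun x hx => G.b3 x hx) ht hs
  rw [Real.norm_eq_abs, Real.norm_eq_abs] at h
  have h2 : √|s - t| ≤ 2 := by
    apply Real.sqrt_le_iff.2 ⟨by norm_num, ?_⟩
    rw [abs_le]; constructor <;> linarith [hs.1, hs.2, ht.1, ht.2]
  have h3 : |s - t| = √|s - t| * √|s - t| := (Real.mul_self_sqrt (abs_nonneg _)).symm
  have hM := G.M1
  calc |u2 s - u2 t| ≤ M * |s - t| := h
    _ = M * (√|s - t| * √|s - t|) := by rw [← h3]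
    _ ≤ M * (2 * √|s - t|) := by gcongr
    _ = _ := by ring

theorem prod_hold {a b : ℝ → ℂ} {s t A B HA HB q : ℝ} (ha : ‖a s - a t‖ ≤ HA * q)
    (hb : ‖b s - b t‖ ≤ HB * q) (hA : ‖a t‖ ≤ A) (hB : ‖b s‖ ≤ B) :
    ‖a s * b s - a t * b t‖ ≤ (HA * B + A * HB) * q := by
  have e : a s * b s - a t * b t = (a s - a t) * b s + a t * (b s - b t) := by ring
  rw [e]
  refine (norm_add_le _ _).trans ?_
  rw [norm_mul, norm_mul]
  have h1 : ‖a s - a t‖ * ‖b s‖ ≤ HA * q * B :=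
    mul_le_mul ha hB (norm_nonneg _) ((norm_nonneg _).trans ha)
  have h2 : ‖a t‖ * ‖b s - b t‖ ≤ A * (HB * q) :=
    mul_le_mul hA hb (norm_nonneg _) ((norm_nonneg _).trans hA)
  linarith

/-- Self pairing identity -/
theorem rN_self {k : ℝ} {φ φ1 : ℝ → ℂ} :
    (∫ y in (-1:ℝ)..1, φ1 y * (starRingEnd ℂ) (φ1 y)) + (k:ℂ) ^ 2 * ∫ y in (-1:ℝ)..1, φ y * (starRingEnd ℂ) (φ y)
      = ((rN k φ φ1 : ℝ) : ℂ) := by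
  unfold rN
  push_cast
  rw [← intervalIntegral.integral_ofReal, ← intervalIntegral.integral_ofReal]
  simp only [Complex.mul_conj, Complex.normSq_eq_norm_sq]

theorem hconj {T T1 : ℝ → ℂ} (hT : ∀ y, HasDerivAt T (T1 y) y) (y : ℝ) :
    HasDerivAt (fun y => (starRingEnd ℂ) (T y)) ((starRingEnd ℂ) (T1 y)) y := (hT y).star

theorem RSol.conj_c (h : Continuous ψ) : Continuous fun y => (starRingEnd ℂ) (ψ y) :=
  Complex.continuous_conj.comp h

/-- Case 1 -/
theorem RGeo.case1 (G : RGeo u u1 u2 u3 ρ ρ1 yc m M d r) {B : ℝ} (hB : 0 < B) :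
    ∃ A : ℝ, 1 ≤ A ∧ ∀ (cr ε k : ℝ) (ψ ψ1 ψ2 g g1 : ℝ → ℂ), RSol u u2 cr ε k ψ ψ1 ψ2 g g1 →
      0 ≤ cr - u yc → cr - u yc ≤ B → |ε| ≤ B → A ≤ k * √(cr - u yc + |ε|) →
      √(rN k ψ ψ1) ≤ √(rN k g g1) := by
  obtain ⟨C, hC, hpv⟩ := G.pv' hB
  have hM := G.M1
  have hM0 : 0 < M := by linarith
  refine ⟨(32 * C * M) ^ 2 + 1, by nlinarith [sq_nonneg (32 * C * M)], ?_⟩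
  intro cr ε k ψ ψ1 ψ2 g g1 s hL0 hLB hεB hA
  have hk := s.hk
  have hk1 : 1 ≤ k := by linarith
  have hk0 : 0 < k := by linarith
  set E := √(rN k ψ ψ1) with hE
  set Γ := √(rN k g g1) with hΓ
  have hE0 : 0 ≤ E := Real.sqrt_nonneg _
  have hΓ0 : 0 ≤ Γ := Real.sqrt_nonneg _
  have hE2 : rN k ψ ψ1 = E ^ 2 := (Real.sq_sqrt (rN_nonneg _ _ _)).symm
  set a := 2 / √k with ha
  have hsk : 1 ≤ √k := Real.one_le_sqrt.2 hk1
  have ha0 : 0 < a := by positivity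
  have ha2 : a ≤ 2 := div_le_self (by norm_num) hsk
  set Λ := √(cr - u yc + |ε|) with hΛ
  have hεp : 0 < |ε| := abs_pos.2 s.hε
  have hΛ0 : 0 < Λ := by positivity
  have bψ : ∀ y ∈ Icc (-1:ℝ) 1, ‖ψ y‖ ≤ a * E := fun y hy => rN_sup hk1 s.hψ s.c1 hy
  have bg : ∀ y ∈ Icc (-1:ℝ) 1, ‖g y‖ ≤ a * Γ := fun y hy => rN_sup hk1 s.hg s.hg1 hy
  have bu : ∀ y ∈ Icc (-1:ℝ) 1, ‖(u2 y : ℂ)‖ ≤ M := fun y hy => by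
    rw [Complex.norm_real]
    exact G.b2 y ⟨by linarith [hy.1, G.d0], by linarith [hy.2, G.d0]⟩
  set h : ℝ → ℂ := fun y => (u2 y : ℂ) * ψ y + g y with hh
  set H := (2 * M * (a * E) + M * E + Γ) * (a * E) + (M * (a * E) + a * Γ) * E with hHdef
  set S := (M * (a * E) + a * Γ) * (a * E) with hSdef
  have bh : ∀ y ∈ Icc (-1:ℝ) 1, ‖h y‖ ≤ M * (a * E) + a * Γ := by
    intro y hy
    refine (norm_add_le _ _).trans ?_
    rw [norm_mul]
    have := mul_le_mul (bu y hy) (bψ y hy) (norm_nonneg _) hM0.le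
    linarith [bg y hy]
  have hhold : ∀ x ∈ Icc (-1:ℝ) 1, ∀ t ∈ Icc (-1:ℝ) 1,
      ‖h x - h t‖ ≤ (2 * M * (a * E) + M * E + Γ) * √|x - t| := by
    intro x hx t ht
    have e1 : ‖(u2 x : ℂ) - u2 t‖ ≤ 2 * M * √|x - t| := by
      rw [← Complex.ofReal_sub, Complex.norm_real]; exact u2_hold G hx ht
    have e2 := prod_hold (a := fun y => (u2 y : ℂ)) (b := ψ) e1
      (rN_hold (k := k) s.hψ s.c1 hx ht) (bu t ht) (bψ x hx)
    have e3 := rN_hold (k := k) s.hg s.hg1 hx ht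
    have : h x - h t = ((u2 x : ℂ) * ψ x - (u2 t : ℂ) * ψ t) + (g x - g t) := by
      simp only [hh]; ring
    rw [this]
    refine (norm_add_le _ _).trans ((add_le_add e2 e3).trans ?_)
    rw [← add_mul]
  have key := hpv (fun y => h y * (starRingEnd ℂ) (ψ y)) cr ε H S hL0 hLB s.hε hεB
    (fun x hx t ht => by
      apply prod_hold (a := h) (b := fun y => (starRingEnd ℂ) (ψ y)) (hhold x hx t ht)
      · rw [← map_sub, RCLike.norm_conj]
        exact rN_hold (k := k) s.hψ s.c1 hx ht
      · exact bh t ht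
      · rw [RCLike.norm_conj]; exact bψ x hx)
    (fun t ht => by
      rw [norm_mul, RCLike.norm_conj]
      exact mul_le_mul (bh t ht) (bψ t ht) (norm_nonneg _) (by positivity))
    (by simp [s.bl]) (by simp [s.br])
  have hp := s.pair (hconj s.hψ) (RSol.conj_c s.c1) (by simp [s.bl]) (by simp [s.br])
  rw [rN_self] at hp
  have key2 : E ^ 2 ≤ C * (H / √Λ + S / Λ) := by
    have : ‖((rN k ψ ψ1 : ℝ) : ℂ)‖ = E ^ 2 := by
      rw [Complex.norm_real, hE2, Real.norm_of_nonneg (by positivity)]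
    rw [← this, hp, norm_neg]
    exact key
  -- quantitative smallness
  set q := √(k * Λ) with hq
  have hq0 : 0 < q := by positivity
  have hq1 : 1 ≤ q := Real.one_le_sqrt.2 (by linarith [sq_nonneg (32 * C * M)])
  have hqA : 32 * C * M ≤ q := by
    apply Real.le_sqrt_of_sq_le; linarith
  have aΛ : a / √Λ = 2 / q := by
    rw [ha, hq, Real.sqrt_mul hk0.le, div_div]
  have aΛ2 : a ^ 2 / Λ = 4 / q ^ 2 := by
    have : (a / √Λ) ^ 2 = (2 / q) ^ 2 := by rw [aΛ]
    calc a ^ 2 / Λ = (a / √Λ) ^ 2 := by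
          have h0 : √Λ ^ 2 = Λ := Real.sq_sqrt hΛ0.le
          have h1 : (a / √Λ) ^ 2 = a ^ 2 / √Λ ^ 2 := div_pow a (√Λ) 2
          rw [h1, h0]
      _ = _ := by rw [this]; ring
  have hHb : H ≤ 6 * M * a * (E * (E + Γ)) := by
    have h1 : 0 ≤ M * a * (E * E) * (2 - a) := by
      have : 0 ≤ 2 - a := by linarith
      positivity
    have h2 : 0 ≤ (M - 1) * (a * (E * Γ)) := by
      have : 0 ≤ M - 1 := by linarith
      positivity
    have h3 : 0 ≤ M * (a * (E * Γ)) := by positivity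
    rw [hHdef]; linarith
  have hSb : S ≤ M * a ^ 2 * (E * (E + Γ)) := by
    have h2 : 0 ≤ (M - 1) * (a ^ 2 * (E * Γ)) := by
      have : 0 ≤ M - 1 := by linarith
      positivity
    rw [hSdef]; linarith
  have f1 : H / √Λ ≤ 12 * M * (E * (E + Γ)) / q := by
    calc H / √Λ ≤ 6 * M * a * (E * (E + Γ)) / √Λ := by gcongr
      _ = 6 * M * (E * (E + Γ)) * (a / √Λ) := by ring
      _ = _ := by rw [aΛ]; ring
  have f2 : S / Λ ≤ 4 * M * (E * (E + Γ)) / q := by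
    calc S / Λ ≤ M * a ^ 2 * (E * (E + Γ)) / Λ := by gcongr
      _ = M * (E * (E + Γ)) * (a ^ 2 / Λ) := by ring
      _ = 4 * M * (E * (E + Γ)) / q ^ 2 := by rw [aΛ2]; ring
      _ ≤ 4 * M * (E * (E + Γ)) / q := by
        gcongr
        exact le_self_pow₀ hq1 (by norm_num)
  have f3 : E ^ 2 ≤ 1 / 2 * (E * (E + Γ)) := by
    have e : C * (H / √Λ + S / Λ) ≤ C * (12 * M * (E * (E + Γ)) / q + 4 * M * (E * (E + Γ)) / q) := by
      gcongr
    have e2 : C * (12 * M * (E * (E + Γ)) / q + 4 * M * (E * (E + Γ)) / q)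
        = (16 * C * M) * (E * (E + Γ)) / q := by ring
    have e3 : (16 * C * M) * (E * (E + Γ)) / q ≤ 1 / 2 * (E * (E + Γ)) := by
      rw [div_le_iff₀ hq0]
      have := mul_le_mul_of_nonneg_right hqA (by positivity : 0 ≤ E * (E + Γ))
      linarith
    linarith
  by_contra hcon
  push Not at hcon
  have : 0 < E := lt_of_le_of_lt hΓ0 hcon
  have := mul_pos this (sub_pos.2 hcon)
  linarith

end AuxE

section AuxF
open Set

theorem rint_add_mul {a b : ℝ} {φ χ T : ℝ → ℂ} (h0 : Continuous φ) (h1 : Continuous χ)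
    (h2 : Continuous T) : ∫ y in a..b, (φ y + χ y) * T y
      = (∫ y in a..b, φ y * T y) + ∫ y in a..b, χ y * T y := by
  have e1 : IntervalIntegrable (fun y => φ y * T y) volume a b := (h0.mul h2).intervalIntegrable _ _
  have e2 : IntervalIntegrable (fun y => χ y * T y) volume a b := (h1.mul h2).intervalIntegrable _ _
  rw [← intervalIntegral.integral_add e1 e2]
  simp only [add_mul]

theorem rI_add {a b : ℝ} (h : a ≤ b) {φ χ : ℝ → ℂ} (h0 : Continuous φ) (h1 : Continuous χ) :
    ∫ y in a..b, ‖φ y + χ y‖ ^ 2 ≤ 2 * (∫ y in a..b, ‖φ y‖ ^ 2) + 2 * ∫ y in a..b, ‖χ y‖ ^ 2 := by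
  rw [← intervalIntegral.integral_const_mul, ← intervalIntegral.integral_const_mul,
    ← intervalIntegral.integral_add]
  · apply intervalIntegral.integral_mono_on h
    · exact (by fun_prop : Continuous fun y => ‖φ y + χ y‖ ^ 2).intervalIntegrable _ _
    · exact (by fun_prop : Continuous fun y => 2 * ‖φ y‖ ^ 2 + 2 * ‖χ y‖ ^ 2).intervalIntegrable _ _
    · intro y _
      have := norm_add_le (φ y) (χ y)
      have h2 : ‖φ y + χ y‖ ^ 2 ≤ (‖φ y‖ + ‖χ y‖) ^ 2 := by gcongr
      linarith [sq_nonneg (‖φ y‖ - ‖χ y‖)]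
  · exact (by fun_prop : Continuous fun y => 2 * ‖φ y‖ ^ 2).intervalIntegrable _ _
  · exact (by fun_prop : Continuous fun y => 2 * ‖χ y‖ ^ 2).intervalIntegrable _ _

theorem rI_mul {a b M : ℝ} (h : a ≤ b) {φ χ : ℝ → ℂ} (h0 : Continuous φ) (h1 : Continuous χ)
    (hM : ∀ y ∈ Icc a b, ‖χ y‖ ≤ M * ‖φ y‖) :
    ∫ y in a..b, ‖χ y‖ ^ 2 ≤ M ^ 2 * ∫ y in a..b, ‖φ y‖ ^ 2 := by
  rw [← intervalIntegral.integral_const_mul]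
  apply intervalIntegral.integral_mono_on h
  · exact (by fun_prop : Continuous fun y => ‖χ y‖ ^ 2).intervalIntegrable _ _
  · exact (by fun_prop : Continuous fun y => M ^ 2 * ‖φ y‖ ^ 2).intervalIntegrable _ _
  · intro y hy
    rw [← mul_pow]
    have := hM y hy
    gcongr

theorem rN_add {k : ℝ} {φ φ1 χ χ1 : ℝ → ℂ} (h0 : Continuous φ) (h1 : Continuous φ1)
    (t0 : Continuous χ) (t1 : Continuous χ1) :
    rN k (fun y => φ y + χ y) (fun y => φ1 y + χ1 y) ≤ 2 * rN k φ φ1 + 2 * rN k χ χ1 := by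
  have e1 := rI_add (show (-1:ℝ) ≤ 1 by norm_num) h0 t0
  have e2 := rI_add (show (-1:ℝ) ≤ 1 by norm_num) h1 t1
  have e3 := mul_le_mul_of_nonneg_left e1 (sq_nonneg k)
  unfold rN
  linarith

/-- localized weak formulation with error `δ` -/
def RStar (u u2 : ℝ → ℝ) (yc r cr ε k δ : ℝ) (w w1 : ℝ → ℂ) : Prop :=
  ∀ T T1 : ℝ → ℂ, (∀ y, HasDerivAt T (T1 y) y) → Continuous T1 → T (-1) = 0 → T 1 = 0 →
    ‖((∫ y in (-1:ℝ)..1, w1 y * T1 y) + (k:ℂ) ^ 2 * ∫ y in (-1:ℝ)..1, w y * T y)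
      + ∫ y in (yc - r)..(yc + r), (u2 y : ℂ) * w y * T y / rf u cr ε y‖ ≤ δ * √(rN k T T1)

variable {u u1 u2 u3 ρ ρ1 : ℝ → ℝ} {yc m M d r cr ε k : ℝ} {ψ ψ1 ψ2 g g1 : ℝ → ℂ}

/-- lower bound for `u - cr` away from the critical point -/
theorem RGeo.farU (G : RGeo u u1 u2 u3 ρ ρ1 yc m M d r) {y : ℝ} (hy : y ∈ Icc (-1:ℝ) 1)
    (hr : r ≤ |y - yc|) : m / 2 * r ^ 2 ≤ u y - u yc := by
  have r0 := G.r0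
  have m0 := G.m0
  rcases le_total yc y with h | h
  · rw [abs_of_nonneg (by linarith)] at hr
    have := G.right.1 0 (y - yc) le_rfl (by linarith) (by linarith [hy.2, G.d0])
    rw [add_zero, add_sub_cancel] at this
    have h2 : r ^ 2 ≤ (y - yc) ^ 2 := by gcongr
    have := mul_le_mul_of_nonneg_left h2 (by positivity : 0 ≤ m / 2)
    linarith
  · rw [abs_of_nonpos (by linarith)] at hr
    have := G.left.1 0 (yc - y) le_rfl (by linarith) (by linarith [hy.1, G.d0])
    rw [sub_zero, sub_sub_cancel] at this
    have h2 : r ^ 2 ≤ (yc - y) ^ 2 := by gcongr; linarith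
    have := mul_le_mul_of_nonneg_left h2 (by positivity : 0 ≤ m / 2)
    linarith

theorem cs_far {a b f0 : ℝ} (hab : a ≤ b) (h1 : -1 ≤ a) (h2 : b ≤ 1) (hf0 : 0 < f0) {h T D : ℝ → ℂ}
    (ch : Continuous h) (cT : Continuous T) (hD : ∀ y ∈ Icc a b, f0 ≤ ‖D y‖) :
    ‖∫ y in a..b, h y * T y / D y‖
      ≤ 1 / f0 * (√(∫ y in (-1:ℝ)..1, ‖h y‖ ^ 2) * √(∫ y in (-1:ℝ)..1, ‖T y‖ ^ 2)) := by
  have e1 : ‖∫ y in a..b, h y * T y / D y‖ ≤ ∫ y in a..b, 1 / f0 * (‖h y‖ * ‖T y‖) := by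
    apply intervalIntegral.norm_integral_le_of_norm_le hab
    · refine Filter.Eventually.of_forall fun y hy => ?_
      have hd := hD y ⟨hy.1.le, hy.2⟩
      rw [norm_div, norm_mul, one_div, inv_mul_eq_div]
      gcongr
    · exact (by fun_prop : Continuous fun y => 1 / f0 * (‖h y‖ * ‖T y‖)).intervalIntegrable _ _
  refine e1.trans ?_
  rw [intervalIntegral.integral_const_mul]
  have e2 := ra_csn hab ch cT
  have e3 := ra_sub ch h1 hab h2
  have e4 := ra_sub cT h1 hab h2
  gcongr
  refine e2.trans ?_
  gcongr

/-- Reduction to the localized problem. -/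
theorem RGeo.reduce (G : RGeo u u1 u2 u3 ρ ρ1 yc m M d r) (s : RSol u u2 cr ε k ψ ψ1 ψ2 g g1)
    (hL : cr - u yc ≤ m * r ^ 2 / 4) :
    ∃ w w1 : ℝ → ℂ, (∀ y, HasDerivAt w (w1 y) y) ∧ Continuous w1 ∧ w (-1) = 0 ∧ w 1 = 0 ∧
      rN k ψ ψ1 ≤ 2 * rN k w w1 + 8 * M ^ 2 * rN k g g1 ∧
      RStar u u2 yc r cr ε k ((2 * M + 16 / (m * r ^ 2)) * √(rN k g g1)
        + 16 * M / (m * r ^ 2) * √(rN k ψ ψ1) / k ^ 2) w w1 := by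
  have hM := G.M1
  have hM0 : 0 < M := by linarith
  have m0 := G.m0
  have r0 := G.r0
  have hl := G.hl
  have hr := G.hr
  have hk0 : 0 < k := by linarith [s.hk]
  have hk1 : 1 ≤ k := by linarith [s.hk]
  set v : ℝ → ℂ := fun y => (ρ y : ℂ) * g y with hv
  set v1 : ℝ → ℂ := fun y => (ρ1 y : ℂ) * g y + (ρ y : ℂ) * g1 y with hv1
  have cρ := G.cρ
  have cρ1 := G.hρ1
  have cg := s.cg
  have cg1 := s.hg1
  have c0 := s.c0
  have c1 := s.c1
  have dv : ∀ y, HasDerivAt v (v1 y) y := fun y => ((G.hρ y).ofReal_comp).mul (s.hg y)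
  have cv : Continuous v := rcont dv
  have cv1 : Continuous v1 := by simp only [hv1]; fun_prop
  -- norm of v
  have i1 : ∫ y in (-1:ℝ)..1, ‖v y‖ ^ 2 ≤ M ^ 2 * ∫ y in (-1:ℝ)..1, ‖g y‖ ^ 2 := by
    apply rI_mul (by norm_num) cg cv
    intro y hy
    simp only [hv]
    rw [norm_mul, Complex.norm_real]
    have := G.rb y hy
    exact mul_le_mul_of_nonneg_right this (norm_nonneg _)
  have i2 : ∫ y in (-1:ℝ)..1, ‖v1 y‖ ^ 2 ≤ 2 * (M ^ 2 * ∫ y in (-1:ℝ)..1, ‖g y‖ ^ 2)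
      + 2 * (M ^ 2 * ∫ y in (-1:ℝ)..1, ‖g1 y‖ ^ 2) := by
    have ca : Continuous fun y => (ρ1 y : ℂ) * g y := by fun_prop
    have cb : Continuous fun y => (ρ y : ℂ) * g1 y := by fun_prop
    refine (rI_add (by norm_num) ca cb).trans ?_
    gcongr
    · apply rI_mul (by norm_num) cg ca
      intro y hy
      rw [norm_mul, Complex.norm_real]
      exact mul_le_mul_of_nonneg_right (G.rb1 y hy) (norm_nonneg _)
    · apply rI_mul (by norm_num) cg1 cb
      intro y hy
      rw [norm_mul, Complex.norm_real]
      exact mul_le_mul_of_nonneg_right (G.rb y hy) (norm_nonneg _)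
  have hvN : rN k v v1 ≤ (2 * M) ^ 2 * rN k g g1 := by
    have q0 := rI_nonneg g (show (-1:ℝ) ≤ 1 by norm_num)
    have q1 := rI_nonneg g1 (show (-1:ℝ) ≤ 1 by norm_num)
    have e1 := mul_le_mul_of_nonneg_left i1 (sq_nonneg k)
    have e2 : M ^ 2 * (∫ y in (-1:ℝ)..1, ‖g y‖ ^ 2) ≤ k ^ 2 * (M ^ 2 * ∫ y in (-1:ℝ)..1, ‖g y‖ ^ 2) :=
      le_mul_of_one_le_left (by positivity) (one_le_pow₀ hk1)
    have e3 : 0 ≤ M ^ 2 * ∫ y in (-1:ℝ)..1, ‖g1 y‖ ^ 2 := by positivity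
    have e4 : 0 ≤ M ^ 2 * ∫ y in (-1:ℝ)..1, ‖g y‖ ^ 2 := by positivity
    unfold rN
    linarith
  have hvN' : √(rN k v v1) ≤ 2 * M * √(rN k g g1) := by
    apply Real.sqrt_le_iff.2 ⟨by positivity, ?_⟩
    rw [mul_pow, Real.sq_sqrt (rN_nonneg _ _ _)]
    exact hvN
  refine ⟨fun y => ψ y + v y, fun y => ψ1 y + v1 y, fun y => (s.hψ y).add (dv y), c1.add cv1,
    by simp [hv, s.bl, G.rl], by simp [hv, s.br, G.rr], ?_, ?_⟩
  · have := rN_add (k := k) (φ := fun y => ψ y + v y) (φ1 := fun y => ψ1 y + v1 y)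
      (χ := fun y => - v y) (χ1 := fun y => - v1 y) (c0.add cv) (c1.add cv1) cv.neg cv1.neg
    have e0 : (fun y => ψ y + v y + - v y) = ψ := by funext y; ring
    have e1 : (fun y => ψ1 y + v1 y + - v1 y) = ψ1 := by funext y; ring
    rw [e0, e1] at this
    have e2 : rN k (fun y => - v y) (fun y => - v1 y) = rN k v v1 := by
      unfold rN; simp only [norm_neg]
    rw [e2] at this
    linarith
  · intro T T1 hT hT1 tl tr
    have cT := rcont hT
    have hp := s.pair hT hT1 tl tr
    set h : ℝ → ℂ := fun y => (u2 y : ℂ) * ψ y + g y with hh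
    have cu2 := G.cu2
    have ch : Continuous h := by simp only [hh]; fun_prop
    have cf := rf_cont G.cu cr ε
    have cI : Continuous fun y => h y * T y / rf u cr ε y := (ch.mul cT).div cf (rf_ne s.hε)
    have hI : ∀ a b, IntervalIntegrable (fun y => h y * T y / rf u cr ε y) volume a b :=
      fun a b => cI.intervalIntegrable a b
    have sp : ∫ y in (-1:ℝ)..1, h y * T y / rf u cr ε y
        = (∫ y in (-1:ℝ)..(yc - r), h y * T y / rf u cr ε y)
          + (∫ y in (yc - r)..(yc + r), h y * T y / rf u cr ε y)
          + ∫ y in (yc + r)..1, h y * T y / rf u cr ε y := by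
      rw [intervalIntegral.integral_add_adjacent_intervals (hI _ _) (hI _ _),
        intervalIntegral.integral_add_adjacent_intervals (hI _ _) (hI _ _)]
    have mid : ∫ y in (yc - r)..(yc + r), (u2 y : ℂ) * (ψ y + v y) * T y / rf u cr ε y
        = ∫ y in (yc - r)..(yc + r), h y * T y / rf u cr ε y := by
      apply intervalIntegral.integral_congr
      intro y hy
      rw [uIcc_of_le (by linarith)] at hy
      have := G.rone y (by rw [abs_le]; constructor <;> linarith [hy.1, hy.2])
      have h2 : (u2 y : ℂ) * (ρ y : ℂ) = 1 := by rw [mul_comm]; exact_mod_cast this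
      simp only [hh, hv]
      congr 2
      rw [mul_add, ← mul_assoc, h2, one_mul]
    set f0 := m * r ^ 2 / 4 with hf0d
    have hf0 : 0 < f0 := by positivity
    have fD : ∀ y ∈ Icc (-1:ℝ) 1, r ≤ |y - yc| → f0 ≤ ‖rf u cr ε y‖ := by
      intro y hy hr
      refine le_trans ?_ (ra_den_ge (u y - cr) ε).1
      refine le_trans ?_ (le_abs_self _)
      have := G.farU hy hr
      linarith
    have far1 := cs_far (a := -1) (b := yc - r) (by linarith) le_rfl (by linarith) hf0 ch cT
      (D := rf u cr ε) (fun y hy => fD y ⟨hy.1, by linarith [hy.2]⟩ (by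
        rw [abs_of_nonpos (by linarith [hy.2])]; linarith [hy.2]))
    have far2 := cs_far (a := yc + r) (b := 1) (by linarith) (by linarith) le_rfl hf0 ch cT
      (D := rf u cr ε) (fun y hy => fD y ⟨by linarith [hy.1], hy.2⟩ (by
        rw [abs_of_nonneg (by linarith [hy.1])]; linarith [hy.1]))
    have hcs := rN_cs (k := k) cv cv1 cT hT1
    -- L2 bounds
    set N := √(rN k T T1) with hN
    set E := √(rN k ψ ψ1) with hE
    set Γ := √(rN k g g1) with hΓ
    have l2b : ∀ φ φ1 : ℝ → ℂ, ∫ y in (-1:ℝ)..1, ‖φ y‖ ^ 2 ≤ (√(rN k φ φ1) / k) ^ 2 := by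
      intro φ φ1
      rw [div_pow, Real.sq_sqrt (rN_nonneg _ _ _), le_div_iff₀ (by positivity)]
      have := rN_0 k φ φ1
      linarith
    have bT : √(∫ y in (-1:ℝ)..1, ‖T y‖ ^ 2) ≤ N / k :=
      Real.sqrt_le_iff.2 ⟨by positivity, l2b T T1⟩
    have bh : √(∫ y in (-1:ℝ)..1, ‖h y‖ ^ 2) ≤ 2 * (M * E + Γ) / k := by
      apply Real.sqrt_le_iff.2 ⟨by positivity, ?_⟩
      have ca : Continuous fun y => (u2 y : ℂ) * ψ y := by fun_prop
      have e1 := rI_add (show (-1:ℝ) ≤ 1 by norm_num) ca cg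
      have e2 := rI_mul (show (-1:ℝ) ≤ 1 by norm_num) c0 ca (M := M) (fun y hy => by
        rw [norm_mul, Complex.norm_real]
        exact mul_le_mul_of_nonneg_right
          (G.b2 y ⟨by linarith [hy.1, G.d0], by linarith [hy.2, G.d0]⟩) (norm_nonneg _))
      have e3 := mul_le_mul_of_nonneg_left (l2b ψ ψ1) (sq_nonneg M)
      have e4 := l2b g g1
      have e5 : 0 ≤ M * E / k * (Γ / k) := by positivity
      have e6 : 0 ≤ (M * E / k) ^ 2 + (Γ / k) ^ 2 := by positivity
      calc _ ≤ 2 * (M ^ 2 * (E / k) ^ 2) + 2 * (Γ / k) ^ 2 := by linarith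
        _ ≤ (2 * (M * E + Γ) / k) ^ 2 := by
          have : (2 * (M * E + Γ) / k) ^ 2 = 4 * (M * E / k + Γ / k) ^ 2 := by ring
          rw [this]
          have : M ^ 2 * (E / k) ^ 2 = (M * E / k) ^ 2 := by ring
          rw [this]; linarith
    have bhT : 1 / f0 * (√(∫ y in (-1:ℝ)..1, ‖h y‖ ^ 2) * √(∫ y in (-1:ℝ)..1, ‖T y‖ ^ 2))
        ≤ 1 / f0 * (2 * (M * E + Γ) / k * (N / k)) := by gcongr
    have expr : ((∫ y in (-1:ℝ)..1, (ψ1 y + v1 y) * T1 y)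
        + (k:ℂ) ^ 2 * ∫ y in (-1:ℝ)..1, (ψ y + v y) * T y)
      + ∫ y in (yc - r)..(yc + r), (u2 y : ℂ) * (ψ y + v y) * T y / rf u cr ε y
      = ((∫ y in (-1:ℝ)..1, v1 y * T1 y) + (k:ℂ) ^ 2 * ∫ y in (-1:ℝ)..1, v y * T y)
        - ((∫ y in (-1:ℝ)..(yc - r), h y * T y / rf u cr ε y)
          + ∫ y in (yc + r)..1, h y * T y / rf u cr ε y) := by
      have a1 : ∫ y in (-1:ℝ)..1, (ψ1 y + v1 y) * T1 y
          = (∫ y in (-1:ℝ)..1, ψ1 y * T1 y) + ∫ y in (-1:ℝ)..1, v1 y * T1 y :=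
        rint_add_mul c1 cv1 hT1
      have a2 : ∫ y in (-1:ℝ)..1, (ψ y + v y) * T y
          = (∫ y in (-1:ℝ)..1, ψ y * T y) + ∫ y in (-1:ℝ)..1, v y * T y :=
        rint_add_mul c0 cv cT
      rw [mid, a1, a2]
      rw [sp] at hp
      linear_combination hp
    rw [expr]
    refine (norm_sub_le _ _).trans ?_
    have hsum := norm_add_le (∫ y in (-1:ℝ)..(yc - r), h y * T y / rf u cr ε y)
      (∫ y in (yc + r)..1, h y * T y / rf u cr ε y)
    have hvT : √(rN k v v1) * N ≤ 2 * M * Γ * N := by gcongr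
    have hfin : 2 * (1 / f0 * (2 * (M * E + Γ) / k * (N / k)))
        ≤ (16 / (m * r ^ 2) * Γ + 16 * M / (m * r ^ 2) * E / k ^ 2) * N := by
      have : 2 * (1 / f0 * (2 * (M * E + Γ) / k * (N / k)))
        = (16 / (m * r ^ 2) * (Γ / k ^ 2) + 16 * M / (m * r ^ 2) * E / k ^ 2) * N := by
        rw [hf0d]; field_simp; ring
      rw [this]
      gcongr
      exact div_le_self (Real.sqrt_nonneg _) (one_le_pow₀ hk1)
    calc _ ≤ √(rN k v v1) * N + (1 / f0 * (2 * (M * E + Γ) / k * (N / k))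
          + 1 / f0 * (2 * (M * E + Γ) / k * (N / k))) := by
            refine add_le_add hcs (hsum.trans (add_le_add (far1.trans bhT) (far2.trans bhT)))
      _ ≤ 2 * M * Γ * N + (16 / (m * r ^ 2) * Γ + 16 * M / (m * r ^ 2) * E / k ^ 2) * N := by linarith
      _ = _ := by ring

end AuxF

section AuxG
open Set

variable {u u1 u2 u3 ρ ρ1 : ℝ → ℝ} {yc m M d r cr ε k δ : ℝ} {w w1 T T1 : ℝ → ℂ}

theorem nf_pos (hε : ε ≠ 0) (x : ℝ) : 0 < x ^ 2 + ε ^ 2 := by positivity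

theorem rf_split_pt (hε : ε ≠ 0) (y q : ℝ) (z : ℂ) :
    (q : ℂ) * z * (starRingEnd ℂ) z / rf u cr ε y
      = ((q * (u y - cr) * ‖z‖ ^ 2 / ((u y - cr) ^ 2 + ε ^ 2) : ℝ) : ℂ)
        + ((ε * (q * ‖z‖ ^ 2 / ((u y - cr) ^ 2 + ε ^ 2)) : ℝ) : ℂ) * Complex.I := by
  have h0 := rf_ne (u := u) (cr := cr) hε y
  have hn : (((u y - cr) ^ 2 + ε ^ 2 : ℝ) : ℂ) ≠ 0 := by
    exact_mod_cast (nf_pos hε (u y - cr)).ne'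
  rw [mul_assoc, Complex.mul_conj, Complex.normSq_eq_norm_sq, div_eq_iff h0]
  have : (((u y - cr) ^ 2 + ε ^ 2 : ℝ) : ℂ) = rf u cr ε y * (((u y - cr : ℝ) : ℂ) + ε * Complex.I) := by
    unfold rf
    push_cast
    ring_nf
    rw [Complex.I_sq]; ring
  have e : ((q * (u y - cr) * ‖z‖ ^ 2 / ((u y - cr) ^ 2 + ε ^ 2) : ℝ) : ℂ)
        + ((ε * (q * ‖z‖ ^ 2 / ((u y - cr) ^ 2 + ε ^ 2)) : ℝ) : ℂ) * Complex.I
      = (q : ℂ) * ((‖z‖ ^ 2 : ℝ) : ℂ) * (((u y - cr : ℝ) : ℂ) + ε * Complex.I)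
        / (((u y - cr) ^ 2 + ε ^ 2 : ℝ) : ℂ) := by
    push_cast; ring
  rw [e, div_mul_eq_mul_div, eq_div_iff hn, this]
  push_cast; ring

theorem rf_split (hε : ε ≠ 0) (hu : Continuous u) (hu2 : Continuous u2) (hT : Continuous T) (a b : ℝ) :
    ∫ y in a..b, (u2 y : ℂ) * T y * (starRingEnd ℂ) (T y) / rf u cr ε y
      = ((∫ y in a..b, u2 y * (u y - cr) * ‖T y‖ ^ 2 / ((u y - cr) ^ 2 + ε ^ 2) : ℝ) : ℂ)
        + ((ε * ∫ y in a..b, u2 y * ‖T y‖ ^ 2 / ((u y - cr) ^ 2 + ε ^ 2) : ℝ) : ℂ) * Complex.I := by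
  simp only [rf_split_pt hε]
  have c1 : Continuous fun y => u2 y * (u y - cr) * ‖T y‖ ^ 2 / ((u y - cr) ^ 2 + ε ^ 2) :=
    Continuous.div (by fun_prop) (by fun_prop) (fun y => (nf_pos hε _).ne')
  have c2 : Continuous fun y => ε * (u2 y * ‖T y‖ ^ 2 / ((u y - cr) ^ 2 + ε ^ 2)) :=
    continuous_const.mul (Continuous.div (by fun_prop) (by fun_prop) (fun y => (nf_pos hε _).ne'))
  rw [intervalIntegral.integral_add, intervalIntegral.integral_mul_const,
    intervalIntegral.integral_ofReal, intervalIntegral.integral_ofReal,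
    intervalIntegral.integral_const_mul]
  · exact (Complex.continuous_ofReal.comp c1).intervalIntegrable _ _
  · exact ((Complex.continuous_ofReal.comp c2).mul continuous_const).intervalIntegrable _ _

theorem rN_conj : rN k (fun y => (starRingEnd ℂ) (T y)) (fun y => (starRingEnd ℂ) (T1 y)) = rN k T T1 := by
  unfold rN; simp only [RCLike.norm_conj]

/-- test with `conj w` -/
theorem star_self (hu : Continuous u) (hu2 : Continuous u2) (hε : ε ≠ 0)
    (hw : ∀ y, HasDerivAt w (w1 y) y) (hw1 : Continuous w1) (wl : w (-1) = 0) (wr : w 1 = 0)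
    (hs : RStar u u2 yc r cr ε k δ w w1) :
    |ε| * |∫ y in (yc - r)..(yc + r), u2 y * ‖w y‖ ^ 2 / ((u y - cr) ^ 2 + ε ^ 2)| ≤ δ * √(rN k w w1) ∧
    rN k w w1 + (∫ y in (yc - r)..(yc + r), u2 y * (u y - cr) * ‖w y‖ ^ 2 / ((u y - cr) ^ 2 + ε ^ 2))
      ≤ δ * √(rN k w w1) := by
  have h := hs _ _ (hconj hw) (RSol.conj_c hw1) (by simp [wl]) (by simp [wr])
  rw [rN_self, rf_split hε hu hu2 (rcont hw), rN_conj] at h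
  constructor
  · refine le_trans ?_ h
    refine le_trans ?_ (Complex.abs_im_le_norm _)
    simp [abs_mul]
  · refine le_trans ?_ h
    refine le_trans (le_trans ?_ (le_abs_self _)) (Complex.abs_re_le_norm _)
    simp

theorem RGeo.umin (G : RGeo u u1 u2 u3 ρ ρ1 yc m M d r) {y : ℝ} (hy : y ∈ Icc (-1:ℝ) 1) :
    u yc ≤ u y := by
  have r0 := G.r0
  have m0 := G.m0
  rcases le_total yc y with h | h
  · have := G.right.1 0 (y - yc) le_rfl (by linarith) (by linarith [hy.2, G.d0])
    rw [add_zero, add_sub_cancel] at this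
    have : 0 ≤ m / 2 * ((y - yc) ^ 2 - 0 ^ 2) := by
      rw [zero_pow (by norm_num), sub_zero]; positivity
    linarith
  · have := G.left.1 0 (yc - y) le_rfl (by linarith) (by linarith [hy.1, G.d0])
    rw [sub_zero, sub_sub_cancel] at this
    have : 0 ≤ m / 2 * ((yc - y) ^ 2 - 0 ^ 2) := by
      rw [zero_pow (by norm_num), sub_zero]; positivity
    linarith

theorem RGeo.zI (G : RGeo u u1 u2 u3 ρ ρ1 yc m M d r) {y : ℝ} (hy : y ∈ Icc (yc - r) (yc + r)) :
    y ∈ Icc (-1:ℝ) 1 := ⟨by linarith [hy.1, G.hl, G.r0], by linarith [hy.2, G.hr, G.r0]⟩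

theorem RGeo.zpos (G : RGeo u u1 u2 u3 ρ ρ1 yc m M d r) {y : ℝ} (hy : y ∈ Icc (yc - r) (yc + r)) :
    m ≤ u2 y := G.pos y (by rw [abs_le]; constructor <;> linarith [hy.1, hy.2, G.r0])

theorem RGeo.zup (G : RGeo u u1 u2 u3 ρ ρ1 yc m M d r) {y : ℝ} (hy : y ∈ Icc (-1:ℝ) 1) :
    |u2 y| ≤ M := G.b2 y ⟨by linarith [hy.1, G.d0], by linarith [hy.2, G.d0]⟩

/-- Case 2a -/
theorem RGeo.case2a (G : RGeo u u1 u2 u3 ρ ρ1 yc m M d r) (hε : ε ≠ 0)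
    (hw : ∀ y, HasDerivAt w (w1 y) y) (hw1 : Continuous w1) (wl : w (-1) = 0) (wr : w 1 = 0)
    (hs : RStar u u2 yc r cr ε k δ w w1) (hδ : 0 ≤ δ) {η : ℝ} (hη : 0 < η)
    (h : η * (cr - u yc) ≤ |ε|) (hL : 0 ≤ cr - u yc) : √(rN k w w1) ≤ (1 + 1 / η) * δ := by
  have cw := rcont hw
  have cu := G.cu
  have cu2 := G.cu2
  have r0 := G.r0
  have m0 := G.m0
  obtain ⟨h1, h2⟩ := star_self cu cu2 hε hw hw1 wl wr hs
  set W := √(rN k w w1) with hW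
  have hW0 : 0 ≤ W := Real.sqrt_nonneg _
  have hW2 : rN k w w1 = W ^ 2 := (Real.sq_sqrt (rN_nonneg _ _ _)).symm
  set J := ∫ y in (yc - r)..(yc + r), u2 y * ‖w y‖ ^ 2 / ((u y - cr) ^ 2 + ε ^ 2) with hJ
  have c1 : Continuous fun y => u2 y * (u y - cr) * ‖w y‖ ^ 2 / ((u y - cr) ^ 2 + ε ^ 2) :=
    Continuous.div (by fun_prop) (by fun_prop) (fun y => (nf_pos hε _).ne')
  have c2 : Continuous fun y => -(cr - u yc) * (u2 y * ‖w y‖ ^ 2 / ((u y - cr) ^ 2 + ε ^ 2)) :=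
    continuous_const.mul (Continuous.div (by fun_prop) (by fun_prop) (fun y => (nf_pos hε _).ne'))
  have h3 : -(cr - u yc) * J ≤
      ∫ y in (yc - r)..(yc + r), u2 y * (u y - cr) * ‖w y‖ ^ 2 / ((u y - cr) ^ 2 + ε ^ 2) := by
    rw [hJ, ← intervalIntegral.integral_const_mul]
    apply intervalIntegral.integral_mono_on (by linarith) (c2.intervalIntegrable _ _)
      (c1.intervalIntegrable _ _)
    intro y hy
    have p1 := G.zpos hy
    have p2 := G.umin (G.zI hy)
    have : u2 y * (u y - cr) * ‖w y‖ ^ 2 / ((u y - cr) ^ 2 + ε ^ 2)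
      = (u y - cr) * (u2 y * ‖w y‖ ^ 2 / ((u y - cr) ^ 2 + ε ^ 2)) := by ring
    rw [this]
    have p3 : 0 ≤ u2 y := by linarith
    apply mul_le_mul_of_nonneg_right (by linarith)
    have := nf_pos hε (u y - cr)
    positivity
  have h4 : (cr - u yc) * J ≤ 1 / η * (δ * W) := by
    have e1 : (cr - u yc) * J ≤ (cr - u yc) * |J| := mul_le_mul_of_nonneg_left (le_abs_self _) hL
    have e2 : η * (cr - u yc) * |J| ≤ |ε| * |J| := mul_le_mul_of_nonneg_right h (abs_nonneg _)
    rw [one_div, inv_mul_eq_div, le_div_iff₀ hη]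
    have e3 := mul_le_mul_of_nonneg_right e1 hη.le
    linarith
  by_contra hc
  push Not at hc
  have hW1 : 0 < W := lt_of_le_of_lt (by positivity) hc
  have := mul_pos hW1 (sub_pos.2 hc)
  rw [hW2] at h2
  linarith

/-- Geometry of the two roots of `u = cr`. -/
structure RRoot (u : ℝ → ℝ) (yc m M r cr L y1 y2 : ℝ) : Prop where
  L0 : 0 < L
  L1 : L ≤ 1
  Lr : 8 * L ≤ m * r
  hL : L ^ 2 = cr - u yc
  h1 : u y1 = cr
  h2 : u y2 = cr
  l1 : L / M ≤ yc - y1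
  l2 : L / M ≤ y2 - yc
  b1 : yc - y1 ≤ 2 * L / m
  b2 : y2 - yc ≤ 2 * L / m
  low2 : ∀ y ∈ Icc yc (yc + 2 * r), m * L / (2 * M) * |y - y2| ≤ |u y - cr|
  low1 : ∀ y ∈ Icc (yc - 2 * r) yc, m * L / (2 * M) * |y - y1| ≤ |u y - cr|
  up2 : ∀ y ∈ Icc y2 (y2 + L), |u y - cr| ≤ 3 * M / m * L * (y - y2)
  up1 : ∀ y ∈ Icc (y1 - L) y1, |u y - cr| ≤ 3 * M / m * L * (y1 - y)
  inn : ∀ y ∈ Icc y1 y2, u y ≤ cr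
  out2 : ∀ y ∈ Icc y2 1, cr ≤ u y
  out1 : ∀ y ∈ Icc (-1) y1, cr ≤ u y

/-- one sided root -/
theorem ra_root {v : ℝ → ℝ} {b L : ℝ} (hv : Continuous v) (hm : 0 < m) (hm1 : m ≤ 1) (hM : 1 ≤ M)
    (hlow : ∀ s t, 0 ≤ s → s ≤ t → t ≤ b → m / 2 * (t ^ 2 - s ^ 2) ≤ v t - v s)
    (hup : ∀ s t, 0 ≤ s → s ≤ t → t ≤ b → v t - v s ≤ M / 2 * (t ^ 2 - s ^ 2))
    (L0 : 0 < L) (hb : 3 * L / m ≤ b) :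
    ∃ x : ℝ, v x - v 0 = L ^ 2 ∧ L / M ≤ x ∧ x ≤ 2 * L / m ∧
      (∀ t, 0 ≤ t → t ≤ b → m * L / (2 * M) * |t - x| ≤ |v t - v 0 - L ^ 2|) ∧
      (∀ t, x ≤ t → t ≤ x + L → |v t - v 0 - L ^ 2| ≤ 3 * M / m * L * (t - x)) ∧
      (∀ t, 0 ≤ t → t ≤ x → v t - v 0 ≤ L ^ 2) ∧ (∀ t, x ≤ t → t ≤ b → L ^ 2 ≤ v t - v 0) := by
  have hM0 : 0 < M := by linarith
  have hLm : 0 < L / m := by positivity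
  have e2 : 2 * L / m = 2 * (L / m) := by ring
  have e3 : 3 * L / m = 3 * (L / m) := by ring
  have hLLm : L ≤ L / m := by rw [le_div_iff₀ hm]; exact mul_le_of_le_one_right L0.le hm1
  have hLmL : L / M ≤ L := div_le_self L0.le hM
  have hLM0 : 0 < L / M := by positivity
  obtain ⟨x, hx, hvx⟩ : ∃ x ∈ Icc (0:ℝ) (2 * L / m), v x = v 0 + L ^ 2 := by
    have := intermediate_value_Icc (by positivity : (0:ℝ) ≤ 2 * L / m) hv.continuousOn
    apply this
    refine ⟨by linarith [sq_nonneg L], ?_⟩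
    have h := hlow 0 (2 * L / m) le_rfl (by positivity) (by linarith)
    have : L ^ 2 ≤ m / 2 * ((2 * L / m) ^ 2 - 0 ^ 2) := by
      have : m / 2 * ((2 * L / m) ^ 2 - 0 ^ 2) = L ^ 2 * (2 / m) := by field_simp; ring
      rw [this]
      apply le_mul_of_one_le_right (by positivity)
      rw [le_div_iff₀ hm]; linarith
    linarith
  have hxb : x ≤ b := by linarith [hx.2]
  have hxl : L / M ≤ x := by
    have h := hup 0 x le_rfl hx.1 hxb
    have h5 : L ^ 2 / M ≤ x ^ 2 / 2 := by rw [div_le_iff₀ hM0]; linarith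
    have h6 : (L / M) ^ 2 ≤ L ^ 2 / M := by
      rw [div_pow]; gcongr; exact le_self_pow₀ hM (by norm_num)
    apply le_of_sq_le_sq ?_ hx.1
    linarith [sq_nonneg x]
  have mono : ∀ s t, 0 ≤ s → s ≤ t → t ≤ b → v s ≤ v t := by
    intro s t h0 h1 h2
    have := hlow s t h0 h1 h2
    have h3 : 0 ≤ m / 2 * (t ^ 2 - s ^ 2) := by
      have : s ^ 2 ≤ t ^ 2 := by gcongr
      have : 0 ≤ t ^ 2 - s ^ 2 := by linarith
      positivity
    linarith
  refine ⟨x, by linarith, hxl, hx.2, ?_, ?_, ?_, ?_⟩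
  · intro t h0 h1
    have key : ∀ p q, 0 ≤ p → p ≤ q → q ≤ b → L / M ≤ p + q →
        m * L / (2 * M) * (q - p) ≤ v q - v p := by
      intro p q h0 h1 h2 h3
      refine le_trans ?_ (hlow p q h0 h1 h2)
      have := mul_le_mul_of_nonneg_left h3 (mul_nonneg (by positivity : 0 ≤ m / 2) (sub_nonneg.2 h1))
      calc _ = m / 2 * (q - p) * (L / M) := by ring
        _ ≤ _ := this
        _ = _ := by ring
    rcases le_total t x with h | h
    · rw [abs_of_nonpos (by linarith)]
      refine le_trans ?_ (neg_le_abs _)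
      have := key t x h0 h hxb (by linarith)
      linarith
    · rw [abs_of_nonneg (by linarith)]
      refine le_trans ?_ (le_abs_self _)
      have := key x t hx.1 h h1 (by linarith)
      linarith
  · intro t h0 h1
    have htb : t ≤ b := by linarith [hx.2]
    have h2 := mono x t hx.1 h0 htb
    rw [abs_of_nonneg (by linarith)]
    have h3 := hup x t hx.1 h0 htb
    have h4 : t + x ≤ 6 * (L / m) := by linarith [hx.2]
    have := mul_le_mul_of_nonneg_left h4 (mul_nonneg (by positivity : 0 ≤ M / 2) (sub_nonneg.2 h0))
    calc _ ≤ M / 2 * (t ^ 2 - x ^ 2) := by linarith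
      _ = M / 2 * (t - x) * (t + x) := by ring
      _ ≤ _ := this
      _ = _ := by ring
  · intro t h0 h1
    have := mono t x h0 h1 hxb
    linarith
  · intro t h0 h1
    have := mono x t hx.1 h0 h1
    linarith

theorem RGeo.root (G : RGeo u u1 u2 u3 ρ ρ1 yc m M d r) {L : ℝ} (L0 : 0 < L) (L1 : L ≤ 1)
    (Lr : 8 * L ≤ m * r) (hL : L ^ 2 = cr - u yc) : ∃ y1 y2, RRoot u yc m M r cr L y1 y2 := by
  have m0 := G.m0
  have r0 := G.r0
  have hl := G.hl
  have hr := G.hr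
  have d0 := G.d0
  have cu := G.cu
  have hb : 3 * L / m ≤ r := by rw [div_le_iff₀ m0]; linarith
  obtain ⟨x2, a1, a2, a3, a4, a5, a6, a7⟩ := ra_root (v := fun t => u (yc + t)) (b := 1 + d - yc)
    (by fun_prop) m0 G.m1 G.M1 G.right.1 G.right.2.1 L0 (by linarith)
  obtain ⟨x1, c1, c2, c3, c4, c5, c6, c7⟩ := ra_root (v := fun t => u (yc - t)) (b := 1 + d + yc)
    (by fun_prop) m0 G.m1 G.M1 G.left.1 G.left.2.1 L0 (by linarith)
  simp only [add_zero, sub_zero] at a1 a4 a5 a6 a7 c1 c4 c5 c6 c7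
  have hM0 : 0 < M := by linarith [G.M1]
  have hLM0 : 0 < L / M := by positivity
  refine ⟨yc - x1, yc + x2, L0, L1, Lr, hL, by linarith, by linarith, by linarith, by linarith,
    by linarith, by linarith, ?_, ?_, ?_, ?_, ?_, ?_, ?_⟩
  · intro y hy
    have := a4 (y - yc) (by linarith [hy.1]) (by linarith [hy.2])
    rwa [add_sub_cancel, hL, sub_sub_sub_cancel_right, sub_sub] at this
  · intro y hy
    have := c4 (yc - y) (by linarith [hy.2]) (by linarith [hy.1])
    rwa [sub_sub_cancel, hL, sub_sub_sub_cancel_right, abs_sub_comm (yc - y),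
      show x1 - (yc - y) = y - (yc - x1) by ring] at this
  · intro y hy
    have := a5 (y - yc) (by linarith [hy.1]) (by linarith [hy.2])
    rwa [add_sub_cancel, hL, sub_sub_sub_cancel_right, sub_sub] at this
  · intro y hy
    have := c5 (yc - y) (by linarith [hy.2]) (by linarith [hy.1])
    rwa [sub_sub_cancel, hL, sub_sub_sub_cancel_right,
      show yc - y - x1 = yc - x1 - y by ring] at this
  · intro y hy
    rcases le_total yc y with h | h
    · have := a6 (y - yc) (by linarith) (by linarith [hy.2])
      rw [add_sub_cancel] at this
      linarith
    · have := c6 (yc - y) (by linarith) (by linarith [hy.1])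
      rw [sub_sub_cancel] at this
      linarith
  · intro y hy
    have := a7 (y - yc) (by linarith [hy.1]) (by linarith [hy.2])
    rw [add_sub_cancel] at this
    linarith
  · intro y hy
    have := c7 (yc - y) (by linarith [hy.2]) (by linarith [hy.1])
    rw [sub_sub_cancel] at this
    linarith

end AuxG

section AuxH
open Set

theorem ra_chi : ∃ (C0 : ℝ) (χ χ1 : ℝ → ℝ), 1 ≤ C0 ∧ (∀ t, HasDerivAt χ (χ1 t) t) ∧ Continuous χ1 ∧
    (∀ t, 0 ≤ χ t ∧ χ t ≤ 1) ∧ (∀ t, |χ1 t| ≤ C0) ∧ (∀ t, |t| ≤ 1 → χ t = 1) ∧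
    (∀ t, |t| < 1 → χ1 t = 0) ∧ (∀ t, 2 ≤ |t| → χ t = 0) ∧ (∀ t, 2 < |t| → χ1 t = 0) := by
  set χ : ℝ → ℝ := fun t => Real.smoothTransition (2 - t) * Real.smoothTransition (2 + t) with hχ
  have hd : ContDiff ℝ 1 χ := by
    have h : ContDiff ℝ 1 Real.smoothTransition := Real.smoothTransition.contDiff
    exact (h.comp (contDiff_const.sub contDiff_id)).mul (h.comp (contDiff_const.add contDiff_id))
  have h1 : ∀ t, |t| ≤ 1 → χ t = 1 := by
    intro t ht
    rw [abs_le] at ht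
    simp only [hχ]
    rw [Real.smoothTransition.one_of_one_le (by linarith),
      Real.smoothTransition.one_of_one_le (by linarith), one_mul]
  have h2 : ∀ t, 2 ≤ |t| → χ t = 0 := by
    intro t ht
    simp only [hχ]
    rcases le_abs.1 ht with h | h
    · rw [Real.smoothTransition.zero_of_nonpos (by linarith), zero_mul]
    · rw [mul_comm, Real.smoothTransition.zero_of_nonpos (by linarith), zero_mul]
  have z1 : ∀ t, |t| < 1 → deriv χ t = 0 := by
    intro t ht
    have : χ =ᶠ[nhds t] fun _ => 1 := by
      filter_upwards [(isOpen_lt continuous_abs continuous_const).mem_nhds ht] with x hx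
      exact h1 x (le_of_lt hx)
    rw [this.deriv_eq]; simp
  have z2 : ∀ t, 2 < |t| → deriv χ t = 0 := by
    intro t ht
    have : χ =ᶠ[nhds t] fun _ => 0 := by
      filter_upwards [(isOpen_lt continuous_const continuous_abs).mem_nhds ht] with x hx
      exact h2 x (le_of_lt hx)
    rw [this.deriv_eq]; simp
  have c1 : Continuous (deriv χ) := hd.continuous_deriv le_rfl
  obtain ⟨C, hC⟩ := (isCompact_Icc (a := (-2:ℝ)) (b := 2)).exists_bound_of_continuousOn c1.continuousOn
  refine ⟨max C 1, χ, deriv χ, le_max_right _ _, fun t => (hd.differentiable (by norm_num) t).hasDerivAt,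
    c1, ?_, ?_, h1, z1, h2, z2⟩
  · intro t
    constructor
    · exact mul_nonneg (Real.smoothTransition.nonneg _) (Real.smoothTransition.nonneg _)
    · exact mul_le_one₀ (Real.smoothTransition.le_one _) (Real.smoothTransition.nonneg _)
        (Real.smoothTransition.le_one _)
  · intro t
    rcases le_or_gt |t| 2 with h | h
    · exact (hC t (abs_le.1 h)).trans (le_max_left _ _)
    · rw [z2 t h, abs_zero]; positivity

/-- bump properties -/
structure RBump (C0 c0 τ : ℝ) (B B1 : ℝ → ℝ) : Prop where
  d : ∀ y, HasDerivAt B (B1 y) y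
  c : Continuous B1
  nn : ∀ y, 0 ≤ B y
  le : ∀ y, B y ≤ 1
  bd : ∀ y, |B1 y| ≤ C0 / τ
  one : ∀ y, |y - c0| ≤ τ → B y = 1
  z1 : ∀ y, |y - c0| < τ → B1 y = 0
  z : ∀ y, 2 * τ ≤ |y - c0| → B y = 0
  z2 : ∀ y, 2 * τ < |y - c0| → B1 y = 0

theorem ra_bump : ∃ C0 : ℝ, 1 ≤ C0 ∧ ∀ c0 τ : ℝ, 0 < τ → ∃ B B1 : ℝ → ℝ, RBump C0 c0 τ B B1 := by
  obtain ⟨C0, χ, χ1, hC, hd, hc, h01, hb, h1, z1, h2, z2⟩ := ra_chi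
  refine ⟨C0, hC, fun c0 τ hτ => ⟨fun y => χ ((y - c0) / τ), fun y => χ1 ((y - c0) / τ) * (1 / τ), ?_⟩⟩
  have e : ∀ y : ℝ, |(y - c0) / τ| = |y - c0| / τ := fun y => by rw [abs_div, abs_of_pos hτ]
  constructor
  · intro y
    exact (hd _).comp y (((hasDerivAt_id y).sub_const c0).div_const τ)
  · exact (hc.comp (by fun_prop)).mul continuous_const
  · exact fun y => (h01 _).1
  · exact fun y => (h01 _).2
  · intro y
    rw [abs_mul, abs_of_pos (by positivity : 0 < 1 / τ), div_eq_mul_one_div C0]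
    gcongr
    exact hb _
  · intro y hy
    apply h1; rw [e, div_le_one hτ]; exact hy
  · intro y hy
    rw [z1, zero_mul]; rw [e, div_lt_one hτ]; exact hy
  · intro y hy
    apply h2; rw [e, le_div_iff₀ hτ]; exact hy
  · intro y hy
    rw [z2, zero_mul]; rw [e, lt_div_iff₀ hτ]; exact hy

theorem RBump.cont {C0 c0 τ : ℝ} {B B1 : ℝ → ℝ} (b : RBump C0 c0 τ B B1) : Continuous B :=
  continuous_iff_continuousAt.2 fun y => (b.d y).continuousAt

theorem ra_restr {E : Type*} [NormedAddCommGroup E] [NormedSpace ℝ E] {Φ : ℝ → E} {p q a b : ℝ}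
    (hΦ : Continuous Φ) (h1 : p ≤ a) (h3 : b ≤ q)
    (z1 : ∀ y ∈ Icc p a, Φ y = 0) (z2 : ∀ y ∈ Icc b q, Φ y = 0) :
    ∫ y in p..q, Φ y = ∫ y in a..b, Φ y := by
  rw [← intervalIntegral.integral_add_adjacent_intervals (hΦ.intervalIntegrable p a)
    (hΦ.intervalIntegrable a q), ← intervalIntegral.integral_add_adjacent_intervals
    (hΦ.intervalIntegrable a b) (hΦ.intervalIntegrable b q)]
  have e1 : ∫ y in p..a, Φ y = ∫ y in p..a, (0:E) :=
    intervalIntegral.integral_congr (fun y hy => z1 y (by rwa [uIcc_of_le h1] at hy))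
  have e2 : ∫ y in b..q, Φ y = ∫ y in b..q, (0:E) :=
    intervalIntegral.integral_congr (fun y hy => z2 y (by rwa [uIcc_of_le h3] at hy))
  rw [e1, e2]; simp

/-- energy of a scaled bump -/
theorem RBump.rN {C0 c0 τ k : ℝ} {B B1 : ℝ → ℝ} (b : RBump C0 c0 τ B B1) (hτ : 0 < τ)
    (hl : -1 ≤ c0 - 2 * τ) (hr : c0 + 2 * τ ≤ 1) (z : ℂ) :
    _root_.rN k (fun y => z * (B y : ℂ)) (fun y => z * (B1 y : ℂ)) ≤ ‖z‖ ^ 2 * (4 * (C0 ^ 2 / τ + k ^ 2 * τ)) := by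
  have cB := b.cont
  have cB1 := b.c
  have key : ∀ (F : ℝ → ℝ) (S : ℝ), Continuous F → (∀ y, |F y| ≤ S) → (∀ y, 2 * τ < |y - c0| → F y = 0) →
      ∫ y in (-1:ℝ)..1, ‖z * (F y : ℂ)‖ ^ 2 ≤ ‖z‖ ^ 2 * (4 * τ * S ^ 2) := by
    intro F S hF hS h0
    have hc : Continuous fun y => ‖z * (F y : ℂ)‖ ^ 2 := by fun_prop
    have h0' : ∀ y, 2 * τ ≤ |y - c0| → F y = 0 := by
      intro y hy
      have hcl : IsClosed {y | F y = 0} := isClosed_singleton.preimage hF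
      have hsub : closure {y : ℝ | 2 * τ < |y - c0|} ⊆ {y | F y = 0} :=
        closure_minimal (fun y hy => h0 y hy) hcl
      apply hsub
      rw [Metric.mem_closure_iff]
      intro e he
      rcases le_abs.1 hy with h | h
      · refine ⟨y + e / 2, ?_, ?_⟩
        · simp only [mem_ofPred_eq]; exact lt_of_lt_of_le (by linarith) (le_abs_self _)
        · rw [Real.dist_eq, abs_lt]; constructor <;> linarith
      · refine ⟨y - e / 2, ?_, ?_⟩
        · simp only [mem_ofPred_eq]; exact lt_of_lt_of_le (by linarith) (neg_le_abs _)
        · rw [Real.dist_eq, abs_lt]; constructor <;> linarith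
    rw [ra_restr hc (a := c0 - 2 * τ) (b := c0 + 2 * τ) hl hr]
    · calc ∫ y in (c0 - 2 * τ)..(c0 + 2 * τ), ‖z * (F y : ℂ)‖ ^ 2
          ≤ ∫ y in (c0 - 2 * τ)..(c0 + 2 * τ), (‖z‖ ^ 2 * S ^ 2) := by
            apply intervalIntegral.integral_mono_on (by linarith) (hc.intervalIntegrable _ _) (by simp)
            intro y _
            rw [norm_mul, mul_pow, Complex.norm_real, Real.norm_eq_abs]
            gcongr
            exact hS y
        _ = _ := by rw [intervalIntegral.integral_const, smul_eq_mul]; ring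
    · intro y hy
      rw [h0' y]
      · simp
      · rw [le_abs]; right; linarith [hy.2]
    · intro y hy
      rw [h0' y]
      · simp
      · rw [le_abs]; left; linarith [hy.1]
  have e0 := key B 1 cB (fun y => by rw [abs_of_nonneg (b.nn y)]; exact b.le y)
    (fun y hy => b.z y hy.le)
  have e1 := key B1 (C0 / τ) cB1 b.bd b.z2
  unfold _root_.rN
  have e3 := mul_le_mul_of_nonneg_left e0 (sq_nonneg k)
  calc _ ≤ ‖z‖ ^ 2 * (4 * τ * (C0 / τ) ^ 2) + k ^ 2 * (‖z‖ ^ 2 * (4 * τ * 1 ^ 2)) := add_le_add e1 e3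
    _ = _ := by field_simp

/-- Picone type inequality -/
theorem ra_picone {R R1 : ℝ → ℂ} {p p1 φ : ℝ → ℝ} {a b C : ℝ} (hab : a < b)
    (hR : ∀ y, HasDerivAt R (R1 y) y) (hR1 : Continuous R1) (Ra : R a = 0) (Rb : R b = 0)
    (hp : ∀ y ∈ Ioo a b, HasDerivAt p (p1 y) y)
    (hb : ∀ y ∈ Ioo a b, |p y| ≤ C / (y - a) + C / (b - y)) (hφ : Continuous φ)
    (h : ∀ y ∈ Ioo a b, ‖R1 y‖ ^ 2 + ‖R y‖ ^ 2 * (p y ^ 2 + p1 y) ≤ φ y) : 0 ≤ ∫ y in a..b, φ y := by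
  obtain ⟨K, hK⟩ := (isCompact_Icc (a := a) (b := b)).exists_bound_of_continuousOn hR1.continuousOn
  have hK0 : 0 ≤ K := (norm_nonneg _).trans (hK a ⟨le_rfl, hab.le⟩)
  have lip : ∀ s ∈ Icc a b, ∀ t ∈ Icc a b, ‖R t - R s‖ ≤ K * ‖t - s‖ := by
    intro s hs t ht
    exact (convex_Icc a b).norm_image_sub_le_of_norm_hasDerivWithin_le
      (fun x hx => (hR x).hasDerivWithinAt) hK hs ht
  have la : ∀ y ∈ Icc a b, ‖R y‖ ≤ K * (y - a) := by
    intro y hy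
    have := lip a ⟨le_rfl, hab.le⟩ y hy
    rwa [Ra, sub_zero, Real.norm_eq_abs, abs_of_nonneg (by linarith [hy.1])] at this
  have lb : ∀ y ∈ Icc a b, ‖R y‖ ≤ K * (b - y) := by
    intro y hy
    have := lip y hy b ⟨hab.le, le_rfl⟩
    rwa [Rb, zero_sub, norm_neg, Real.norm_eq_abs, abs_of_nonneg (by linarith [hy.2])] at this
  have hC0 : 0 ≤ C := by
    by_contra hc
    push Not at hc
    have := hb ((a + b) / 2) ⟨by linarith, by linarith⟩
    have h1 : C / ((a + b) / 2 - a) < 0 := div_neg_of_neg_of_pos hc (by linarith)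
    have h2 : C / (b - (a + b) / 2) < 0 := div_neg_of_neg_of_pos hc (by linarith)
    linarith [abs_nonneg (p ((a + b) / 2))]
  set Φ : ℝ → ℝ := fun y => ‖R y‖ ^ 2 * p y with hΦ
  have bound : ∀ y ∈ Ioo a b, |Φ y| ≤ 2 * K ^ 2 * C * (y - a) ∧ |Φ y| ≤ 2 * K ^ 2 * C * (b - y) := by
    intro y hy
    have hy' : y ∈ Icc a b := ⟨hy.1.le, hy.2.le⟩
    have p1 : 0 < y - a := by linarith [hy.1]
    have p2 : 0 < b - y := by linarith [hy.2]
    have h1 := la y hy'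
    have h2 := lb y hy'
    have n0 := norm_nonneg (R y)
    simp only [hΦ]
    rw [abs_mul, abs_of_nonneg (by positivity)]
    have h3 := mul_le_mul_of_nonneg_left (hb y hy) (sq_nonneg ‖R y‖)
    have q1 : ‖R y‖ ^ 2 ≤ K ^ 2 * (y - a) ^ 2 := by rw [← mul_pow]; gcongr
    have q2 : ‖R y‖ ^ 2 ≤ K ^ 2 * (b - y) ^ 2 := by rw [← mul_pow]; gcongr
    have q3 : ‖R y‖ ^ 2 ≤ K ^ 2 * ((y - a) * (b - y)) := by
      calc ‖R y‖ ^ 2 = ‖R y‖ * ‖R y‖ := by ring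
        _ ≤ K * (y - a) * (K * (b - y)) := by gcongr
        _ = _ := by ring
    constructor
    · refine h3.trans ?_
      calc ‖R y‖ ^ 2 * (C / (y - a) + C / (b - y))
          = ‖R y‖ ^ 2 * (C / (y - a)) + ‖R y‖ ^ 2 * (C / (b - y)) := by ring
        _ ≤ K ^ 2 * (y - a) ^ 2 * (C / (y - a)) + K ^ 2 * ((y - a) * (b - y)) * (C / (b - y)) := by gcongr
        _ = _ := by field_simp; ring
    · refine h3.trans ?_
      calc ‖R y‖ ^ 2 * (C / (y - a) + C / (b - y))
          = ‖R y‖ ^ 2 * (C / (y - a)) + ‖R y‖ ^ 2 * (C / (b - y)) := by ring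
        _ ≤ K ^ 2 * ((y - a) * (b - y)) * (C / (y - a)) + K ^ 2 * (b - y) ^ 2 * (C / (b - y)) := by gcongr
        _ = _ := by field_simp; ring
  have Φa : Φ a = 0 := by simp [hΦ, Ra]
  have Φb : Φ b = 0 := by simp [hΦ, Rb]
  have hsq : ∀ y, HasDerivAt (fun y => ‖R y‖ ^ 2) (2 * inner ℝ (R y) (R1 y)) y := fun y => (hR y).norm_sq
  have hder : ∀ y ∈ Ioo a b, HasDerivAt Φ (2 * inner ℝ (R y) (R1 y) * p y + ‖R y‖ ^ 2 * p1 y) y :=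
    fun y hy => (hsq y).mul (hp y hy)
  have hcont : ContinuousOn Φ (Icc a b) := by
    have edge : ∀ c : ℝ, Φ c = 0 → (∀ y ∈ Icc a b, |Φ y| ≤ 2 * K ^ 2 * C * |y - c|) →
        ContinuousWithinAt Φ (Icc a b) c := by
      intro c hc hbd
      rw [ContinuousWithinAt, hc]
      apply squeeze_zero_norm' (a := fun y => 2 * K ^ 2 * C * |y - c|)
      · filter_upwards [self_mem_nhdsWithin] with y hy
        exact hbd y hy
      · have : Continuous fun y => 2 * K ^ 2 * C * |y - c| := by fun_prop
        have h := (this.tendsto c).mono_left (nhdsWithin_le_nhds (s := Icc a b))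
        simpa using h
    intro y hy
    rcases eq_or_lt_of_le hy.1 with h1 | h1
    · rw [← h1]
      apply edge a Φa
      intro y hy
      rcases eq_or_lt_of_le hy.1 with h1 | h1
      · rw [← h1, Φa]; simp
      rcases eq_or_lt_of_le hy.2 with h2 | h2
      · rw [h2, Φb, abs_zero]; positivity
      rw [abs_of_pos (sub_pos.2 h1)]; exact (bound y ⟨h1, h2⟩).1
    rcases eq_or_lt_of_le hy.2 with h2 | h2
    · rw [h2]
      apply edge b Φb
      intro y hy
      rcases eq_or_lt_of_le hy.1 with h1 | h1
      · rw [← h1, Φa, abs_zero]; positivity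
      rcases eq_or_lt_of_le hy.2 with h2 | h2
      · rw [h2, Φb]; simp
      rw [abs_sub_comm, abs_of_pos (sub_pos.2 h2)]; exact (bound y ⟨h1, h2⟩).2
    · exact (hder y ⟨h1, h2⟩).continuousAt.continuousWithinAt
  have := intervalIntegral.sub_le_integral_of_hasDeriv_right_of_le hab.le hcont
    (fun y hy => (hder y hy).hasDerivWithinAt) (φ := φ) hφ.continuousOn.integrableOn_Icc (by
      intro y hy
      refine le_trans ?_ (h y hy)
      have h1 : inner ℝ (R y) (R1 y) * p y ≤ ‖R y‖ * ‖R1 y‖ * |p y| := by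
        calc inner ℝ (R y) (R1 y) * p y ≤ |inner ℝ (R y) (R1 y) * p y| := le_abs_self _
          _ = |inner ℝ (R y) (R1 y)| * |p y| := abs_mul _ _
          _ ≤ _ := by gcongr; exact abs_real_inner_le_norm _ _
      have h2 := sq_nonneg (‖R1 y‖ - ‖R y‖ * |p y|)
      have h3 : (‖R y‖ * |p y|) ^ 2 = ‖R y‖ ^ 2 * p y ^ 2 := by rw [mul_pow, sq_abs]
      have h4 : (‖R1 y‖ - ‖R y‖ * |p y|) ^ 2
        = ‖R1 y‖ ^ 2 - 2 * (‖R y‖ * ‖R1 y‖ * |p y|) + (‖R y‖ * |p y|) ^ 2 := by ring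
      linarith)
  rw [Φa, Φb, sub_zero] at this
  exact this

end AuxH

section AuxI
open Set

variable {u u1 u2 u3 ρ ρ1 : ℝ → ℝ} {yc m M d r cr ε k δ L y1 y2 : ℝ} {w w1 T T1 : ℝ → ℂ}

theorem rR_norm (U : ℝ) (z t : ℂ) : ‖t - U • z‖ ^ 2 = ‖t‖ ^ 2 - 2 * (U * inner ℝ z t) + ‖z‖ ^ 2 * U ^ 2 := by
  rw [norm_sub_sq_real, inner_smul_right, norm_smul, mul_pow, Real.norm_eq_abs, sq_abs,
    real_inner_comm]
  ring

theorem RGeo.inner_half (G : RGeo u u1 u2 u3 ρ ρ1 yc m M d r) (hε : ε ≠ 0)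
    (hT : ∀ y, HasDerivAt T (T1 y) y) (hT1 : Continuous T1) {z : ℂ} {a b C : ℝ} (hab : a < b)
    (Ra : T a - (u a - cr) • z = 0) (Rb : T b - (u b - cr) • z = 0)
    (hsub : ∀ y ∈ Ioo a b, |y - yc| ≤ 2 * r) (hx : ∀ y ∈ Ioo a b, y - yc ≠ 0)
    (hU : ∀ y ∈ Ioo a b, u y - cr < 0)
    (hb : ∀ y ∈ Ioo a b, |1 / (y - yc)| + |u1 y / (u y - cr)| ≤ C / (y - a) + C / (b - y)) :
    0 ≤ ∫ y in a..b, (‖T1 y - u1 y • z‖ ^ 2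
      - 2 * (-(u2 y * (u y - cr) * ‖T y‖ ^ 2 / ((u y - cr) ^ 2 + ε ^ 2))
        + u2 y * (2 * inner ℝ z (T y) - ‖z‖ ^ 2 * (u y - cr)))) := by
  have cu := G.cu
  have cu1 := G.cu1
  have cu2 := G.cu2
  have cT := rcont hT
  refine ra_picone (R := fun y => T y - (u y - cr) • z) (R1 := fun y => T1 y - u1 y • z)
    (p := fun y => 1 / (y - yc) + u1 y / (u y - cr))
    (p1 := fun y => -1 / (y - yc) ^ 2 + (u2 y * (u y - cr) - u1 y * u1 y) / (u y - cr) ^ 2)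
    (C := C) hab ?_ ?_ Ra Rb ?_ ?_ ?_ ?_
  · intro y
    exact (hT y).sub (((G.hu y).sub_const cr).smul_const z)
  · fun_prop
  · intro y hy
    have h1 : HasDerivAt (fun y => 1 / (y - yc)) (-1 / (y - yc) ^ 2) y := by
      simpa using (((hasDerivAt_id y).sub_const yc).fun_inv (hx y hy))
    exact h1.add ((G.hu1 y).div ((G.hu y).sub_const cr) (hU y hy).ne)
  · intro y hy
    exact (abs_add_le _ _).trans (hb y hy)
  · have c1 : Continuous fun y => u2 y * (u y - cr) * ‖T y‖ ^ 2 / ((u y - cr) ^ 2 + ε ^ 2) :=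
      Continuous.div (by fun_prop) (by fun_prop) (fun y => (nf_pos hε _).ne')
    fun_prop
  · intro y hy
    have hx0 := hx y hy
    have hU0 := hU y hy
    have hpos := G.pos y (hsub y hy)
    have hpic := G.pic y (hsub y hy)
    have m0 := G.m0
    set x := y - yc with hxd
    set U := u y - cr with hUd
    have hnf := nf_pos hε U
    have e1 : (1 / x + u1 y / U) ^ 2 + (-1 / x ^ 2 + (u2 y * U - u1 y * u1 y) / U ^ 2)
        = 2 * (u1 y * x) / x ^ 2 / U + u2 y / U := by
      have := hU0.ne
      field_simp; ring
    have e2 : 2 * (u1 y * x) / x ^ 2 / U ≤ u2 y / U := by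
      apply div_le_div_of_nonpos_of_le hU0.le
      rw [le_div_iff₀ (by positivity)]; exact hpic
    rw [e1]
    have e3 : ‖T y - U • z‖ ^ 2 * (2 * (u1 y * x) / x ^ 2 / U + u2 y / U)
        ≤ ‖T y - U • z‖ ^ 2 * (2 * u2 y / U) := by
      apply mul_le_mul_of_nonneg_left _ (by positivity)
      have : 2 * u2 y / U = u2 y / U + u2 y / U := by ring
      linarith
    have e4 : ‖T y - U • z‖ ^ 2 * (2 * u2 y / U)
        = 2 * (u2 y * ‖T y‖ ^ 2 / U) - 2 * (u2 y * (2 * inner ℝ z (T y) - ‖z‖ ^ 2 * U)) := by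
      rw [rR_norm]
      have := hU0.ne
      field_simp; ring
    have e5 : u2 y * ‖T y‖ ^ 2 / U ≤ u2 y * U * ‖T y‖ ^ 2 / (U ^ 2 + ε ^ 2) := by
      have : u2 y * U * ‖T y‖ ^ 2 / (U ^ 2 + ε ^ 2) - u2 y * ‖T y‖ ^ 2 / U
          = u2 y * ‖T y‖ ^ 2 * ε ^ 2 / ((U ^ 2 + ε ^ 2) * (-U)) := by
        have := hU0.ne
        field_simp; ring
      have h2 : 0 ≤ u2 y * ‖T y‖ ^ 2 * ε ^ 2 / ((U ^ 2 + ε ^ 2) * (-U)) := by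
        have : 0 < -U := by linarith
        have : 0 ≤ u2 y := by linarith
        positivity
      linarith
    linarith

theorem RGeo.inner_ibp (G : RGeo u u1 u2 u3 ρ ρ1 yc m M d r)
    (hT : ∀ y, HasDerivAt T (T1 y) y) (hT1 : Continuous T1) (z : ℂ) {a b : ℝ}
    (Ta : T a = 0) (Tb : T b = 0) (ha : u a = cr) (hb : u b = cr) :
    ∫ y in a..b, ‖T1 y‖ ^ 2 = (∫ y in a..b, ‖T1 y - u1 y • z‖ ^ 2)
      - ∫ y in a..b, u2 y * (2 * inner ℝ z (T y) - ‖z‖ ^ 2 * (u y - cr)) := by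
  have cu := G.cu
  have cu1 := G.cu1
  have cu2 := G.cu2
  have cT := rcont hT
  have hd : ∀ y, HasDerivAt (fun y => ‖z‖ ^ 2 * (u1 y * (u y - cr)) - 2 * (u1 y * inner ℝ z (T y)))
      (‖z‖ ^ 2 * (u2 y * (u y - cr) + u1 y * u1 y)
        - 2 * (u2 y * inner ℝ z (T y) + u1 y * inner ℝ z (T1 y))) y := by
    intro y
    have h1 : HasDerivAt (fun y => (inner ℝ z (T y) : ℝ)) (inner ℝ z (T1 y)) y := by
      have := (hasDerivAt_const y z).inner ℝ (hT y)
      simpa using this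
    exact (((G.hu1 y).mul ((G.hu y).sub_const cr)).const_mul (‖z‖ ^ 2)).sub
      (((G.hu1 y).mul h1).const_mul 2)
  have h := intervalIntegral.integral_eq_sub_of_hasDerivAt (a := a) (b := b) (fun y _ => hd y)
    (by apply Continuous.intervalIntegrable; fun_prop)
  rw [Ta, Tb, ha, hb] at h
  simp only [sub_self, mul_zero, inner_zero_right] at h
  have e1 : ∫ y in a..b, ‖T1 y - u1 y • z‖ ^ 2 = ∫ y in a..b, (‖T1 y‖ ^ 2
      + (u2 y * (2 * inner ℝ z (T y) - ‖z‖ ^ 2 * (u y - cr)) +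
      (‖z‖ ^ 2 * (u2 y * (u y - cr) + u1 y * u1 y)
        - 2 * (u2 y * inner ℝ z (T y) + u1 y * inner ℝ z (T1 y))))) := by
    apply intervalIntegral.integral_congr
    intro y _
    simp only
    rw [rR_norm]; ring
  rw [e1, intervalIntegral.integral_add, intervalIntegral.integral_add, h]
  · ring
  all_goals (apply Continuous.intervalIntegrable; fun_prop)

/-- coercivity in the inner zone after removing the kernel direction -/
theorem RGeo.inner (G : RGeo u u1 u2 u3 ρ ρ1 yc m M d r) (X : RRoot u yc m M r cr L y1 y2) (hε : ε ≠ 0)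
    (hT : ∀ y, HasDerivAt T (T1 y) y) (hT1 : Continuous T1) {z : ℂ}
    (T1z : T y1 = 0) (T2z : T y2 = 0) (Tc : T yc - (u yc - cr) • z = 0) :
    1 / 2 * ∫ y in y1..y2, ‖T1 y - u1 y • z‖ ^ 2 ≤ (∫ y in y1..y2, ‖T1 y‖ ^ 2)
      + ∫ y in y1..y2, u2 y * (u y - cr) * ‖T y‖ ^ 2 / ((u y - cr) ^ 2 + ε ^ 2) := by
  have cu := G.cu
  have cu1 := G.cu1
  have cu2 := G.cu2
  have cT := rcont hT
  have L0 := X.L0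
  have m0 := G.m0
  have m1 := G.m1
  have r0 := G.r0
  have hl := G.hl
  have hr := G.hr
  have d0 := G.d0
  have hM0 : 0 < M := by linarith [G.M1]
  have hLM : 0 < L / M := by positivity
  have hLm : 2 * L / m ≤ r := by rw [div_le_iff₀ m0]; linarith [X.Lr]
  have l1 := X.l1
  have l2 := X.l2
  have b1 := X.b1
  have b2 := X.b2
  have hyI : ∀ y ∈ Icc y1 y2, |y - yc| ≤ r := by
    intro y hy; rw [abs_le]; constructor <;> linarith [hy.1, hy.2]
  have hm2 : 0 < m * L / (2 * M) := by positivity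
  set C := 1 + M * r / (m * L / (2 * M)) with hC
  have C1 : 0 < C := by positivity
  have ubd : ∀ y ∈ Icc y1 y2, |u1 y| ≤ M * r := by
    intro y hy
    have h := hyI y hy
    have h' := abs_le.1 h
    exact (G.up y ⟨by linarith, by linarith⟩).trans (by gcongr)
  have ubd2 : ∀ y ∈ Icc y1 y2, ∀ q, 0 < q → m * L / (2 * M) * q ≤ |u y - cr| →
      |u1 y / (u y - cr)| ≤ C / q - 1 / q := by
    intro y hy q hq h
    have e : C / q - 1 / q = (M * r) / (m * L / (2 * M) * q) := by
      rw [hC]; field_simp; ring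
    rw [e, abs_div]
    exact div_le_div₀ (by positivity) (ubd y hy) (by positivity) h
  have hneg : ∀ y ∈ Icc y1 y2, ∀ q, 0 < q → m * L / (2 * M) * q ≤ |u y - cr| → u y - cr < 0 := by
    intro y hy q hq h
    have h1 := X.inn y hy
    have h2 : 0 < |u y - cr| := lt_of_lt_of_le (by positivity) h
    exact lt_of_le_of_ne (by linarith) (abs_pos.1 h2)
  have R2 : T y2 - (u y2 - cr) • z = 0 := by rw [T2z, X.h2]; simp
  have R1 : T y1 - (u y1 - cr) • z = 0 := by rw [T1z, X.h1]; simp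
  have low2' : ∀ y ∈ Ioo yc y2, m * L / (2 * M) * (y2 - y) ≤ |u y - cr| := by
    intro y hy
    have := X.low2 y ⟨hy.1.le, by linarith [hy.2]⟩
    rwa [abs_sub_comm y, abs_of_pos (by linarith [hy.2])] at this
  have low1' : ∀ y ∈ Ioo y1 yc, m * L / (2 * M) * (y - y1) ≤ |u y - cr| := by
    intro y hy
    have := X.low1 y ⟨by linarith [hy.1], hy.2.le⟩
    rwa [abs_of_pos (by linarith [hy.1])] at this
  have H2 := G.inner_half (cr := cr) hε hT hT1 (z := z) (a := yc) (b := y2) (C := C) (by linarith) Tc R2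
    (fun y hy => (hyI y ⟨by linarith [hy.1], hy.2.le⟩).trans (by linarith))
    (fun y hy => by have := hy.1; intro h; linarith)
    (fun y hy => hneg y ⟨by linarith [hy.1], hy.2.le⟩ _ (by linarith [hy.2]) (low2' y hy))
    (fun y hy => by
      have a1 : 0 < y - yc := by linarith [hy.1]
      have a2 : 0 < y2 - y := by linarith [hy.2]
      have h := ubd2 y ⟨by linarith [hy.1], hy.2.le⟩ (y2 - y) a2 (low2' y hy)
      have h2 : |1 / (y - yc)| ≤ C / (y - yc) := by
        rw [abs_of_pos (by positivity)]; gcongr; rw [hC]; linarith [show 0 ≤ M * r / (m * L / (2 * M)) by positivity]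
      linarith [show 0 ≤ 1 / (y2 - y) by positivity])
  have H1 := G.inner_half (cr := cr) hε hT hT1 (z := z) (a := y1) (b := yc) (C := C) (by linarith) R1 Tc
    (fun y hy => (hyI y ⟨hy.1.le, by linarith [hy.2]⟩).trans (by linarith))
    (fun y hy => by have := hy.2; intro h; linarith)
    (fun y hy => hneg y ⟨hy.1.le, by linarith [hy.2]⟩ _ (by linarith [hy.1]) (low1' y hy))
    (fun y hy => by
      have a1 : 0 < yc - y := by linarith [hy.2]
      have a2 : 0 < y - y1 := by linarith [hy.1]
      have h := ubd2 y ⟨hy.1.le, by linarith [hy.2]⟩ (y - y1) a2 (low1' y hy)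
      have h2 : |1 / (y - yc)| ≤ C / (yc - y) := by
        rw [abs_div, abs_one, abs_sub_comm, abs_of_pos a1]; gcongr; rw [hC]; linarith [show 0 ≤ M * r / (m * L / (2 * M)) by positivity]
      linarith [show 0 ≤ 1 / (y - y1) by positivity])
  have c1 : Continuous fun y => u2 y * (u y - cr) * ‖T y‖ ^ 2 / ((u y - cr) ^ 2 + ε ^ 2) :=
    Continuous.div (by fun_prop) (by fun_prop) (fun y => (nf_pos hε _).ne')
  have H := add_nonneg H1 H2
  rw [intervalIntegral.integral_add_adjacent_intervals
    (by apply Continuous.intervalIntegrable; fun_prop) (by apply Continuous.intervalIntegrable; fun_prop),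
    intervalIntegral.integral_sub, intervalIntegral.integral_const_mul, intervalIntegral.integral_add,
    intervalIntegral.integral_neg] at H
  · have h3 := G.inner_ibp hT hT1 z T1z T2z X.h1 X.h2
    linarith
  all_goals (apply Continuous.intervalIntegrable; fun_prop)

end AuxI

section AuxJ
open Set

variable {u u1 u2 u3 ρ ρ1 : ℝ → ℝ} {yc m M d r cr ε k δ L y1 y2 : ℝ} {w w1 T T1 : ℝ → ℂ}

theorem sing_est {h : ℝ → ℂ} {p q y0 t D c : ℝ} (hpq : p ≤ q) (hp : y0 - t ≤ p) (hq : q ≤ y0 + t)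
    (hD : 0 ≤ D) (hc : 0 < c) (hh : ∀ y ∈ Icc p q, ‖h y‖ ≤ D * √(|y - y0|))
    (hU : ∀ y ∈ Icc p q, c * |y - y0| ≤ |u y - cr|) :
    ‖∫ y in p..q, h y / rf u cr ε y‖ ≤ 4 * (D / c) * √t := by
  apply ra_sing hpq hp hq (by positivity)
  intro y hy hne
  have h0 : 0 < |y - y0| := abs_pos.2 (sub_ne_zero.2 hne)
  have h1 : c * |y - y0| ≤ ‖rf u cr ε y‖ := (hU y hy).trans (ra_den_ge (u y - cr) ε).1
  rw [norm_div]
  have h2 : 0 < c * |y - y0| := by positivity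
  calc ‖h y‖ / ‖rf u cr ε y‖ * √|y - y0| ≤ D * √|y - y0| / (c * |y - y0|) * √|y - y0| := by
        gcongr; exact hh y hy
    _ = D / c := by
        have : √|y - y0| * √|y - y0| = |y - y0| := Real.mul_self_sqrt h0.le
        rw [div_mul_eq_mul_div, mul_assoc, this]; field_simp

theorem RGeo.bval (G : RGeo u u1 u2 u3 ρ ρ1 yc m M d r) (hε : ε ≠ 0)
    (hw : ∀ y, HasDerivAt w (w1 y) y) (hw1 : Continuous w1) (wl : w (-1) = 0) (wr : w 1 = 0)
    (hs : RStar u u2 yc r cr ε k δ w w1) {η p q y0 : ℝ} (L0 : 0 < L)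
    (hη : |ε| ≤ η * L ^ 2) (hp : yc - r ≤ p) (hq : q ≤ yc + r) (hpq : q - p = |ε| / L)
    (hy0 : y0 ∈ Icc p q) (hU : ∀ y ∈ Icc p q, |u y - cr| ≤ 3 * M / m * |ε|) :
    ‖w y0‖ ^ 2 ≤ 20 * M ^ 2 / m ^ 3 * L * (δ * √(rN k w w1) + η * √(rN k w w1) ^ 2) := by
  have cw := rcont hw
  have cu := G.cu
  have cu2 := G.cu2
  have r0 := G.r0
  have m0 := G.m0
  have m1 := G.m1
  have M1 := G.M1
  have hl := G.hl
  have hr := G.hr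
  obtain ⟨h1, -⟩ := star_self cu cu2 hε hw hw1 wl wr hs
  set W := √(rN k w w1) with hW
  have hW2 : rN k w w1 = W ^ 2 := (Real.sq_sqrt (rN_nonneg _ _ _)).symm
  have e0 : 0 < |ε| := abs_pos.2 hε
  have hpq' : p < q := by have : 0 < |ε| / L := by positivity
                          linarith
  have c2 : Continuous fun y => u2 y * ‖w y‖ ^ 2 / ((u y - cr) ^ 2 + ε ^ 2) :=
    Continuous.div (by fun_prop) (by fun_prop) (fun y => (nf_pos hε _).ne')
  set J := ∫ y in (yc - r)..(yc + r), u2 y * ‖w y‖ ^ 2 / ((u y - cr) ^ 2 + ε ^ 2) with hJ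
  have hM2 : 1 ≤ M ^ 2 / m ^ 2 := by
    rw [one_le_div (by positivity)]; gcongr; linarith
  have s1 : ∫ y in p..q, ‖w y‖ ^ 2 ≤ 10 * M ^ 2 / m ^ 3 * ε ^ 2 * ∫ y in p..q, u2 y * ‖w y‖ ^ 2 / ((u y - cr) ^ 2 + ε ^ 2) := by
    rw [← intervalIntegral.integral_const_mul]
    apply intervalIntegral.integral_mono_on hpq'.le
    · apply Continuous.intervalIntegrable; fun_prop
    · exact (continuous_const.mul c2).intervalIntegrable _ _
    · intro y hy
      have hz : m ≤ u2 y := G.zpos ⟨hp.trans hy.1, hy.2.trans hq⟩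
      have hn := nf_pos hε (u y - cr)
      have h3 : (u y - cr) ^ 2 + ε ^ 2 ≤ 10 * M ^ 2 / m ^ 2 * ε ^ 2 := by
        have h4 : (u y - cr) ^ 2 ≤ 9 * (M ^ 2 / m ^ 2) * ε ^ 2 := by
          rw [← sq_abs (u y - cr), ← sq_abs ε]
          calc |u y - cr| ^ 2 ≤ (3 * M / m * |ε|) ^ 2 := by gcongr; exact hU y hy
            _ = _ := by ring
        have h5 := mul_le_mul_of_nonneg_right hM2 (sq_nonneg ε)
        calc _ ≤ 9 * (M ^ 2 / m ^ 2) * ε ^ 2 + M ^ 2 / m ^ 2 * ε ^ 2 := by linarith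
          _ = _ := by ring
      rw [← mul_div_assoc, le_div_iff₀ hn]
      calc ‖w y‖ ^ 2 * ((u y - cr) ^ 2 + ε ^ 2) ≤ ‖w y‖ ^ 2 * (10 * M ^ 2 / m ^ 2 * ε ^ 2) := by gcongr
        _ = 10 * M ^ 2 / m ^ 3 * ε ^ 2 * (m * ‖w y‖ ^ 2) := by field_simp
        _ ≤ _ := by gcongr
  have s2 : ∫ y in p..q, u2 y * ‖w y‖ ^ 2 / ((u y - cr) ^ 2 + ε ^ 2) ≤ |J| := by
    refine le_trans ?_ (le_abs_self _)
    apply intervalIntegral.integral_mono_interval hp hpq'.le hq _ (c2.intervalIntegrable _ _)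
    filter_upwards [ae_restrict_mem measurableSet_Ioc] with y hy
    have hz : m ≤ u2 y := G.zpos ⟨hy.1.le, hy.2⟩
    have hz' : 0 ≤ u2 y := by linarith
    simp only [Pi.zero_apply]
    have hn := nf_pos hε (u y - cr)
    positivity
  have s3 := ra_avg hw hw1 hy0
  have s4 : ∫ x in p..q, ‖w1 x‖ ^ 2 ≤ W ^ 2 := by
    rw [← hW2]
    exact (ra_sub hw1 (by linarith) hpq'.le (by linarith)).trans (rN_d k w w1)
  rw [hpq] at s3
  have s5 : ∫ y in p..q, ‖w y‖ ^ 2 ≤ 10 * M ^ 2 / m ^ 3 * |ε| * (δ * W) := by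
    calc _ ≤ 10 * M ^ 2 / m ^ 3 * ε ^ 2 * |J| := s1.trans (by gcongr)
      _ = 10 * M ^ 2 / m ^ 3 * |ε| * (|ε| * |J|) := by rw [← sq_abs ε]; ring
      _ ≤ _ := by gcongr
  have s6 : |ε| / L * ‖w y0‖ ^ 2 ≤ |ε| / L * (20 * M ^ 2 / m ^ 3 * L * (δ * W) + 2 * (|ε| / L) * W ^ 2) := by
    calc _ ≤ 2 * (10 * M ^ 2 / m ^ 3 * |ε| * (δ * W)) + 2 * (|ε| / L) ^ 2 * W ^ 2 := by
          refine s3.trans ?_; gcongr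
      _ = _ := by field_simp; ring
  have s7 := le_of_mul_le_mul_left s6 (by positivity)
  have s8 : |ε| / L ≤ η * L := by rw [div_le_iff₀ L0]; linarith
  have hη0 : 0 ≤ η * L := le_trans (by positivity) s8
  have hc : 2 ≤ 20 * M ^ 2 / m ^ 3 := by
    rw [le_div_iff₀ (by positivity)]
    have : m ^ 3 ≤ 1 := pow_le_one₀ m0.le m1
    have : 1 ≤ M ^ 2 := one_le_pow₀ M1
    linarith
  calc _ ≤ _ := s7
    _ ≤ 20 * M ^ 2 / m ^ 3 * L * (δ * W) + 20 * M ^ 2 / m ^ 3 * (η * L) * W ^ 2 := by gcongr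
    _ = _ := by ring

theorem RGeo.bump_cross (G : RGeo u u1 u2 u3 ρ ρ1 yc m M d r) (hε : ε ≠ 0) (L0 : 0 < L)
    {C0 y0 D : ℝ} {B B1 : ℝ → ℝ} (b : RBump C0 y0 (L / (4 * M)) B B1) (hT : Continuous T)
    (hl : yc - r ≤ y0 - L / (2 * M)) (hr : y0 + L / (2 * M) ≤ yc + r) (hD : 0 ≤ D)
    (hTh : ∀ y ∈ Icc (y0 - L / (2 * M)) (y0 + L / (2 * M)), ‖T y‖ ≤ D * √(|y - y0|))
    (hU : ∀ y ∈ Icc (y0 - L / (2 * M)) (y0 + L / (2 * M)), m * L / (2 * M) * |y - y0| ≤ |u y - cr|) (z : ℂ) :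
    ‖∫ y in (yc - r)..(yc + r), (u2 y : ℂ) * (z * (B y : ℂ)) * T y / rf u cr ε y‖
      ≤ 8 * M ^ 2 / m * (‖z‖ / √L) * D := by
  have cu2 := G.cu2
  have cB := b.cont
  have m0 := G.m0
  have M1 := G.M1
  have hM0 : 0 < M := by linarith
  have hcf := rf_cont G.cu cr ε
  have e2 : 2 * (L / (4 * M)) = L / (2 * M) := by field_simp; ring
  have hcont : Continuous fun y => (u2 y : ℂ) * (z * (B y : ℂ)) * T y / rf u cr ε y :=
    Continuous.div (by fun_prop) hcf (rf_ne hε)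
  have hpos : 0 < L / (2 * M) := by positivity
  rw [ra_restr hcont hl hr]
  · refine (sing_est (D := M * ‖z‖ * D) (y0 := y0) (t := L / (2 * M)) (c := m * L / (2 * M)) (by linarith)
      le_rfl le_rfl (by positivity) (by positivity) ?_ hU).trans ?_
    · intro y hy
      rw [norm_mul, norm_mul, norm_mul, Complex.norm_real, Complex.norm_real, Real.norm_eq_abs,
        Real.norm_eq_abs, abs_of_nonneg (b.nn y)]
      have h1 : |u2 y| ≤ M := G.zup (G.zI ⟨hl.trans hy.1, hy.2.trans hr⟩)
      have h2 := hTh y hy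
      have h3 := b.le y
      have h4 := b.nn y
      calc |u2 y| * (‖z‖ * B y) * ‖T y‖ ≤ M * (‖z‖ * 1) * (D * √|y - y0|) := by gcongr
        _ = _ := by ring
    · have h1 : √(L / (2 * M)) ≤ √L := by
        apply Real.sqrt_le_sqrt
        exact div_le_self L0.le (by linarith)
      have h2 : √L * √L = L := Real.mul_self_sqrt L0.le
      have h3 : 0 < √L := Real.sqrt_pos.2 L0
      calc 4 * (M * ‖z‖ * D / (m * L / (2 * M))) * √(L / (2 * M))
          ≤ 4 * (M * ‖z‖ * D / (m * L / (2 * M))) * √L := by gcongr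
        _ = 4 * (M * ‖z‖ * D / (m * (√L * √L) / (2 * M))) * √L := by rw [h2]
        _ = _ := by field_simp; ring
  · intro y hy
    rw [b.z y]
    · simp
    · rw [e2, le_abs]; right; linarith [hy.2]
  · intro y hy
    rw [b.z y]
    · simp
    · rw [e2, le_abs]; left; linarith [hy.1]

theorem RGeo.bump_pv (G : RGeo u u1 u2 u3 ρ ρ1 yc m M d r) {C0 : ℝ} (hC0 : 1 ≤ C0) :
    ∃ C : ℝ, 1 ≤ C ∧ ∀ (cr ε L y0 : ℝ) (B B1 : ℝ → ℝ) (z : ℂ), 0 < L → L ≤ 1 → L ^ 2 = cr - u yc →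
      ε ≠ 0 → |ε| ≤ 1 → RBump C0 y0 (L / (4 * M)) B B1 →
      yc - r ≤ y0 - L / (2 * M) → y0 + L / (2 * M) ≤ yc + r →
      ‖∫ y in (yc - r)..(yc + r), (u2 y : ℂ) * (z * (B y : ℂ)) / rf u cr ε y‖ ≤ C * (‖z‖ / L) := by
  obtain ⟨C, hC, hpv⟩ := G.pv' (B := 1) one_pos
  have M1 := G.M1
  have r0 := G.r0
  have hM0 : 0 < M := by linarith
  refine ⟨max 1 (C * (2 * M + M * √(4 * M * C0) + M)), le_max_left _ _, ?_⟩
  intro cr ε L y0 B B1 z L0 L1 hL hε hε1 b hl hr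
  have e2 : 2 * (L / (4 * M)) = L / (2 * M) := by field_simp; ring
  have hpos : 0 < L / (2 * M) := by positivity
  have cu2 := G.cu2
  have cB := b.cont
  have hcf := rf_cont G.cu cr ε
  have Gl := G.hl
  have Gr := G.hr
  have zl : ∀ y, y ≤ y0 - L / (2 * M) → B y = 0 := by
    intro y hy; apply b.z; rw [e2, le_abs]; right; linarith
  have zr : ∀ y, y0 + L / (2 * M) ≤ y → B y = 0 := by
    intro y hy; apply b.z; rw [e2, le_abs]; left; linarith
  have hcont : Continuous fun y => (u2 y : ℂ) * (B y : ℂ) / rf u cr ε y :=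
    Continuous.div (by fun_prop) hcf (rf_ne hε)
  have e1 : ∫ y in (yc - r)..(yc + r), (u2 y : ℂ) * (z * (B y : ℂ)) / rf u cr ε y
      = z * ∫ y in (-1:ℝ)..1, (u2 y : ℂ) * (B y : ℂ) / rf u cr ε y := by
    rw [ra_restr hcont (p := -1) (q := 1) (a := yc - r) (b := yc + r) (by linarith) (by linarith),
      ← intervalIntegral.integral_const_mul]
    · congr 1; ext y; ring
    · intro y hy; rw [zl y (by linarith [hy.2])]; simp
    · intro y hy; rw [zr y (by linarith [hy.1])]; simp
  have sL : 0 < √L := Real.sqrt_pos.2 L0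
  have s2L : √L * √L = L := Real.mul_self_sqrt L0.le
  have hk := hpv (fun y => (u2 y : ℂ) * (B y : ℂ)) cr ε ((2 * M + M * √(4 * M * C0)) / √L) M
    (by rw [← hL]; positivity) (by rw [← hL]; exact pow_le_one₀ L0.le L1) hε hε1 (by
      intro s hs t ht
      have hB : ‖(B s : ℂ) - (B t : ℂ)‖ ≤ √(4 * M * C0) / √L * √|s - t| := by
        rw [← Complex.ofReal_sub, Complex.norm_real, Real.norm_eq_abs]
        have h1 : |B s - B t| ≤ C0 / (L / (4 * M)) * |s - t| := by
          have := (convex_univ (𝕜 := ℝ) (E := ℝ)).norm_image_sub_le_of_norm_hasDerivWithin_le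
            (f := B) (f' := B1) (C := C0 / (L / (4 * M))) (x := t) (y := s)
            (fun x _ => (b.d x).hasDerivWithinAt) (fun x _ => b.bd x) (mem_univ _) (mem_univ _)
          simpa [Real.norm_eq_abs] using this
        have h2 : |B s - B t| ≤ 1 := by
          rw [abs_le]; constructor <;> linarith [b.nn s, b.nn t, b.le s, b.le t]
        rw [← Real.sqrt_div (by positivity), ← Real.sqrt_mul (by positivity)]
        apply Real.le_sqrt_of_sq_le
        calc |B s - B t| ^ 2 = |B s - B t| * |B s - B t| := by ring
          _ ≤ 1 * (C0 / (L / (4 * M)) * |s - t|) := by gcongr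
          _ = _ := by field_simp
      have hu : ‖(u2 s : ℂ) - (u2 t : ℂ)‖ ≤ 2 * M * √|s - t| := by
        rw [← Complex.ofReal_sub, Complex.norm_real, Real.norm_eq_abs]; exact u2_hold G hs ht
      have h3 := prod_hold (a := fun y => (u2 y : ℂ)) (b := fun y => (B y : ℂ)) (A := M) (B := 1) hu hB
        (by rw [Complex.norm_real]; exact G.zup ht)
        (by rw [Complex.norm_real, Real.norm_eq_abs, abs_of_nonneg (b.nn s)]; exact b.le s)
      refine h3.trans ?_
      gcongr
      have : 2 * M ≤ 2 * M / √L := by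
        rw [le_div_iff₀ sL]
        have : √L ≤ 1 := Real.sqrt_le_one.2 L1
        exact mul_le_of_le_one_right (by positivity) this
      calc _ ≤ 2 * M / √L + M * (√(4 * M * C0) / √L) := by linarith
        _ = _ := by ring)
    (by
      intro t ht
      rw [norm_mul, Complex.norm_real, Complex.norm_real, Real.norm_eq_abs,
        Real.norm_eq_abs, abs_of_nonneg (b.nn t)]
      calc |u2 t| * B t ≤ M * 1 := by
            gcongr
            · exact b.nn t
            · exact G.zup ht
            · exact b.le t
        _ = M := by ring)
    (by rw [zl _ (by linarith)]; simp) (by rw [zr _ (by linarith)]; simp)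
  rw [e1, norm_mul]
  have q1 : L ≤ √(cr - u yc + |ε|) := by
    apply Real.le_sqrt_of_sq_le; rw [hL]; linarith [abs_nonneg ε]
  have q2 : √L ≤ √√(cr - u yc + |ε|) := Real.sqrt_le_sqrt q1
  have q3 : ‖∫ y in (-1:ℝ)..1, (u2 y : ℂ) * (B y : ℂ) / rf u cr ε y‖ ≤ C * (2 * M + M * √(4 * M * C0) + M) / L := by
    refine hk.trans ?_
    calc _ ≤ C * ((2 * M + M * √(4 * M * C0)) / √L / √L + M / L) := by gcongr
      _ = _ := by rw [div_div, s2L]; ring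
  calc _ ≤ ‖z‖ * (C * (2 * M + M * √(4 * M * C0) + M) / L) := by gcongr
    _ = C * (2 * M + M * √(4 * M * C0) + M) * (‖z‖ / L) := by ring
    _ ≤ _ := by gcongr; exact le_max_right _ _

end AuxJ

section AuxK
open Set

variable {u u1 u2 u3 ρ ρ1 : ℝ → ℝ} {yc m M d r cr ε k δ L y1 y2 : ℝ} {w w1 T T1 : ℝ → ℂ}

structure RDec (u u2 : ℝ → ℝ) (yc m r cr ε k δ L y1 y2 P C : ℝ) (w w1 T T1 β β1 : ℝ → ℂ) : Prop where
  hT : ∀ y, HasDerivAt T (T1 y) y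
  hT1 : Continuous T1
  hβ : ∀ y, HasDerivAt β (β1 y) y
  hβ1 : Continuous β1
  e : ∀ y, w y = T y + β y
  e1 : ∀ y, w1 y = T1 y + β1 y
  Tl : T (-1) = 0
  Tr : T 1 = 0
  Ty1 : T y1 = 0
  Ty2 : T y2 = 0
  b : rN k β β1 ≤ C * P
  pv : ‖∫ y in (yc - r)..(yc + r), (u2 y : ℂ) * β y / rf u cr ε y‖ ≤ C * (√P / √L)
  supp : ∀ y, 4 * L / m ≤ |y - yc| → β y = 0
  en : rN k T T1 + (∫ y in (yc - r)..(yc + r), u2 y * (u y - cr) * ‖T y‖ ^ 2 / ((u y - cr) ^ 2 + ε ^ 2))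
    ≤ C * (√P + δ) * √(rN k T T1)

theorem star_cross {β β1 : ℝ → ℂ} (cu : Continuous u) (cu2 : Continuous u2) (hε : ε ≠ 0)
    (hs : RStar u u2 yc r cr ε k δ w w1) (hT : ∀ y, HasDerivAt T (T1 y) y) (hT1 : Continuous T1)
    (cβ : Continuous β) (hβ1 : Continuous β1) (e0 : ∀ y, w y = T y + β y) (e1 : ∀ y, w1 y = T1 y + β1 y)
    (Tl : T (-1) = 0) (Tr : T 1 = 0) :
    rN k T T1 + (∫ y in (yc - r)..(yc + r), u2 y * (u y - cr) * ‖T y‖ ^ 2 / ((u y - cr) ^ 2 + ε ^ 2))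
      ≤ δ * √(rN k T T1) + √(rN k β β1) * √(rN k T T1)
        + ‖∫ y in (yc - r)..(yc + r), (u2 y : ℂ) * β y * (starRingEnd ℂ) (T y) / rf u cr ε y‖ := by
  have cT := rcont hT
  have hcf := rf_cont cu cr ε
  have ccT : Continuous fun y => (starRingEnd ℂ) (T y) := RSol.conj_c cT
  have ccT1 : Continuous fun y => (starRingEnd ℂ) (T1 y) := RSol.conj_c hT1
  have h := hs _ _ (hconj hT) ccT1 (by simp [Tl]) (by simp [Tr])
  have x3 := rN_cs (k := k) cβ hβ1 ccT ccT1
  rw [rN_conj] at h x3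
  have i1 : ∫ y in (-1:ℝ)..1, w1 y * (starRingEnd ℂ) (T1 y) = (∫ y in (-1:ℝ)..1, T1 y * (starRingEnd ℂ) (T1 y))
      + ∫ y in (-1:ℝ)..1, β1 y * (starRingEnd ℂ) (T1 y) := by
    rw [← rint_add_mul hT1 hβ1 ccT1]; simp only [e1]
  have i2 : ∫ y in (-1:ℝ)..1, w y * (starRingEnd ℂ) (T y) = (∫ y in (-1:ℝ)..1, T y * (starRingEnd ℂ) (T y))
      + ∫ y in (-1:ℝ)..1, β y * (starRingEnd ℂ) (T y) := by
    rw [← rint_add_mul cT cβ ccT]; simp only [e0]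
  have i3 : ∫ y in (yc - r)..(yc + r), (u2 y : ℂ) * w y * (starRingEnd ℂ) (T y) / rf u cr ε y
      = (∫ y in (yc - r)..(yc + r), (u2 y : ℂ) * T y * (starRingEnd ℂ) (T y) / rf u cr ε y)
        + ∫ y in (yc - r)..(yc + r), (u2 y : ℂ) * β y * (starRingEnd ℂ) (T y) / rf u cr ε y := by
    rw [← intervalIntegral.integral_add]
    · congr 1; ext y; rw [e0]; ring
    · exact (Continuous.div (by fun_prop) hcf (rf_ne hε)).intervalIntegrable _ _
    · exact (Continuous.div (by fun_prop) hcf (rf_ne hε)).intervalIntegrable _ _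
  rw [i1, i2, i3, rf_split hε cu cu2 cT] at h
  have hself := rN_self (k := k) (φ := T) (φ1 := T1)
  generalize (∫ y in (yc - r)..(yc + r), u2 y * (u y - cr) * ‖T y‖ ^ 2 / ((u y - cr) ^ 2 + ε ^ 2)) = I at *
  generalize (ε * ∫ y in (yc - r)..(yc + r), u2 y * ‖T y‖ ^ 2 / ((u y - cr) ^ 2 + ε ^ 2)) = J at *
  generalize (∫ y in (-1:ℝ)..1, T1 y * (starRingEnd ℂ) (T1 y)) = a1 at *
  generalize (∫ y in (-1:ℝ)..1, T y * (starRingEnd ℂ) (T y)) = a2 at *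
  generalize (∫ y in (-1:ℝ)..1, β1 y * (starRingEnd ℂ) (T1 y)) = c1 at *
  generalize (∫ y in (-1:ℝ)..1, β y * (starRingEnd ℂ) (T y)) = c2 at *
  generalize (∫ y in (yc - r)..(yc + r), (u2 y : ℂ) * β y * (starRingEnd ℂ) (T y) / rf u cr ε y) = d1 at *
  have hre : rN k T T1 + I ≤ ‖(((rN k T T1 + I : ℝ) : ℂ)) + (J : ℂ) * Complex.I‖ := by
    refine le_trans (le_trans ?_ (le_abs_self _)) (Complex.abs_re_le_norm _)
    simp
  refine hre.trans ?_
  have e : (((rN k T T1 + I : ℝ) : ℂ)) + (J : ℂ) * Complex.I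
      = ((a1 + c1 + (k:ℂ) ^ 2 * (a2 + c2)) + ((I : ℂ) + (J : ℂ) * Complex.I + d1))
        - (c1 + (k:ℂ) ^ 2 * c2) - d1 := by
    push_cast; rw [← hself]; ring
  rw [e]
  refine (norm_sub_le _ _).trans ?_
  gcongr
  refine (norm_sub_le _ _).trans ?_
  exact add_le_add h x3

set_option maxHeartbeats 2000000 in
theorem RGeo.decomp (G : RGeo u u1 u2 u3 ρ ρ1 yc m M d r) {A : ℝ} :
    ∃ C : ℝ, 1 ≤ C ∧ ∀ (cr ε k δ η L y1 y2 : ℝ) (w w1 : ℝ → ℂ), RRoot u yc m M r cr L y1 y2 →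
      ε ≠ 0 → |ε| ≤ η * L ^ 2 → η ≤ 1 / 2 → 0 ≤ k → k * L ≤ A →
      (∀ y, HasDerivAt w (w1 y) y) → Continuous w1 → w (-1) = 0 → w 1 = 0 →
      RStar u u2 yc r cr ε k δ w w1 → 0 ≤ δ →
      ∃ T T1 β β1 : ℝ → ℂ, RDec u u2 yc m r cr ε k δ L y1 y2
        (δ * √(rN k w w1) + η * √(rN k w w1) ^ 2) C w w1 T T1 β β1 := by
  obtain ⟨C0, hC0, hbump⟩ := ra_bump
  obtain ⟨Cp, hCp, hpv⟩ := G.bump_pv hC0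
  have m0 := G.m0
  have m1 := G.m1
  have M1 := G.M1
  have hM0 : 0 < M := by linarith
  obtain ⟨C1, hC1⟩ : ∃ x, x = 20 * M ^ 2 / m ^ 3 := ⟨_, rfl⟩
  have C1p : 0 < C1 := by rw [hC1]; positivity
  obtain ⟨C2, hC2⟩ : ∃ x, x = 4 * (4 * M * C0 ^ 2 + A ^ 2) := ⟨_, rfl⟩
  have C2p : 0 ≤ C2 := by rw [hC2]; positivity
  obtain ⟨Cf, hCf⟩ : ∃ x, x = 4 * C1 * C2 + √(4 * C1 * C2) + 16 * M ^ 2 / m * √C1 + 2 * Cp * √C1 + 1 := ⟨_, rfl⟩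
  have f1 : 0 ≤ 4 * C1 * C2 := by positivity
  have f2 : 0 ≤ √(4 * C1 * C2) := by positivity
  have f3 : 0 ≤ 16 * M ^ 2 / m * √C1 := by positivity
  have f4 : 0 ≤ 2 * Cp * √C1 := by positivity
  refine ⟨Cf, by linarith, ?_⟩
  intro cr ε k δ η L y1 y2 w w1 X hε hη hη2 hk hkA hw hw1 wl wr hs hδ
  have cw := rcont hw
  have cu := G.cu
  have cu2 := G.cu2
  have r0 := G.r0
  have Gl := G.hl
  have Gr := G.hr
  have L0 := X.L0
  have L1 := X.L1
  have l1 := X.l1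
  have l2 := X.l2
  have b1 := X.b1
  have b2 := X.b2
  have hLM : 0 < L / M := by positivity
  have hLM' : L / M ≤ L := div_le_self L0.le M1
  have hLm : L ≤ L / m := by rw [le_div_iff₀ m0]; exact mul_le_of_le_one_right L0.le m1
  have hLr : 8 * (L / m) ≤ r := by rw [← mul_div_assoc, div_le_iff₀ m0]; linarith [X.Lr]
  have e2m : 2 * L / m = 2 * (L / m) := by ring
  have e4m : 4 * L / m = 4 * (L / m) := by ring
  have eτ : L / (2 * M) = L / M / 2 := by field_simp
  have eτ2 : 2 * (L / (4 * M)) = L / M / 2 := by field_simp; ring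
  have τ0 : 0 < L / (4 * M) := by positivity
  have sL : 0 < √L := Real.sqrt_pos.2 L0
  have s2L : √L * √L = L := Real.mul_self_sqrt L0.le
  have ε0 : 0 < |ε| := abs_pos.2 hε
  have hη0 : 0 ≤ η := by
    by_contra h
    push Not at h
    have : η * L ^ 2 < 0 := mul_neg_of_neg_of_pos h (by positivity)
    linarith
  have hL2 : L ^ 2 ≤ L := by rw [sq]; exact mul_le_of_le_one_right L0.le L1
  have hεL : |ε| / L ≤ L := by
    rw [div_le_iff₀ L0]
    have : η * L ^ 2 ≤ 1 * L ^ 2 := by gcongr; linarith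
    linarith [sq L]
  have hε1 : |ε| ≤ 1 := by
    have : |ε| ≤ L * L := by rwa [div_le_iff₀ L0] at hεL
    linarith [sq L]
  have hεL0 : 0 < |ε| / L := by positivity
  have hUs : ∀ t, t ≤ |ε| / L → 3 * M / m * L * t ≤ 3 * M / m * |ε| := by
    intro t ht
    calc 3 * M / m * L * t ≤ 3 * M / m * L * (|ε| / L) := by gcongr
      _ = _ := by field_simp
  obtain ⟨W, hW⟩ : ∃ x, x = √(rN k w w1) := ⟨_, rfl⟩
  have hW0 : 0 ≤ W := hW ▸ Real.sqrt_nonneg _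
  rw [← hW]
  have P0 : 0 ≤ δ * W + η * W ^ 2 := by positivity
  obtain ⟨P, hP⟩ : ∃ x, x = δ * W + η * W ^ 2 := ⟨_, rfl⟩
  rw [← hP] at P0 ⊢
  have v2 : ‖w y2‖ ^ 2 ≤ C1 * L * P := by
    rw [hP, hW, hC1]
    exact G.bval hε hw hw1 wl wr hs (p := y2) (q := y2 + |ε| / L) L0 hη (by linarith) (by linarith)
      (by ring) ⟨le_rfl, by linarith⟩ (by
        intro y hy
        refine (X.up2 y ⟨hy.1, by linarith [hy.2]⟩).trans (hUs _ (by linarith [hy.2])))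
  have v1 : ‖w y1‖ ^ 2 ≤ C1 * L * P := by
    rw [hP, hW, hC1]
    exact G.bval hε hw hw1 wl wr hs (p := y1 - |ε| / L) (q := y1) L0 hη (by linarith) (by linarith)
      (by ring) ⟨by linarith, le_rfl⟩ (by
        intro y hy
        refine (X.up1 y ⟨by linarith [hy.1], hy.2⟩).trans (hUs _ (by linarith [hy.1])))
  have vs : ∀ z : ℂ, ‖z‖ ^ 2 ≤ C1 * L * P → ‖z‖ / √L ≤ √C1 * √P ∧ ‖z‖ / L ≤ √C1 * (√P / √L) := by
    intro z hz
    have h1 : ‖z‖ ≤ √C1 * √L * √P := by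
      rw [← Real.sqrt_mul C1p.le, ← Real.sqrt_mul (by positivity)]
      exact Real.le_sqrt_of_sq_le hz
    constructor
    · rw [div_le_iff₀ sL]; linarith
    · rw [div_le_iff₀ L0]
      calc ‖z‖ ≤ √C1 * √L * √P := h1
        _ = √C1 * (√P / √L) * (√L * √L) := by field_simp
        _ = _ := by rw [s2L]
  obtain ⟨B1, B1', hB1⟩ := hbump y1 (L / (4 * M)) τ0
  obtain ⟨B2, B2', hB2⟩ := hbump y2 (L / (4 * M)) τ0
  have cB1 := hB1.cont
  have cB2 := hB2.cont
  have cB1' := hB1.c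
  have cB2' := hB2.c
  have n2l : yc - r ≤ y2 - L / (2 * M) := by linarith
  have n2r : y2 + L / (2 * M) ≤ yc + r := by linarith
  have n1l : yc - r ≤ y1 - L / (2 * M) := by linarith
  have n1r : y1 + L / (2 * M) ≤ yc + r := by linarith
  have zz1 : ∀ y, L / M / 2 ≤ |y - y1| → B1 y = 0 := fun y hy => hB1.z y (by rw [eτ2]; exact hy)
  have zz2 : ∀ y, L / M / 2 ≤ |y - y2| → B2 y = 0 := fun y hy => hB2.z y (by rw [eτ2]; exact hy)
  have bN : ∀ (y0 : ℝ) (B B' : ℝ → ℝ) (z : ℂ), RBump C0 y0 (L / (4 * M)) B B' →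
      yc - r ≤ y0 - L / (2 * M) → y0 + L / (2 * M) ≤ yc + r → ‖z‖ ^ 2 ≤ C1 * L * P →
      rN k (fun y => z * (B y : ℂ)) (fun y => z * (B' y : ℂ)) ≤ C1 * C2 * P := by
    intro y0 B B' z hB h1 h2 hz
    refine (hB.rN τ0 (by rw [eτ2]; linarith) (by rw [eτ2]; linarith) z).trans ?_
    have h3 : 4 * (C0 ^ 2 / (L / (4 * M)) + k ^ 2 * (L / (4 * M))) ≤ C2 / L := by
      rw [le_div_iff₀ L0, hC2]
      have h4 : (k * L) ^ 2 ≤ A ^ 2 := by gcongr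
      have h5 : (k * L) ^ 2 / (4 * M) ≤ (k * L) ^ 2 := div_le_self (by positivity) (by linarith)
      calc 4 * (C0 ^ 2 / (L / (4 * M)) + k ^ 2 * (L / (4 * M))) * L
          = 4 * (4 * M * C0 ^ 2 + (k * L) ^ 2 / (4 * M)) := by field_simp
        _ ≤ _ := by linarith
    calc _ ≤ C1 * L * P * (C2 / L) := by gcongr
      _ = _ := by field_simp
  set β : ℝ → ℂ := fun y => w y1 * (B1 y : ℂ) + w y2 * (B2 y : ℂ) with hβd
  set β1 : ℝ → ℂ := fun y => w y1 * (B1' y : ℂ) + w y2 * (B2' y : ℂ) with hβ1d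
  have hβ : ∀ y, HasDerivAt β (β1 y) y := fun y =>
    ((hB1.d y).ofReal_comp.const_mul (w y1)).add ((hB2.d y).ofReal_comp.const_mul (w y2))
  have hβ1 : Continuous β1 := by fun_prop
  have cβ : Continuous β := rcont hβ
  have hT : ∀ y, HasDerivAt (fun y => w y - β y) (w1 y - β1 y) y := fun y => (hw y).sub (hβ y)
  have hT1 : Continuous fun y => w1 y - β1 y := hw1.sub hβ1
  have cT : Continuous fun y => w y - β y := cw.sub cβ
  have supp : ∀ y, 4 * L / m ≤ |y - yc| → β y = 0 := by
    intro y hy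
    have z1 : B1 y = 0 := by
      apply zz1; rw [le_abs]
      rcases le_abs.1 hy with h | h
      · left; linarith
      · right; linarith
    have z2 : B2 y = 0 := by
      apply zz2; rw [le_abs]
      rcases le_abs.1 hy with h | h
      · left; linarith
      · right; linarith
    simp [hβd, z1, z2]
  have βl : β (-1) = 0 := supp _ (by rw [le_abs]; right; linarith)
  have βr : β 1 = 0 := supp _ (by rw [le_abs]; left; linarith)
  have β1y : β y1 = w y1 := by
    have z2 : B2 y1 = 0 := by apply zz2; rw [le_abs]; right; linarith
    have z1 : B1 y1 = 1 := by apply hB1.one; simp; positivity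
    simp [hβd, z1, z2]
  have β2y : β y2 = w y2 := by
    have z2 : B1 y2 = 0 := by apply zz1; rw [le_abs]; left; linarith
    have z1 : B2 y2 = 1 := by apply hB2.one; simp; positivity
    simp [hβd, z1, z2]
  have hb : rN k β β1 ≤ 4 * C1 * C2 * P := by
    refine (rN_add (k := k) (φ := fun y => w y1 * (B1 y : ℂ)) (φ1 := fun y => w y1 * (B1' y : ℂ))
      (χ := fun y => w y2 * (B2 y : ℂ)) (χ1 := fun y => w y2 * (B2' y : ℂ))
      (by fun_prop) (by fun_prop) (by fun_prop) (by fun_prop)).trans ?_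
    have q1 := bN y1 B1 B1' (w y1) hB1 n1l n1r v1
    have q2 := bN y2 B2 B2' (w y2) hB2 n2l n2r v2
    linarith
  have hcf := rf_cont G.cu cr ε
  have sp : ∀ (S : ℝ → ℂ), Continuous S → ∫ y in (yc - r)..(yc + r), (u2 y : ℂ) * β y * S y / rf u cr ε y
      = (∫ y in (yc - r)..(yc + r), (u2 y : ℂ) * (w y1 * (B1 y : ℂ)) * S y / rf u cr ε y)
        + ∫ y in (yc - r)..(yc + r), (u2 y : ℂ) * (w y2 * (B2 y : ℂ)) * S y / rf u cr ε y := by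
    intro S hS
    rw [← intervalIntegral.integral_add]
    · congr 1; ext y; simp only [hβd]; ring
    · exact (Continuous.div (by fun_prop) hcf (rf_ne hε)).intervalIntegrable _ _
    · exact (Continuous.div (by fun_prop) hcf (rf_ne hε)).intervalIntegrable _ _
  have hpvb : ‖∫ y in (yc - r)..(yc + r), (u2 y : ℂ) * β y / rf u cr ε y‖ ≤ 2 * Cp * √C1 * (√P / √L) := by
    have h := sp (fun _ => 1) continuous_const
    simp only [mul_one] at h
    rw [h]
    have q1 := hpv cr ε L y1 B1 B1' (w y1) L0 L1 X.hL hε hε1 hB1 n1l n1r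
    have q2 := hpv cr ε L y2 B2 B2' (w y2) L0 L1 X.hL hε hε1 hB2 n2l n2r
    have q3 := mul_le_mul_of_nonneg_left (vs _ v1).2 (by linarith : 0 ≤ Cp)
    have q4 := mul_le_mul_of_nonneg_left (vs _ v2).2 (by linarith : 0 ≤ Cp)
    refine (norm_add_le _ _).trans ?_
    linarith
  have Ty1 : w y1 - β y1 = 0 := by rw [β1y, sub_self]
  have Ty2 : w y2 - β y2 = 0 := by rw [β2y, sub_self]
  have Tl : w (-1) - β (-1) = 0 := by rw [βl, wl, sub_self]
  have Tr : w 1 - β 1 = 0 := by rw [βr, wr, sub_self]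
  refine ⟨fun y => w y - β y, fun y => w1 y - β1 y, β, β1, hT, hT1, hβ, hβ1, fun y => by ring,
    fun y => by ring, Tl, Tr, Ty1, Ty2, hb.trans (by gcongr; linarith), hpvb.trans (by gcongr; linarith), supp, ?_⟩
  have cT' : Continuous fun y => (starRingEnd ℂ) (w y - β y) := RSol.conj_c cT
  have hcr := star_cross (T := fun y => w y - β y) (T1 := fun y => w1 y - β1 y) cu cu2 hε hs hT hT1 cβ hβ1
    (fun y => by ring) (fun y => by ring) Tl Tr
  rw [sp _ cT'] at hcr
  refine hcr.trans ?_
  have N0 : 0 ≤ √(rN k (fun y => w y - β y) fun y => w1 y - β1 y) := Real.sqrt_nonneg _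
  have hold : ∀ y0 ∈ Icc (-1:ℝ) 1, w y0 - β y0 = 0 → ∀ y ∈ Icc (-1:ℝ) 1, ‖(starRingEnd ℂ) (w y - β y)‖
      ≤ √(rN k (fun y => w y - β y) fun y => w1 y - β1 y) * √|y - y0| := by
    intro y0 h0 hz y hy
    have := rN_hold (k := k) hT hT1 hy h0
    rw [RCLike.norm_conj]
    rwa [hz, sub_zero] at this
  have x1 := G.bump_cross hε L0 hB1 cT' n1l n1r N0
    (fun y hy => hold y1 ⟨by linarith, by linarith⟩ Ty1 y ⟨by linarith [hy.1], by linarith [hy.2]⟩)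
    (fun y hy => X.low1 y ⟨by linarith [hy.1], by linarith [hy.2]⟩) (w y1)
  have x2 := G.bump_cross hε L0 hB2 cT' n2l n2r N0
    (fun y hy => hold y2 ⟨by linarith, by linarith⟩ Ty2 y ⟨by linarith [hy.1], by linarith [hy.2]⟩)
    (fun y hy => X.low2 y ⟨by linarith [hy.1], by linarith [hy.2]⟩) (w y2)
  have hsb : √(rN k β β1) ≤ √(4 * C1 * C2) * √P := by
    rw [← Real.sqrt_mul f1]; exact Real.sqrt_le_sqrt hb
  generalize √(rN k (fun y => w y - β y) fun y => w1 y - β1 y) = N at *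
  have t1 := mul_le_mul_of_nonneg_right hsb N0
  have K0 : 0 ≤ 8 * M ^ 2 / m := by positivity
  have t2 := x1.trans (mul_le_mul_of_nonneg_right (mul_le_mul_of_nonneg_left (vs _ v1).1 K0) N0)
  have t3 := x2.trans (mul_le_mul_of_nonneg_right (mul_le_mul_of_nonneg_left (vs _ v2).1 K0) N0)
  have sP : 0 ≤ √P := Real.sqrt_nonneg _
  have t4 := norm_add_le (∫ y in (yc - r)..(yc + r), (u2 y : ℂ) * (w y1 * (B1 y : ℂ)) * (starRingEnd ℂ) (w y - β y) / rf u cr ε y)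
    (∫ y in (yc - r)..(yc + r), (u2 y : ℂ) * (w y2 * (B2 y : ℂ)) * (starRingEnd ℂ) (w y - β y) / rf u cr ε y)
  have dN : 0 ≤ δ * N := mul_nonneg hδ N0
  have pN : 0 ≤ √P * N := mul_nonneg sP N0
  calc _ ≤ δ * N + √(4 * C1 * C2) * √P * N + (8 * M ^ 2 / m * (√C1 * √P) * N
        + 8 * M ^ 2 / m * (√C1 * √P) * N) := add_le_add (add_le_add le_rfl t1) (t4.trans (add_le_add t2 t3))
    _ = 1 * (δ * N) + (√(4 * C1 * C2) + 16 * M ^ 2 / m * √C1) * (√P * N) := by ring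
    _ ≤ Cf * (δ * N) + Cf * (√P * N) := add_le_add (mul_le_mul_of_nonneg_right (by linarith) dN)
        (mul_le_mul_of_nonneg_right (by linarith) pN)
    _ = _ := by ring

end AuxK

section AuxL
open Set

variable {u u1 u2 u3 ρ ρ1 : ℝ → ℝ} {yc m M d r cr ε k δ L y1 y2 : ℝ} {w w1 T T1 : ℝ → ℂ}

theorem ra_split3 {E : Type*} [NormedAddCommGroup E] [NormedSpace ℝ E] [CompleteSpace E] {Φ : ℝ → E} (h : Continuous Φ)
    (a p q b : ℝ) : ∫ y in a..b, Φ y = (∫ y in a..p, Φ y) + (∫ y in p..q, Φ y) + ∫ y in q..b, Φ y := by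
  rw [intervalIntegral.integral_add_adjacent_intervals (h.intervalIntegrable _ _) (h.intervalIntegrable _ _),
    intervalIntegral.integral_add_adjacent_intervals (h.intervalIntegrable _ _) (h.intervalIntegrable _ _)]

theorem RGeo.ord (G : RGeo u u1 u2 u3 ρ ρ1 yc m M d r) (X : RRoot u yc m M r cr L y1 y2) :
    -1 ≤ yc - r ∧ yc - r ≤ y1 ∧ y1 ≤ yc ∧ yc ≤ y2 ∧ y2 ≤ yc + r ∧ yc + r ≤ 1 ∧ 8 * L / m ≤ r
      ∧ 0 < L / m ∧ y1 ≤ y2 ∧ -1 ≤ y1 ∧ y2 ≤ 1 ∧ yc - 2 * (L / m) ≤ y1 ∧ y2 ≤ yc + 2 * (L / m)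
      ∧ 8 * (L / m) ≤ r := by
  have m0 := G.m0
  have M1 := G.M1
  have r0 := G.r0
  have L0 := X.L0
  have h1 : 8 * L / m ≤ r := by rw [div_le_iff₀ m0]; linarith [X.Lr]
  have h2 : 0 < L / m := by positivity
  have h3 : 0 < L / M := by positivity
  have e1 : 8 * L / m = 8 * (L / m) := by ring
  have e2 : 2 * L / m = 2 * (L / m) := by ring
  have a1 := X.l1
  have a2 := X.l2
  have b1 := X.b1
  have b2 := X.b2
  have hl := G.hl
  have hr := G.hr
  rw [e2] at b1 b2
  rw [e1] at h1
  refine ⟨?_, ?_, ?_, ?_, ?_, ?_, by rw [e1]; exact h1, h2, ?_, ?_, ?_, ?_, ?_, h1⟩ <;> linarith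

def rO (k y1 y2 : ℝ) (T T1 : ℝ → ℂ) : ℝ :=
  (∫ y in (-1:ℝ)..y1, ‖T1 y‖ ^ 2) + (∫ y in y2..1, ‖T1 y‖ ^ 2) + k ^ 2 * ∫ y in (-1:ℝ)..1, ‖T y‖ ^ 2

theorem RGeo.outer_en (G : RGeo u u1 u2 u3 ρ ρ1 yc m M d r) (X : RRoot u yc m M r cr L y1 y2) (hε : ε ≠ 0)
    (hT : ∀ y, HasDerivAt T (T1 y) y) (hT1 : Continuous T1) {z : ℂ}
    (T1z : T y1 = 0) (T2z : T y2 = 0) (Tc : T yc - (u yc - cr) • z = 0) :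
    rO k y1 y2 T T1 + 1 / 2 * (∫ y in y1..y2, ‖T1 y - u1 y • z‖ ^ 2) ≤
      rN k T T1 + (∫ y in (yc - r)..(yc + r), u2 y * (u y - cr) * ‖T y‖ ^ 2 / ((u y - cr) ^ 2 + ε ^ 2)) := by
  have h := G.inner X hε hT hT1 T1z T2z Tc
  have cT := rcont hT
  have cu := G.cu
  have cu2 := G.cu2
  have m0 := G.m0
  obtain ⟨o1, o2, o3, o4, o5, o6, -, -, -, -, -⟩ := G.ord X
  have c1 : Continuous fun y => u2 y * (u y - cr) * ‖T y‖ ^ 2 / ((u y - cr) ^ 2 + ε ^ 2) :=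
    Continuous.div (by fun_prop) (by fun_prop) (fun y => (nf_pos hε _).ne')
  have c2 : Continuous fun y => ‖T1 y‖ ^ 2 := by fun_prop
  have pt : ∀ y ∈ Icc (yc - r) (yc + r), cr ≤ u y →
      0 ≤ u2 y * (u y - cr) * ‖T y‖ ^ 2 / ((u y - cr) ^ 2 + ε ^ 2) := by
    intro y hy hu
    have h1 : 0 ≤ u2 y := m0.le.trans (G.zpos hy)
    have h2 : 0 ≤ u y - cr := by linarith
    have h3 := nf_pos hε (u y - cr)
    positivity
  have p1 : 0 ≤ ∫ y in (yc - r)..y1, u2 y * (u y - cr) * ‖T y‖ ^ 2 / ((u y - cr) ^ 2 + ε ^ 2) :=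
    intervalIntegral.integral_nonneg o2 (fun y hy => pt y ⟨hy.1, by linarith [hy.2]⟩
      (X.out1 y ⟨o1.trans hy.1, hy.2⟩))
  have p2 : 0 ≤ ∫ y in y2..(yc + r), u2 y * (u y - cr) * ‖T y‖ ^ 2 / ((u y - cr) ^ 2 + ε ^ 2) :=
    intervalIntegral.integral_nonneg o5 (fun y hy => pt y ⟨by linarith [hy.1], hy.2⟩
      (X.out2 y ⟨hy.1, hy.2.trans o6⟩))
  unfold rO rN
  rw [ra_split3 c1 _ y1 y2, ra_split3 c2 (-1) y1 y2 1]
  linarith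

theorem RGeo.ulow (G : RGeo u u1 u2 u3 ρ ρ1 yc m M d r) {x y : ℝ} (hxr : x ≤ r) (hy : |y - yc| ≤ x) :
    u y - u yc ≤ M / 2 * x ^ 2 := by
  have r0 := G.r0
  have hl := G.hl
  have hr := G.hr
  have d0 := G.d0
  have M1 := G.M1
  have h2 : (y - yc) ^ 2 ≤ x ^ 2 := by rw [← sq_abs (y - yc)]; gcongr
  have h3 : M / 2 * (y - yc) ^ 2 ≤ M / 2 * x ^ 2 := mul_le_mul_of_nonneg_left h2 (by linarith)
  rw [abs_le] at hy
  rcases le_total yc y with h | h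
  · have := G.right.2.1 0 (y - yc) le_rfl (by linarith) (by linarith [hy.2])
    rw [add_zero, add_sub_cancel, zero_pow (by norm_num), sub_zero] at this
    linarith
  · have := G.left.2.1 0 (yc - y) le_rfl (by linarith) (by linarith [hy.1])
    rw [sub_zero, sub_sub_cancel, zero_pow (by norm_num), sub_zero] at this
    have e : (yc - y) ^ 2 = (y - yc) ^ 2 := by ring
    rw [e] at this
    linarith

theorem re_pt (hε : ε ≠ 0) (y q : ℝ) :
    ((q : ℂ) * ((u y - cr : ℝ) : ℂ) / rf u cr ε y).re = q * (u y - cr) ^ 2 / ((u y - cr) ^ 2 + ε ^ 2) := by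
  have h := rf_split_pt (u := u) (cr := cr) hε y (q * (u y - cr)) 1
  have e : (q : ℂ) * ((u y - cr : ℝ) : ℂ) / rf u cr ε y
    = ((q * (u y - cr) : ℝ) : ℂ) * 1 * (starRingEnd ℂ) 1 / rf u cr ε y := by
    push_cast; simp
  rw [e, h]
  simp [-Complex.ofReal_mul, -Complex.ofReal_div, -Complex.ofReal_add, -Complex.ofReal_sub, -Complex.ofReal_pow]
  ring

theorem RGeo.lower (G : RGeo u u1 u2 u3 ρ ρ1 yc m M d r) (X : RRoot u yc m M r cr L y1 y2) (hε : ε ≠ 0)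
    (hη : |ε| ≤ 1 / 2 * L ^ 2) :
    m * L / M ≤ ‖∫ y in y1..y2, (u2 y : ℂ) * ((u y - cr : ℝ) : ℂ) / rf u cr ε y‖ := by
  have cu := G.cu
  have cu2 := G.cu2
  have m0 := G.m0
  have M1 := G.M1
  have L0 := X.L0
  have hM0 : 0 < M := by linarith
  have hcf := rf_cont G.cu cr ε
  obtain ⟨o1, o2, o3, o4, o5, o6, -, -, o9, -, -⟩ := G.ord X
  have hLM : 0 < L / M := by positivity
  have cc : Continuous fun y => (u2 y : ℂ) * ((u y - cr : ℝ) : ℂ) / rf u cr ε y :=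
    Continuous.div (by fun_prop) hcf (rf_ne hε)
  have c1 : Continuous fun y => u2 y * (u y - cr) ^ 2 / ((u y - cr) ^ 2 + ε ^ 2) :=
    Continuous.div (by fun_prop) (by fun_prop) (fun y => (nf_pos hε _).ne')
  have e1 : (∫ y in y1..y2, (u2 y : ℂ) * ((u y - cr : ℝ) : ℂ) / rf u cr ε y).re
      = ∫ y in y1..y2, u2 y * (u y - cr) ^ 2 / ((u y - cr) ^ 2 + ε ^ 2) := by
    have := Complex.reCLM.intervalIntegral_comp_comm (cc.intervalIntegrable (μ := volume) y1 y2)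
    simp only [Complex.reCLM_apply, re_pt hε] at this
    exact this.symm
  refine le_trans ?_ ((le_abs_self _).trans (Complex.abs_re_le_norm _))
  rw [e1]
  have s1 : ∫ y in (yc - L / M)..(yc + L / M), m / 2
      ≤ ∫ y in (yc - L / M)..(yc + L / M), u2 y * (u y - cr) ^ 2 / ((u y - cr) ^ 2 + ε ^ 2) := by
    apply intervalIntegral.integral_mono_on (by linarith) (by simp) (c1.intervalIntegrable _ _)
    intro y hy
    have hz : m ≤ u2 y := G.zpos ⟨by linarith [hy.1, X.l1], by linarith [hy.2, X.l2]⟩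
    have hx : |y - yc| ≤ L / M := by rw [abs_le]; constructor <;> linarith [hy.1, hy.2]
    have h1 := G.ulow (by linarith [X.l2]) hx
    have h2 : M / 2 * (L / M) ^ 2 ≤ L ^ 2 / 2 := by
      have : M / 2 * (L / M) ^ 2 = L ^ 2 / 2 / M := by field_simp
      rw [this]; exact div_le_self (by positivity) M1
    have h3 : |ε| ≤ -(u y - cr) := by linarith [X.hL]
    have h4 : ε ^ 2 ≤ (u y - cr) ^ 2 := by
      rw [← sq_abs ε, ← neg_sq (u y - cr)]; gcongr
    have hn := nf_pos hε (u y - cr)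
    rw [le_div_iff₀ hn]
    calc m / 2 * ((u y - cr) ^ 2 + ε ^ 2) ≤ m / 2 * ((u y - cr) ^ 2 + (u y - cr) ^ 2) := by gcongr
      _ = m * (u y - cr) ^ 2 := by ring
      _ ≤ _ := by gcongr
  have s2 : ∫ y in (yc - L / M)..(yc + L / M), u2 y * (u y - cr) ^ 2 / ((u y - cr) ^ 2 + ε ^ 2)
      ≤ ∫ y in y1..y2, u2 y * (u y - cr) ^ 2 / ((u y - cr) ^ 2 + ε ^ 2) := by
    apply intervalIntegral.integral_mono_interval (by linarith [X.l1]) (by linarith) (by linarith [X.l2]) _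
      (c1.intervalIntegrable _ _)
    filter_upwards [ae_restrict_mem measurableSet_Ioc] with y hy
    have hz : m ≤ u2 y := G.zpos ⟨by linarith [hy.1], by linarith [hy.2]⟩
    have hz' : 0 ≤ u2 y := by linarith
    simp only [Pi.zero_apply]
    have hn := nf_pos hε (u y - cr)
    positivity
  rw [intervalIntegral.integral_const, smul_eq_mul] at s1
  have e : (yc + L / M - (yc - L / M)) * (m / 2) = m * L / M := by ring
  linarith

theorem RGeo.sing2 (G : RGeo u u1 u2 u3 ρ ρ1 yc m M d r) (L0 : 0 < L) {h : ℝ → ℂ} {p q y0 E : ℝ}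
    (hpq : p ≤ q) (hp : yc - r ≤ p) (hq : q ≤ yc + r)
    (hp' : y0 - 8 * (L / m) ≤ p) (hq' : q ≤ y0 + 8 * (L / m))
    (hE : 0 ≤ E) (hh : ∀ y ∈ Icc p q, ‖h y‖ ≤ √|y - y0| * E)
    (hU : ∀ y ∈ Icc p q, m * L / (2 * M) * |y - y0| ≤ |u y - cr|) :
    ‖∫ y in p..q, (u2 y : ℂ) * h y / rf u cr ε y‖ ≤ 8 * M ^ 2 / m * √(8 / m) * (E / √L) := by
  have m0 := G.m0
  have M1 := G.M1
  have hM0 : 0 < M := by linarith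
  refine (sing_est (D := M * E) (t := 8 * (L / m)) (c := m * L / (2 * M)) hpq hp' hq' (by positivity)
    (by positivity) ?_ hU).trans ?_
  · intro y hy
    have h1 : |u2 y| ≤ M := G.zup (G.zI ⟨hp.trans hy.1, hy.2.trans hq⟩)
    rw [norm_mul, Complex.norm_real, Real.norm_eq_abs]
    calc |u2 y| * ‖h y‖ ≤ M * (√|y - y0| * E) := by gcongr; exact hh y hy
      _ = _ := by ring
  · have h2 : √L * √L = L := Real.mul_self_sqrt L0.le
    have h3 : 0 < √L := Real.sqrt_pos.2 L0
    have h4 : √(8 * (L / m)) = √(8 / m) * √L := by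
      rw [← Real.sqrt_mul (by positivity)]; congr 1; ring
    rw [h4]
    apply le_of_eq
    calc 4 * (M * E / (m * L / (2 * M))) * (√(8 / m) * √L)
        = 4 * (M * E / (m * (√L * √L) / (2 * M))) * (√(8 / m) * √L) := by rw [h2]
      _ = _ := by generalize √(8 / m) = s; field_simp; ring

end AuxL

section AuxM
open Set

variable {u u1 u2 u3 ρ ρ1 : ℝ → ℝ} {yc m M d r cr ε k δ L y1 y2 : ℝ} {w w1 T T1 : ℝ → ℂ}

theorem rO_ge (h1 : -1 ≤ y1) (h2 : y2 ≤ 1) : (∫ y in (-1:ℝ)..y1, ‖T1 y‖ ^ 2) ≤ rO k y1 y2 T T1 ∧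
    (∫ y in y2..1, ‖T1 y‖ ^ 2) ≤ rO k y1 y2 T T1 ∧ k ^ 2 * (∫ y in (-1:ℝ)..1, ‖T y‖ ^ 2) ≤ rO k y1 y2 T T1 := by
  have a1 := rI_nonneg T1 h1
  have a2 := rI_nonneg T1 h2
  have a3 : 0 ≤ k ^ 2 * (∫ y in (-1:ℝ)..1, ‖T y‖ ^ 2) :=
    mul_nonneg (sq_nonneg _) (rI_nonneg T (by norm_num))
  unfold rO
  refine ⟨?_, ?_, ?_⟩ <;> linarith

theorem RGeo.outR (G : RGeo u u1 u2 u3 ρ ρ1 yc m M d r) (X : RRoot u yc m M r cr L y1 y2) (hε : ε ≠ 0)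
    (hT : ∀ y, HasDerivAt T (T1 y) y) (hT1 : Continuous T1) (T2z : T y2 = 0) {C0 : ℝ} {B B1 : ℝ → ℝ}
    (b : RBump C0 yc (4 * (L / m)) B B1) :
    ‖∫ y in y2..(yc + r), (u2 y : ℂ) * (T y * (B y : ℂ)) / rf u cr ε y‖
      ≤ 8 * M ^ 2 / m * √(8 / m) * (√(rO k y1 y2 T T1) / √L) := by
  obtain ⟨o1, o2, o3, o4, o5, o6, -, o8, -, o10, o11, o12, o13, o14⟩ := G.ord X
  have cT := rcont hT
  have cu2 := G.cu2
  have cB := b.cont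
  have hcf := rf_cont G.cu cr ε
  have cc : Continuous fun y => (u2 y : ℂ) * (T y * (B y : ℂ)) / rf u cr ε y :=
    Continuous.div (by fun_prop) hcf (rf_ne hε)
  rw [ra_restr cc (le_refl y2) (b := yc + 8 * (L / m)) (by linarith)]
  · refine G.sing2 X.L0 (y0 := y2) (by linarith) (by linarith) (by linarith) (by linarith) (by linarith)
      (Real.sqrt_nonneg _) ?_ ?_
    · intro y hy
      have h1 := ra_hold' hT hT1 (a := y2) (b := 1) (s := y) (t := y2) ⟨hy.1, by linarith [hy.2]⟩ ⟨le_rfl, o11⟩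
      rw [T2z, sub_zero] at h1
      have h2 := Real.sqrt_le_sqrt (rO_ge (k := k) (T := T) (T1 := T1) o10 o11).2.1
      rw [norm_mul, Complex.norm_real, Real.norm_eq_abs, abs_of_nonneg (b.nn y)]
      calc ‖T y‖ * B y ≤ ‖T y‖ * 1 := by gcongr; exact b.le y
        _ = ‖T y‖ := mul_one _
        _ ≤ _ := h1.trans (by gcongr)
    · intro y hy
      exact X.low2 y ⟨by linarith [hy.1], by linarith [hy.2, G.r0]⟩
  · intro y hy
    have : y = y2 := le_antisymm hy.2 hy.1
    rw [this, T2z]; simp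
  · intro y hy
    rw [b.z y (by rw [le_abs]; left; linarith [hy.1])]; simp

theorem RGeo.outL (G : RGeo u u1 u2 u3 ρ ρ1 yc m M d r) (X : RRoot u yc m M r cr L y1 y2) (hε : ε ≠ 0)
    (hT : ∀ y, HasDerivAt T (T1 y) y) (hT1 : Continuous T1) (T1z : T y1 = 0) {C0 : ℝ} {B B1 : ℝ → ℝ}
    (b : RBump C0 yc (4 * (L / m)) B B1) :
    ‖∫ y in (yc - r)..y1, (u2 y : ℂ) * (T y * (B y : ℂ)) / rf u cr ε y‖
      ≤ 8 * M ^ 2 / m * √(8 / m) * (√(rO k y1 y2 T T1) / √L) := by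
  obtain ⟨o1, o2, o3, o4, o5, o6, -, o8, -, o10, o11, o12, o13, o14⟩ := G.ord X
  have cT := rcont hT
  have cu2 := G.cu2
  have cB := b.cont
  have hcf := rf_cont G.cu cr ε
  have cc : Continuous fun y => (u2 y : ℂ) * (T y * (B y : ℂ)) / rf u cr ε y :=
    Continuous.div (by fun_prop) hcf (rf_ne hε)
  rw [ra_restr cc (a := yc - 8 * (L / m)) (by linarith) (le_refl y1)]
  · refine G.sing2 X.L0 (y0 := y1) (by linarith) (by linarith) (by linarith) (by linarith) (by linarith)
      (Real.sqrt_nonneg _) ?_ ?_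
    · intro y hy
      have h1 := ra_hold' hT hT1 (a := -1) (b := y1) (s := y) (t := y1) ⟨by linarith [hy.1], hy.2⟩ ⟨o10, le_rfl⟩
      rw [T1z, sub_zero] at h1
      have h2 := Real.sqrt_le_sqrt (rO_ge (k := k) (T := T) (T1 := T1) o10 o11).1
      rw [norm_mul, Complex.norm_real, Real.norm_eq_abs, abs_of_nonneg (b.nn y)]
      calc ‖T y‖ * B y ≤ ‖T y‖ * 1 := by gcongr; exact b.le y
        _ = ‖T y‖ := mul_one _
        _ ≤ _ := h1.trans (by gcongr)
    · intro y hy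
      exact X.low1 y ⟨by linarith [hy.1, G.r0], by linarith [hy.2]⟩
  · intro y hy
    rw [b.z y (by rw [le_abs]; right; linarith [hy.2])]; simp
  · intro y hy
    have : y = y1 := le_antisymm hy.2 hy.1
    rw [this, T1z]; simp

theorem RGeo.inR (G : RGeo u u1 u2 u3 ρ ρ1 yc m M d r) (X : RRoot u yc m M r cr L y1 y2) (hε : ε ≠ 0)
    (hT : ∀ y, HasDerivAt T (T1 y) y) (hT1 : Continuous T1) (T1z : T y1 = 0) (T2z : T y2 = 0) (z : ℂ) :
    ‖∫ y in y1..y2, (u2 y : ℂ) * (T y - (u y - cr) • z) / rf u cr ε y‖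
      ≤ 2 * (8 * M ^ 2 / m * √(8 / m) * (√(∫ y in y1..y2, ‖T1 y - u1 y • z‖ ^ 2) / √L)) := by
  obtain ⟨o1, o2, o3, o4, o5, o6, -, o8, o9, o10, o11, o12, o13, o14⟩ := G.ord X
  have cT := rcont hT
  have cu := G.cu
  have cu1 := G.cu1
  have cu2 := G.cu2
  have hcf := rf_cont G.cu cr ε
  have cc : Continuous fun y => (u2 y : ℂ) * (T y - (u y - cr) • z) / rf u cr ε y :=
    Continuous.div (by fun_prop) hcf (rf_ne hε)
  have hR : ∀ y, HasDerivAt (fun y => T y - (u y - cr) • z) (T1 y - u1 y • z) y := fun y =>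
    (hT y).sub (((G.hu y).sub_const cr).smul_const z)
  have cR1 : Continuous fun y => T1 y - u1 y • z := by fun_prop
  rw [← intervalIntegral.integral_add_adjacent_intervals (cc.intervalIntegrable y1 yc) (cc.intervalIntegrable yc y2)]
  have s1 : ‖∫ y in y1..yc, (u2 y : ℂ) * (T y - (u y - cr) • z) / rf u cr ε y‖
      ≤ 8 * M ^ 2 / m * √(8 / m) * (√(∫ y in y1..y2, ‖T1 y - u1 y • z‖ ^ 2) / √L) := by
    refine G.sing2 X.L0 (y0 := y1) (by linarith) (by linarith) (by linarith) (by linarith) (by linarith)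
      (Real.sqrt_nonneg _) ?_ ?_
    · intro y hy
      have h1 := ra_hold' hR cR1 (a := y1) (b := y2) (s := y) (t := y1) ⟨hy.1, by linarith [hy.2]⟩ ⟨le_rfl, o9⟩
      rw [T1z, X.h1] at h1
      simpa using h1
    · intro y hy
      exact X.low1 y ⟨by linarith [hy.1, G.r0], by linarith [hy.2]⟩
  have s2 : ‖∫ y in yc..y2, (u2 y : ℂ) * (T y - (u y - cr) • z) / rf u cr ε y‖
      ≤ 8 * M ^ 2 / m * √(8 / m) * (√(∫ y in y1..y2, ‖T1 y - u1 y • z‖ ^ 2) / √L) := by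
    refine G.sing2 X.L0 (y0 := y2) (by linarith) (by linarith) (by linarith) (by linarith) (by linarith)
      (Real.sqrt_nonneg _) ?_ ?_
    · intro y hy
      have h1 := ra_hold' hR cR1 (a := y1) (b := y2) (s := y) (t := y2) ⟨by linarith [hy.1], hy.2⟩ ⟨o9, le_rfl⟩
      rw [T2z, X.h2] at h1
      simpa using h1
    · intro y hy
      exact X.low2 y ⟨by linarith [hy.1], by linarith [hy.2, G.r0]⟩
  refine (norm_add_le _ _).trans ?_
  linarith

theorem ra_cs2 {a b : ℝ} (hab : a ≤ b) {p q : ℝ → ℂ} (hp : Continuous p) (hq : Continuous q) :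
    ‖∫ x in a..b, p x * q x‖ ≤ √(∫ x in a..b, ‖p x‖ ^ 2) * √(∫ x in a..b, ‖q x‖ ^ 2) := by
  refine (intervalIntegral.norm_integral_le_integral_norm hab).trans ?_
  simp only [norm_mul]
  exact ra_csn hab hp hq

theorem pairO {Z Z1 : ℝ → ℂ} (h1 : -1 ≤ y1) (h2 : y2 ≤ 1) (h3 : y1 ≤ y2) (hk : 0 ≤ k) (cT : Continuous T)
    (hT1 : Continuous T1) (cZ : Continuous Z) (cZ1 : Continuous Z1) (zz : ∀ y ∈ Icc y1 y2, Z1 y = 0) :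
    ‖(∫ y in (-1:ℝ)..1, T1 y * Z1 y) + (k:ℂ) ^ 2 * ∫ y in (-1:ℝ)..1, T y * Z y‖
      ≤ 3 * (√(rO k y1 y2 T T1) * √(rN k Z Z1)) := by
  have cc : Continuous fun y => T1 y * Z1 y := by fun_prop
  obtain ⟨a1, a2, a3⟩ := rO_ge (k := k) (T := T) (T1 := T1) h1 h2
  have e0 : ∫ y in y1..y2, T1 y * Z1 y = 0 := by
    rw [intervalIntegral.integral_congr (g := fun _ => 0)]
    · simp
    · intro y hy
      rw [uIcc_of_le h3] at hy
      simp [zz y hy]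
  have b1 := ra_cs2 h1 hT1 cZ1
  have b2 := ra_cs2 h2 hT1 cZ1
  have b3 := ra_cs2 (show (-1:ℝ) ≤ 1 by norm_num) cT cZ
  have n1 := (ra_sub cZ1 le_rfl h1 (h3.trans h2)).trans (rN_d k Z Z1)
  have n2 := (ra_sub cZ1 (h1.trans h3) h2 le_rfl).trans (rN_d k Z Z1)
  have n3 := rN_0 k Z Z1
  have c1 : ‖∫ y in (-1:ℝ)..y1, T1 y * Z1 y‖ ≤ √(rO k y1 y2 T T1) * √(rN k Z Z1) :=
    b1.trans (mul_le_mul (Real.sqrt_le_sqrt a1) (Real.sqrt_le_sqrt n1) (Real.sqrt_nonneg _) (Real.sqrt_nonneg _))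
  have c2 : ‖∫ y in y2..1, T1 y * Z1 y‖ ≤ √(rO k y1 y2 T T1) * √(rN k Z Z1) :=
    b2.trans (mul_le_mul (Real.sqrt_le_sqrt a2) (Real.sqrt_le_sqrt n2) (Real.sqrt_nonneg _) (Real.sqrt_nonneg _))
  have c3 : ‖(k:ℂ) ^ 2 * ∫ y in (-1:ℝ)..1, T y * Z y‖ ≤ √(rO k y1 y2 T T1) * √(rN k Z Z1) := by
    rw [norm_mul, norm_pow, Complex.norm_real, Real.norm_eq_abs, sq_abs]
    have q1 := Real.sqrt_le_sqrt a3
    have q2 := Real.sqrt_le_sqrt n3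
    rw [Real.sqrt_mul (sq_nonneg _), Real.sqrt_sq hk] at q1 q2
    calc _ ≤ k ^ 2 * (√(∫ x in (-1:ℝ)..1, ‖T x‖ ^ 2) * √(∫ x in (-1:ℝ)..1, ‖Z x‖ ^ 2)) := by gcongr
      _ = (k * √(∫ x in (-1:ℝ)..1, ‖T x‖ ^ 2)) * (k * √(∫ x in (-1:ℝ)..1, ‖Z x‖ ^ 2)) := by ring
      _ ≤ _ := mul_le_mul q1 q2 (by positivity) (by positivity)
  rw [ra_split3 cc (-1) y1 y2 1, e0, add_zero]
  refine (norm_add_le _ _).trans ?_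
  have := norm_add_le (∫ y in (-1:ℝ)..y1, T1 y * Z1 y) (∫ y in y2..1, T1 y * Z1 y)
  linarith

end AuxM

section AuxN
open Set

variable {u u1 u2 u3 ρ ρ1 : ℝ → ℝ} {yc m M d r cr ε k δ L y1 y2 : ℝ} {w w1 T T1 : ℝ → ℂ}

theorem RGeo.zeta_id (G : RGeo u u1 u2 u3 ρ ρ1 yc m M d r) (X : RRoot u yc m M r cr L y1 y2) (hε : ε ≠ 0)
    {β : ℝ → ℂ} (cT : Continuous T) (cβ : Continuous β) (e : ∀ y, w y = T y + β y)
    (supp : ∀ y, 4 * L / m ≤ |y - yc| → β y = 0) {C0 : ℝ} {B B1 : ℝ → ℝ}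
    (b : RBump C0 yc (4 * (L / m)) B B1) (z : ℂ) :
    ∫ y in (yc - r)..(yc + r), (u2 y : ℂ) * w y * (B y : ℂ) / rf u cr ε y
      = (∫ y in (yc - r)..y1, (u2 y : ℂ) * (T y * (B y : ℂ)) / rf u cr ε y)
        + (∫ y in y1..y2, (u2 y : ℂ) * (T y - (u y - cr) • z) / rf u cr ε y)
        + z * (∫ y in y1..y2, (u2 y : ℂ) * ((u y - cr : ℝ) : ℂ) / rf u cr ε y)
        + (∫ y in y2..(yc + r), (u2 y : ℂ) * (T y * (B y : ℂ)) / rf u cr ε y)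
        + ∫ y in (yc - r)..(yc + r), (u2 y : ℂ) * β y / rf u cr ε y := by
  obtain ⟨o1, o2, o3, o4, o5, o6, -, o8, o9, o10, o11, o12, o13, o14⟩ := G.ord X
  have cu := G.cu
  have cu2 := G.cu2
  have cB := b.cont
  have hcf := rf_cont G.cu cr ε
  have c1 : Continuous fun y => (u2 y : ℂ) * (T y * (B y : ℂ)) / rf u cr ε y :=
    Continuous.div (by fun_prop) hcf (rf_ne hε)
  have c2 : Continuous fun y => (u2 y : ℂ) * β y / rf u cr ε y :=
    Continuous.div (by fun_prop) hcf (rf_ne hε)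
  have c3 : Continuous fun y => (u2 y : ℂ) * (T y - (u y - cr) • z) / rf u cr ε y :=
    Continuous.div (by fun_prop) hcf (rf_ne hε)
  have c4 : Continuous fun y => z * ((u2 y : ℂ) * ((u y - cr : ℝ) : ℂ) / rf u cr ε y) :=
    continuous_const.mul (Continuous.div (by fun_prop) hcf (rf_ne hε))
  have e1 : ∫ y in (yc - r)..(yc + r), (u2 y : ℂ) * w y * (B y : ℂ) / rf u cr ε y
      = (∫ y in (yc - r)..(yc + r), (u2 y : ℂ) * (T y * (B y : ℂ)) / rf u cr ε y)
        + ∫ y in (yc - r)..(yc + r), (u2 y : ℂ) * β y / rf u cr ε y := by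
    rw [← intervalIntegral.integral_add (c1.intervalIntegrable _ _) (c2.intervalIntegrable _ _)]
    apply intervalIntegral.integral_congr
    intro y _
    have : β y * (B y : ℂ) = β y := by
      rcases le_total (4 * L / m) |y - yc| with h | h
      · rw [supp y h]; simp
      · rw [b.one y (by rw [← mul_div_assoc]; exact h)]; simp
    simp only
    rw [e, ← add_div]
    congr 1
    linear_combination (u2 y : ℂ) * this
  have e2 : ∫ y in y1..y2, (u2 y : ℂ) * (T y * (B y : ℂ)) / rf u cr ε y
      = (∫ y in y1..y2, (u2 y : ℂ) * (T y - (u y - cr) • z) / rf u cr ε y)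
        + z * (∫ y in y1..y2, (u2 y : ℂ) * ((u y - cr : ℝ) : ℂ) / rf u cr ε y) := by
    rw [← intervalIntegral.integral_const_mul,
      ← intervalIntegral.integral_add (c3.intervalIntegrable _ _) (c4.intervalIntegrable _ _)]
    apply intervalIntegral.integral_congr
    intro y hy
    rw [uIcc_of_le o9] at hy
    simp only
    rw [b.one y (by rw [abs_le]; constructor <;> linarith [hy.1, hy.2]), Complex.real_smul]
    push_cast
    ring
  rw [e1, ra_split3 c1 (yc - r) y1 y2 (yc + r), e2]
  ring

theorem amp_alg {a b c d e f g : ℂ} {S : ℝ} (h : ‖(a + b) + (c + d + e + f + g)‖ ≤ S) :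
    ‖e‖ ≤ S + ‖a‖ + ‖b‖ + ‖c‖ + ‖d‖ + ‖f‖ + ‖g‖ := by
  have e1 : e = ((a + b) + (c + d + e + f + g)) - a - b - c - d - f - g := by ring
  calc ‖e‖ = ‖((a + b) + (c + d + e + f + g)) - a - b - c - d - f - g‖ := by rw [← e1]
    _ ≤ ‖(a + b) + (c + d + e + f + g)‖ + ‖a‖ + ‖b‖ + ‖c‖ + ‖d‖ + ‖f‖ + ‖g‖ := by
      refine (norm_sub_le _ _).trans (add_le_add_left ?_ _)
      refine (norm_sub_le _ _).trans (add_le_add_left ?_ _)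
      refine (norm_sub_le _ _).trans (add_le_add_left ?_ _)
      refine (norm_sub_le _ _).trans (add_le_add_left ?_ _)
      refine (norm_sub_le _ _).trans (add_le_add_left ?_ _)
      exact norm_sub_le _ _
    _ ≤ _ := by gcongr

theorem amp_alg' {a a' b b' q c d e f g : ℂ} {S : ℝ} (h : ‖((a + b) + q * (a' + b')) + (c + d + e + f + g)‖ ≤ S) :
    ‖e‖ ≤ S + ‖a + q * a'‖ + ‖b + q * b'‖ + ‖c‖ + ‖d‖ + ‖f‖ + ‖g‖ := by
  apply amp_alg
  have e1 : (a + q * a' + (b + q * b')) = ((a + b) + q * (a' + b')) := by ring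
  rw [e1]; exact h

theorem amp_num {z0 sZ sβ s C S δ O I P q R c : ℝ} (hδ : 0 ≤ δ) (hO : 0 ≤ O) (hI : 0 ≤ I) (hP : 0 ≤ P)
    (hq : 0 ≤ q) (hs : 0 ≤ s) (hC : 1 ≤ C) (hS : 0 ≤ S)
    (h1 : sZ ≤ s * q) (h2 : sβ ≤ √C * P) (h3 : 0 ≤ sZ)
    (h : z0 * c ≤ δ * sZ + 3 * (O * sZ) + sβ * sZ + S * (O * q) + 2 * (S * (I * q)) + S * (O * q) + C * (P * q))
    (hR : R = 3 * s + s * √C + 2 * S + C) :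
    z0 * c ≤ R * ((O + I + P + δ) * q) := by
  have hc : 0 ≤ √C := Real.sqrt_nonneg _
  have a1 : δ * sZ ≤ δ * (s * q) := mul_le_mul_of_nonneg_left h1 hδ
  have a2 : O * sZ ≤ O * (s * q) := mul_le_mul_of_nonneg_left h1 hO
  have a3 : sβ * sZ ≤ √C * P * (s * q) := mul_le_mul h2 h1 h3 (by positivity)
  have p1 : 0 ≤ O * q := by positivity
  have p2 : 0 ≤ I * q := by positivity
  have p3 : 0 ≤ P * q := by positivity
  have p4 : 0 ≤ δ * q := by positivity
  have p5 : 0 ≤ s * √C := by positivity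
  have e : R * ((O + I + P + δ) * q) - (δ * (s * q) + 3 * (O * (s * q)) + √C * P * (s * q) + S * (O * q) + 2 * (S * (I * q)) + S * (O * q) + C * (P * q))
    = (s * √C + C) * (O * q) + (3 * s + s * √C + C) * (I * q) + (3 * s + 2 * S) * (P * q)
      + (2 * s + s * √C + 2 * S + C) * (δ * q) := by rw [hR]; ring
  have f : 0 ≤ (s * √C + C) * (O * q) + (3 * s + s * √C + C) * (I * q) + (3 * s + 2 * S) * (P * q)
      + (2 * s + s * √C + 2 * S + C) * (δ * q) := by positivity
  linarith

set_option maxHeartbeats 1000000 in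
theorem RGeo.amp (G : RGeo u u1 u2 u3 ρ ρ1 yc m M d r) {A C : ℝ} (hC : 1 ≤ C) :
    ∃ R : ℝ, 1 ≤ R ∧ ∀ (cr ε k δ L y1 y2 P : ℝ) (w w1 T T1 β β1 : ℝ → ℂ) (z : ℂ), RRoot u yc m M r cr L y1 y2 →
      ε ≠ 0 → |ε| ≤ 1 / 2 * L ^ 2 → 0 ≤ k → k * L ≤ A →
      RStar u u2 yc r cr ε k δ w w1 → 0 ≤ δ → RDec u u2 yc m r cr ε k δ L y1 y2 P C w w1 T T1 β β1 → 
      ‖z‖ * (m * L / M) ≤ R * ((√(rO k y1 y2 T T1) + √(∫ y in y1..y2, ‖T1 y - u1 y • z‖ ^ 2) + √P + δ) * (1 / √L)) := by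
  obtain ⟨C0, hC0, hbump⟩ := ra_bump
  have m0 := G.m0
  have M1 := G.M1
  obtain ⟨s, hs⟩ : ∃ s, s = √(C0 ^ 2 * m + 16 * A ^ 2 / m) := ⟨_, rfl⟩
  obtain ⟨S, hS⟩ : ∃ S, S = 8 * M ^ 2 / m * √(8 / m) := ⟨_, rfl⟩
  have s0 : 0 ≤ s := by rw [hs]; positivity
  have S0 : 0 ≤ S := by rw [hS]; positivity
  have sc : 0 ≤ s * √C := by positivity
  refine ⟨3 * s + s * √C + 2 * S + C, by linarith, ?_⟩
  intro cr ε k δ L y1 y2 P w w1 T T1 β β1 z X hε hη hk hkA hst hδ D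
  have L0 := X.L0
  have hLm : 0 < L / m := by positivity
  obtain ⟨o1, o2, o3, o4, o5, o6, -, o8, o9, o10, o11, o12, o13, o14⟩ := G.ord X
  obtain ⟨B, B1, b⟩ := hbump yc (4 * (L / m)) (by linarith)
  have cT := rcont D.hT
  have cβ := rcont D.hβ
  have cB := b.cont
  have cB1 := b.c
  have cZ : Continuous fun y => (B y : ℂ) := by fun_prop
  have cZ1 : Continuous fun y => (B1 y : ℂ) := by fun_prop
  have hZ : rN k (fun y => (B y : ℂ)) (fun y => (B1 y : ℂ)) ≤ (C0 ^ 2 * m + 16 * A ^ 2 / m) / L := by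
    have h := b.rN (k := k) (by linarith) (by linarith) (by linarith) 1
    simp only [one_mul, norm_one, one_pow] at h
    refine h.trans ?_
    rw [le_div_iff₀ L0]
    have e1 : 4 * (C0 ^ 2 / (4 * (L / m)) + k ^ 2 * (4 * (L / m))) * L = C0 ^ 2 * m + 16 * (k * L) ^ 2 / m := by
      field_simp; ring
    rw [e1]
    have : 0 ≤ k * L := by positivity
    gcongr
  have hZs : √(rN k (fun y => (B y : ℂ)) (fun y => (B1 y : ℂ))) ≤ s * (1 / √L) := by
    rw [hs, mul_one_div, ← Real.sqrt_div (by positivity)]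
    exact Real.sqrt_le_sqrt hZ
  have hst' := hst (fun y => (B y : ℂ)) (fun y => (B1 y : ℂ)) (fun y => (b.d y).ofReal_comp) cZ1
    (by rw [b.z]; · simp
        rw [le_abs]; right; linarith)
    (by rw [b.z]; · simp
        rw [le_abs]; left; linarith)
  have i1 : ∫ y in (-1:ℝ)..1, w1 y * (B1 y : ℂ) = (∫ y in (-1:ℝ)..1, T1 y * (B1 y : ℂ))
      + ∫ y in (-1:ℝ)..1, β1 y * (B1 y : ℂ) := by
    rw [← rint_add_mul D.hT1 D.hβ1 cZ1]; simp only [D.e1]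
  have i2 : ∫ y in (-1:ℝ)..1, w y * (B y : ℂ) = (∫ y in (-1:ℝ)..1, T y * (B y : ℂ))
      + ∫ y in (-1:ℝ)..1, β y * (B y : ℂ) := by
    rw [← rint_add_mul cT cβ cZ]; simp only [D.e]
  rw [i1, i2, G.zeta_id X hε cT cβ D.e D.supp b z] at hst'
  have q1 := pairO (k := k) o10 o11 o9 hk cT D.hT1 cZ cZ1 (by
    intro y hy
    rw [b.z1 y (by rw [abs_lt]; constructor <;> linarith [hy.1, hy.2])]; simp)
  have q2 := rN_cs (k := k) cβ D.hβ1 cZ cZ1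
  have q3 := G.outL (k := k) (y2 := y2) X hε D.hT D.hT1 D.Ty1 b
  have q4 := G.outR (k := k) (y1 := y1) X hε D.hT D.hT1 D.Ty2 b
  have q5 := G.inR X hε D.hT D.hT1 D.Ty1 D.Ty2 z
  have q6 := D.pv
  have q7 := amp_alg' hst'
  have q8 := G.lower X hε hη
  rw [norm_mul] at q7
  have q9 := mul_le_mul_of_nonneg_left q8 (norm_nonneg z)
  have hβ : √(rN k β β1) ≤ √C * √P := by
    rw [← Real.sqrt_mul (by linarith)]; exact Real.sqrt_le_sqrt D.b
  rw [← hS] at q3 q4 q5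
  refine amp_num hδ (Real.sqrt_nonneg _) (Real.sqrt_nonneg _) (Real.sqrt_nonneg _) (by positivity) s0 hC S0
    hZs hβ (Real.sqrt_nonneg _) ?_ rfl
  simp only [mul_one_div]
  linarith

end AuxN

section AuxO
open Set

variable {u u1 u2 u3 ρ ρ1 : ℝ → ℝ} {yc m M d r cr ε k δ L y1 y2 : ℝ} {w w1 T T1 : ℝ → ℂ}

theorem RGeo.in_en (G : RGeo u u1 u2 u3 ρ ρ1 yc m M d r) (X : RRoot u yc m M r cr L y1 y2)
    (hT1 : Continuous T1) (z : ℂ) :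
    ∫ y in y1..y2, ‖T1 y‖ ^ 2 ≤ 2 * (∫ y in y1..y2, ‖T1 y - u1 y • z‖ ^ 2)
      + 32 * M ^ 2 / m ^ 3 * (‖z‖ ^ 2 * L ^ 3) := by
  obtain ⟨o1, o2, o3, o4, o5, o6, -, o8, o9, o10, o11, o12, o13, o14⟩ := G.ord X
  have m0 := G.m0
  have M1 := G.M1
  have d0 := G.d0
  have cu1 := G.cu1
  have h := rI_add o9 (φ := fun y => T1 y - u1 y • z) (χ := fun y => u1 y • z) (by fun_prop) (by fun_prop)
  simp only [sub_add_cancel] at h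
  have h2 : ∫ y in y1..y2, ‖u1 y • z‖ ^ 2 ≤ ∫ y in y1..y2, (M * (2 * (L / m)) * ‖z‖) ^ 2 := by
    apply intervalIntegral.integral_mono_on o9
    · exact (by fun_prop : Continuous fun y => ‖u1 y • z‖ ^ 2).intervalIntegrable _ _
    · simp
    · intro y hy
      have h3 := G.up y ⟨by linarith [hy.1], by linarith [hy.2]⟩
      have h4 : |y - yc| ≤ 2 * (L / m) := by rw [abs_le]; constructor <;> linarith [hy.1, hy.2]
      rw [norm_smul, Real.norm_eq_abs]
      gcongr
      exact h3.trans (by gcongr)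
  rw [intervalIntegral.integral_const, smul_eq_mul] at h2
  have h5 : (y2 - y1) * (M * (2 * (L / m)) * ‖z‖) ^ 2 ≤ 4 * (L / m) * (M * (2 * (L / m)) * ‖z‖) ^ 2 := by
    gcongr; linarith
  have e : 4 * (L / m) * (M * (2 * (L / m)) * ‖z‖) ^ 2 = 16 * M ^ 2 / m ^ 3 * (‖z‖ ^ 2 * L ^ 3) := by
    field_simp; ring
  have e' : 32 * M ^ 2 / m ^ 3 * (‖z‖ ^ 2 * L ^ 3) = 2 * (16 * M ^ 2 / m ^ 3 * (‖z‖ ^ 2 * L ^ 3)) := by ring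
  rw [e']
  linarith

theorem sq4 (a b c d : ℝ) : (a + b + c + d) ^ 2 ≤ 4 * (a ^ 2 + b ^ 2 + c ^ 2 + d ^ 2) := by
  linarith [sq_nonneg (a - b), sq_nonneg (a - c), sq_nonneg (a - d), sq_nonneg (b - c), sq_nonneg (b - d), sq_nonneg (c - d)]

theorem amp_sq {Zn O I P R : ℝ} (hm : 0 < m) (hM : 0 < M) (hL : 0 < L) (hZ : 0 ≤ Zn) (hO : 0 ≤ O) (hI : 0 ≤ I) (hP : 0 ≤ P)
    (h : Zn * (m * L / M) ≤ R * ((√O + √I + √P + δ) * (1 / √L))) :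
    32 * M ^ 2 / m ^ 3 * (Zn ^ 2 * L ^ 3) ≤ 128 * M ^ 4 / m ^ 5 * R ^ 2 * (O + I + P + δ ^ 2) := by
  have sL : 0 < √L := Real.sqrt_pos.2 hL
  have s2 : √L ^ 2 = L := Real.sq_sqrt hL.le
  have h1 : Zn * (m * L / M) * √L ≤ R * (√O + √I + √P + δ) := by
    calc _ ≤ R * ((√O + √I + √P + δ) * (1 / √L)) * √L := by gcongr
      _ = _ := by field_simp
  have h2 : (Zn * (m * L / M) * √L) ^ 2 ≤ (R * (√O + √I + √P + δ)) ^ 2 := by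
    gcongr
  have h3 := sq4 (√O) (√I) (√P) δ
  rw [Real.sq_sqrt hO, Real.sq_sqrt hI, Real.sq_sqrt hP] at h3
  have e1 : 32 * M ^ 2 / m ^ 3 * (Zn ^ 2 * L ^ 3) = 32 * M ^ 4 / m ^ 5 * (Zn * (m * L / M) * √L) ^ 2 := by
    rw [mul_pow _ (√L), s2]; field_simp
  rw [e1]
  calc _ ≤ 32 * M ^ 4 / m ^ 5 * (R * (√O + √I + √P + δ)) ^ 2 := by gcongr
    _ = 32 * M ^ 4 / m ^ 5 * R ^ 2 * (√O + √I + √P + δ) ^ 2 := by ring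
    _ ≤ 32 * M ^ 4 / m ^ 5 * R ^ 2 * (4 * (O + I + P + δ ^ 2)) := by gcongr
    _ = _ := by ring

theorem abs_N {N E C P O I D1 : ℝ} (hO : 0 ≤ O) (hI : 0 ≤ I) (hP : 0 ≤ P) (hD : 0 ≤ D1)
    (h1 : N ^ 2 ≤ O + (2 * I + D1 * (O + I + P + δ ^ 2))) (h2 : O + 1 / 2 * I ≤ C * (√P + δ) * N)
    (hE : E = D1 + 2) : N ^ 2 ≤ (2 * E + 8 * E ^ 2 * C ^ 2) * (P + δ ^ 2) := by
  have hs : √P ^ 2 = P := Real.sq_sqrt hP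
  have hE0 : 0 ≤ E := by linarith
  have h3 : N ^ 2 ≤ E * (O + I + P + δ ^ 2) := by
    have : E * (O + I + P + δ ^ 2) = D1 * (O + I + P + δ ^ 2) + 2 * (O + I + P + δ ^ 2) := by rw [hE]; ring
    linarith [sq_nonneg δ]
  have h4 : E * (O + I + P + δ ^ 2) ≤ E * (2 * (C * (√P + δ) * N) + P + δ ^ 2) := by
    apply mul_le_mul_of_nonneg_left _ hE0; linarith
  have h5 := sq_nonneg (N - 2 * (E * C * (√P + δ)))
  have h6 : (√P + δ) ^ 2 ≤ 2 * (P + δ ^ 2) := by linarith [sq_nonneg (√P - δ)]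
  have h7 : 2 * (E ^ 2 * C ^ 2) * (√P + δ) ^ 2 ≤ 2 * (E ^ 2 * C ^ 2) * (2 * (P + δ ^ 2)) := by gcongr
  linarith

theorem abs_W {W F η : ℝ} (hF : 1 ≤ F) (hW : 0 ≤ W) (hδ : 0 ≤ δ) (hη : η * F = 1 / 2)
    (h : W ^ 2 ≤ F * ((δ * W + η * W ^ 2) + δ ^ 2)) : W ≤ 3 * F * δ := by
  have e : F * ((δ * W + η * W ^ 2) + δ ^ 2) = F * δ * W + (η * F) * W ^ 2 + F * δ ^ 2 := by ring
  rw [e, hη] at h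
  by_contra hc
  push Not at hc
  have p0 : 0 ≤ F * δ := by positivity
  have h1 : 3 * F * δ * W ≤ W * W := mul_le_mul_of_nonneg_right hc.le hW
  have h2 : 0 < W := lt_of_le_of_lt (by positivity) hc
  have h3 : (3 * F * δ) * (F * δ) ≤ W * (F * δ) := mul_le_mul_of_nonneg_right hc.le p0
  have h4 : F * δ ^ 2 ≤ F * F * δ ^ 2 := by
    have : F * 1 ≤ F * F := by gcongr
    have := mul_le_mul_of_nonneg_right this (sq_nonneg δ)
    linarith
  rcases hδ.eq_or_lt with h0 | h0
  · rw [← h0] at h; simp at h; linarith [mul_pos h2 h2]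
  · have p1 : 0 < F * F * δ ^ 2 := by positivity
    linarith

theorem RGeo.case2b (G : RGeo u u1 u2 u3 ρ ρ1 yc m M d r) (A : ℝ) :
    ∃ η C : ℝ, 0 < η ∧ 1 ≤ C ∧ ∀ (cr ε k δ L y1 y2 : ℝ) (w w1 : ℝ → ℂ), RRoot u yc m M r cr L y1 y2 →
      ε ≠ 0 → |ε| ≤ η * L ^ 2 → 0 ≤ k → k * L ≤ A →
      (∀ y, HasDerivAt w (w1 y) y) → Continuous w1 → w (-1) = 0 → w 1 = 0 →
      RStar u u2 yc r cr ε k δ w w1 → 0 ≤ δ → √(rN k w w1) ≤ C * δ := by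
  obtain ⟨C, hC, hdec⟩ := G.decomp (A := A)
  obtain ⟨R, hR, hamp⟩ := G.amp (A := A) hC
  have m0 := G.m0
  have M1 := G.M1
  have M0 : 0 < M := by linarith
  obtain ⟨D1, hD1⟩ : ∃ x, x = 128 * M ^ 4 / m ^ 5 * R ^ 2 := ⟨_, rfl⟩
  have D0 : 0 ≤ D1 := by rw [hD1]; positivity
  obtain ⟨E, hE⟩ : ∃ x, x = D1 + 2 := ⟨_, rfl⟩
  obtain ⟨F, hF⟩ : ∃ x, x = 2 * (2 * E + 8 * E ^ 2 * C ^ 2) + 2 * C := ⟨_, rfl⟩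
  have F1 : 1 ≤ F := by
    have : 0 ≤ 8 * E ^ 2 * C ^ 2 := by positivity
    linarith
  refine ⟨1 / (2 * F), 3 * F, by positivity, by linarith, ?_⟩
  intro cr ε k δ L y1 y2 w w1 X hε hη hk hkA hw hw1 wl wr hs hδ
  have L0 := X.L0
  have hη2 : 1 / (2 * F) ≤ 1 / 2 := by
    apply one_div_le_one_div_of_le <;> linarith
  obtain ⟨T, T1, β, β1, D⟩ := hdec cr ε k δ (1 / (2 * F)) L y1 y2 w w1 X hε hη hη2 hk hkA hw hw1 wl wr hs hδ
  have η0 : 0 ≤ 1 / (2 * F) := by positivity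
  have ηF : 1 / (2 * F) * F = 1 / 2 := by field_simp
  generalize 1 / (2 * F) = η at *
  have W0 : 0 ≤ √(rN k w w1) := Real.sqrt_nonneg _
  have P0 : 0 ≤ δ * √(rN k w w1) + η * √(rN k w w1) ^ 2 := by positivity
  apply abs_W F1 W0 hδ ηF
  have hWT : rN k w w1 ≤ 2 * rN k T T1 + 2 * rN k β β1 := by
    have := rN_add (k := k) (rcont D.hT) D.hT1 (rcont D.hβ) D.hβ1
    have ew : w = fun y => T y + β y := funext D.e
    have ew1 : w1 = fun y => T1 y + β1 y := funext D.e1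
    rw [ew, ew1]; exact this
  have hW2 : √(rN k w w1) ^ 2 = rN k w w1 := Real.sq_sqrt (rN_nonneg _ _ _)
  generalize δ * √(rN k w w1) + η * √(rN k w w1) ^ 2 = P at *
  rw [hW2]
  have hU : u yc - cr ≠ 0 := by
    have := X.hL
    have : 0 < L ^ 2 := by positivity
    linarith
  obtain ⟨z, hz⟩ : ∃ z : ℂ, T yc - (u yc - cr) • z = 0 :=
    ⟨(u yc - cr)⁻¹ • T yc, by rw [smul_smul, mul_inv_cancel₀ hU, one_smul, sub_self]⟩
  obtain ⟨o1, o2, o3, o4, o5, o6, -, o8, o9, o10, o11, o12, o13, o14⟩ := G.ord X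
  have hε2 : |ε| ≤ 1 / 2 * L ^ 2 := hη.trans (by gcongr)
  have a1 := hamp cr ε k δ L y1 y2 P w w1 T T1 β β1 z X hε hε2 hk hkA hs hδ D
  have a2 := (G.outer_en (k := k) X hε D.hT D.hT1 D.Ty1 D.Ty2 hz).trans D.en
  have a3 := G.in_en X D.hT1 z
  have I0 : 0 ≤ ∫ y in y1..y2, ‖T1 y - u1 y • z‖ ^ 2 := rI_nonneg _ o9
  have O0 : 0 ≤ rO k y1 y2 T T1 := le_trans (rI_nonneg T1 o10) (rO_ge o10 o11).1
  have a4 := amp_sq m0 M0 L0 (norm_nonneg z) O0 I0 P0 a1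
  rw [← hD1] at a4
  have a5 : rN k T T1 = rO k y1 y2 T T1 + ∫ y in y1..y2, ‖T1 y‖ ^ 2 := by
    have c2 : Continuous fun y => ‖T1 y‖ ^ 2 := by have := D.hT1; fun_prop
    unfold rO rN
    rw [ra_split3 c2 (-1) y1 y2 1]; ring
  have a6 : √(rN k T T1) ^ 2 = rN k T T1 := Real.sq_sqrt (rN_nonneg _ _ _)
  have a7 := abs_N (N := √(rN k T T1)) O0 I0 P0 D0 (by rw [a6, a5]; linarith) a2 hE
  rw [a6] at a7
  have a8 := D.b
  have e : F * (P + δ ^ 2) = 2 * ((2 * E + 8 * E ^ 2 * C ^ 2) * (P + δ ^ 2)) + 2 * (C * P) + 2 * C * δ ^ 2 := by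
    rw [hF]; ring
  have : 0 ≤ 2 * C * δ ^ 2 := by positivity
  rw [e]
  linarith

end AuxO

section AuxP
open Set

variable {u u1 u2 u3 ρ ρ1 : ℝ → ℝ} {yc m M d r cr ε k δ L y1 y2 : ℝ} {w w1 T T1 : ℝ → ℂ}

theorem RGeo.small (G : RGeo u u1 u2 u3 ρ ρ1 yc m M d r) {A : ℝ} (hA : 1 ≤ A) :
    ∃ C : ℝ, 1 ≤ C ∧ ∀ (cr ε k δ : ℝ) (w w1 : ℝ → ℂ), ε ≠ 0 → 0 ≤ k → 0 ≤ cr - u yc →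
      cr - u yc ≤ 1 → cr - u yc ≤ (m * r / 8) ^ 2 → k * √(cr - u yc) ≤ A →
      (∀ y, HasDerivAt w (w1 y) y) → Continuous w1 → w (-1) = 0 → w 1 = 0 →
      RStar u u2 yc r cr ε k δ w w1 → 0 ≤ δ → √(rN k w w1) ≤ C * δ := by
  obtain ⟨η, C, η0, hC, hb⟩ := G.case2b A
  have i0 : 0 < 1 / η := by positivity
  have m0 := G.m0
  have r0 := G.r0
  refine ⟨C + (1 + 1 / η), by linarith, ?_⟩
  intro cr ε k δ w w1 hε hk h0 h1 h2 hkA hw hw1 wl wr hs hδ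
  have p1 : 0 ≤ C * δ := by positivity
  have p2 : 0 ≤ (1 + 1 / η) * δ := by positivity
  rw [add_mul]
  rcases le_total (η * (cr - u yc)) |ε| with h | h
  · have := G.case2a hε hw hw1 wl wr hs hδ η0 h h0
    linarith
  · have e0 : 0 < |ε| := abs_pos.2 hε
    have hp : 0 < cr - u yc := by
      by_contra hc
      have : cr - u yc = 0 := by linarith
      rw [this, mul_zero] at h; linarith
    have hL := Real.sq_sqrt h0
    obtain ⟨y1, y2, X⟩ := G.root (cr := cr) (L := √(cr - u yc)) (Real.sqrt_pos.2 hp) (Real.sqrt_le_one.2 h1)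
      (by
        have := Real.sqrt_le_sqrt h2
        rw [Real.sqrt_sq (by positivity)] at this
        linarith) hL
    have := hb cr ε k δ _ y1 y2 w w1 X hε (by rw [hL]; exact h) hk hkA hw hw1 wl wr hs hδ
    linarith

theorem fin_alg {E W Γ a b C : ℝ} (hE : 0 ≤ E) (hW : 0 ≤ W) (hΓ : 0 ≤ Γ) (hM : 1 ≤ M) (hC : 1 ≤ C) (hk : 1 ≤ k)
    (hK : 4 * C * b ≤ k) (h1 : E ^ 2 ≤ 2 * W ^ 2 + 8 * M ^ 2 * Γ ^ 2)
    (h2 : W ≤ C * (a * Γ + b * E / k ^ 2)) : E ≤ (4 * C * a + 6 * M) * Γ := by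
  have h3 : E ≤ 2 * W + 3 * M * Γ := by
    apply le_of_sq_le_sq _ (by positivity)
    have : 0 ≤ W * (M * Γ) := by positivity
    have : 0 ≤ (M * Γ) ^ 2 := by positivity
    have e : (2 * W + 3 * M * Γ) ^ 2 = 4 * W ^ 2 + 12 * (W * (M * Γ)) + 9 * (M * Γ) ^ 2 := by ring
    have e2 : 8 * M ^ 2 * Γ ^ 2 = 8 * (M * Γ) ^ 2 := by ring
    linarith [sq_nonneg W]
  have h4 : 4 * C * b ≤ k ^ 2 := hK.trans (by nlinarith)
  have h5 : C * (b * E / k ^ 2) ≤ E / 4 := by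
    rw [← mul_div_assoc, div_le_iff₀ (by positivity)]
    have := mul_le_mul_of_nonneg_right h4 hE
    linarith
  linarith

theorem RGeo.main (G : RGeo u u1 u2 u3 ρ ρ1 yc m M d r) :
    ∃ K C : ℝ, 3 ≤ K ∧ 1 ≤ C ∧ ∀ (cr ε k : ℝ) (ψ ψ1 ψ2 g g1 : ℝ → ℂ), RSol u u2 cr ε k ψ ψ1 ψ2 g g1 →
      K ≤ k → 0 ≤ cr - u yc → cr - u yc ≤ 2 * M → |ε| ≤ 1 → √(rN k ψ ψ1) ≤ C * √(rN k g g1) := by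
  have M1 := G.M1
  have m0 := G.m0
  have r0 := G.r0
  obtain ⟨A, hA, h1⟩ := G.case1 (B := 2 * M + 1) (by linarith)
  obtain ⟨C, hC, h2⟩ := G.small hA
  obtain ⟨a, ha⟩ : ∃ a, a = 2 * M + 16 / (m * r ^ 2) := ⟨_, rfl⟩
  obtain ⟨b, hb⟩ : ∃ b, b = 16 * M / (m * r ^ 2) := ⟨_, rfl⟩
  have a0 : 0 ≤ a := by rw [ha]; positivity
  have b0 : 0 ≤ b := by rw [hb]; positivity
  obtain ⟨μ, hμ⟩ : ∃ μ, μ = min 1 (min (m * r ^ 2 / 4) ((m * r / 8) ^ 2)) := ⟨_, rfl⟩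
  have μ0 : 0 < μ := by rw [hμ]; positivity
  have μ1 : μ ≤ 1 := by rw [hμ]; exact min_le_left _ _
  have μ2 : μ ≤ m * r ^ 2 / 4 := by rw [hμ]; exact (min_le_right _ _).trans (min_le_left _ _)
  have μ3 : μ ≤ (m * r / 8) ^ 2 := by rw [hμ]; exact (min_le_right _ _).trans (min_le_right _ _)
  have p1 : 0 ≤ 4 * C * b := by positivity
  have p2 : 0 ≤ A ^ 2 / μ := by positivity
  have p3 : 0 ≤ 4 * C * a := by positivity
  refine ⟨3 + 4 * C * b + A ^ 2 / μ, 4 * C * a + 6 * M, by linarith, by linarith, ?_⟩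
  intro cr ε k ψ ψ1 ψ2 g g1 s hK h0 hM hε1
  have k1 : 1 ≤ k := by linarith
  have hε := s.hε
  have Γ0 : 0 ≤ √(rN k g g1) := Real.sqrt_nonneg _
  have E0 : 0 ≤ √(rN k ψ ψ1) := Real.sqrt_nonneg _
  by_cases hc : A ≤ k * √(cr - u yc + |ε|)
  · refine (h1 cr ε k ψ ψ1 ψ2 g g1 s h0 (by linarith) (by linarith) hc).trans ?_
    have : 1 * √(rN k g g1) ≤ (4 * C * a + 6 * M) * √(rN k g g1) := by gcongr; linarith
    linarith
  push Not at hc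
  have hS : cr - u yc + |ε| ≤ μ := by
    have q0 : 0 ≤ cr - u yc + |ε| := by positivity
    have q1 : (k * √(cr - u yc + |ε|)) ^ 2 ≤ A ^ 2 := by gcongr
    rw [mul_pow, Real.sq_sqrt q0] at q1
    have q2 : A ^ 2 / μ ≤ k ^ 2 := by
      have : k * 1 ≤ k * k := by gcongr
      rw [sq k]; linarith
    rw [div_le_iff₀ μ0] at q2
    have : k ^ 2 * (cr - u yc + |ε|) ≤ k ^ 2 * μ := q1.trans q2
    exact le_of_mul_le_mul_left this (by positivity)
  have hS' : cr - u yc ≤ μ := by linarith [abs_nonneg ε]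
  obtain ⟨w, w1, hw, hw1, wl, wr, hE, hst⟩ := G.reduce s (hS'.trans μ2)
  rw [← ha, ← hb] at hst
  have hδ : 0 ≤ a * √(rN k g g1) + b * √(rN k ψ ψ1) / k ^ 2 := by positivity
  have hkA : k * √(cr - u yc) ≤ A := by
    refine le_trans ?_ hc.le
    gcongr; linarith [abs_nonneg ε]
  have hW := h2 cr ε k _ w w1 hε (by linarith) h0 (hS'.trans μ1) (hS'.trans μ3) hkA hw hw1 wl wr hst hδ
  refine fin_alg E0 (Real.sqrt_nonneg _) Γ0 M1 hC k1 (by linarith) ?_ hW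
  rw [Real.sq_sqrt (rN_nonneg _ _ _), Real.sq_sqrt (rN_nonneg _ _ _), Real.sq_sqrt (rN_nonneg _ _ _)]
  exact hE

end AuxP

section AuxQ
open Set

variable {u u1 u2 u3 ρ ρ1 : ℝ → ℝ} {yc m M d r cr ε k δ L y1 y2 : ℝ} {w w1 T T1 : ℝ → ℂ}

theorem q_pos {q : ℝ → ℝ} (cq : Continuous q) (hyc : yc ∈ Icc (-1:ℝ) 1) (h0 : 0 < q yc)
    (hne : ∀ y ∈ Icc (-1:ℝ) 1, q y ≠ 0) : ∀ y ∈ Icc (-1:ℝ) 1, 0 < q y := by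
  intro y hy
  by_contra hc
  push Not at hc
  have h := intermediate_value_uIcc (a := y) (b := yc) cq.continuousOn
  have h1 : (0:ℝ) ∈ uIcc (q y) (q yc) := by
    rw [uIcc_of_le (by linarith)]; exact ⟨hc, h0.le⟩
  obtain ⟨x, hx, hx0⟩ := h h1
  exact hne x (ordConnected_Icc.uIcc_subset hy hyc hx) hx0

theorem q_ext {q : ℝ → ℝ} (cq : Continuous q) (h : ∀ y ∈ Icc (-1:ℝ) 1, 0 < q y) :
    ∃ d m : ℝ, 0 < d ∧ 0 < m ∧ ∀ y ∈ Icc (-1 - d) (1 + d), m ≤ q y := by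
  have ho : IsOpen {y | 0 < q y} := isOpen_lt continuous_const cq
  obtain ⟨d1, d10, h1⟩ := Metric.isOpen_iff.1 ho 1 (h 1 (by simp))
  obtain ⟨d2, d20, h2⟩ := Metric.isOpen_iff.1 ho (-1) (h (-1) (by simp))
  obtain ⟨d, hd⟩ : ∃ d, d = min d1 d2 / 2 := ⟨_, rfl⟩
  have d0 : 0 < d := by rw [hd]; positivity
  have e1 : d < d1 := by have := min_le_left d1 d2; linarith
  have e2 : d < d2 := by have := min_le_right d1 d2; linarith
  have hp : ∀ y ∈ Icc (-1 - d) (1 + d), 0 < q y := by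
    intro y hy
    by_cases ha : y < -1
    · exact h2 (by rw [Metric.mem_ball, Real.dist_eq, abs_lt]; constructor <;> linarith [hy.1])
    by_cases hb : 1 < y
    · exact h1 (by rw [Metric.mem_ball, Real.dist_eq, abs_lt]; constructor <;> linarith [hy.2])
    push Not at ha hb
    exact h y ⟨ha, hb⟩
  obtain ⟨x, hx, hmin⟩ := (isCompact_Icc (a := -1 - d) (b := 1 + d)).exists_isMinOn ⟨0, by constructor <;> linarith⟩
    cq.continuousOn
  exact ⟨d, q x, d0, hp x hx, fun y hy => hmin hy⟩

theorem rho_ex (hu2 : ∀ y, HasDerivAt u2 (u3 y) y) (cu3 : Continuous u3) (hr : 0 < r)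
    (hpos : ∀ y, |y - yc| ≤ 2 * r → 0 < u2 y) : ∃ ρ ρ1 : ℝ → ℝ, (∀ y, HasDerivAt ρ (ρ1 y) y) ∧ Continuous ρ1 ∧
      (∀ y, |y - yc| ≤ r → ρ y * u2 y = 1) ∧ ∀ y, 2 * r ≤ |y - yc| → ρ y = 0 := by
  obtain ⟨C0, hC0, hbump⟩ := ra_bump
  obtain ⟨B, B1, b⟩ := hbump yc r hr
  have cB := b.cont
  have cB1 := b.c
  have cu2 : Continuous u2 := continuous_iff_continuousAt.2 fun y => (hu2 y).continuousAt
  have far : ∀ y, u2 y = 0 → ∀ᶠ x in nhds y, 2 * r < |x - yc| := by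
    intro y hy
    have h1 : 2 * r < |y - yc| := by
      by_contra hc
      push Not at hc
      exact (hpos y hc).ne' hy
    exact (isOpen_lt continuous_const (by fun_prop : Continuous fun x : ℝ => |x - yc|)).mem_nhds h1
  refine ⟨fun y => B y / u2 y, fun y => (B1 y * u2 y - B y * u3 y) / u2 y ^ 2, ?_, ?_, ?_, ?_⟩
  · intro y
    by_cases hy : u2 y = 0
    · have e : (fun y => B y / u2 y) =ᶠ[nhds y] fun _ => 0 := by
        filter_upwards [far y hy] with x hx
        rw [b.z x hx.le, zero_div]
      simp only [hy]
      have := (hasDerivAt_const y (0:ℝ)).congr_of_eventuallyEq e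
      simpa using this
    · exact (b.d y).div (hu2 y) hy
  · rw [continuous_iff_continuousAt]
    intro y
    by_cases hy : u2 y = 0
    · have e : (fun y => (B1 y * u2 y - B y * u3 y) / u2 y ^ 2) =ᶠ[nhds y] fun _ => 0 := by
        filter_upwards [far y hy] with x hx
        rw [b.z x hx.le, b.z2 x hx]; simp
      exact continuousAt_const.congr e.symm
    · exact ContinuousAt.div (by fun_prop) (by fun_prop) (pow_ne_zero 2 hy)
  · intro y hy
    simp only [b.one y hy]
    exact one_div_mul_cancel (hpos y (by linarith)).ne'
  · intro y hy
    simp only [b.z y hy, zero_div]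

theorem bdd_ex {f : ℝ → ℝ} (hf : Continuous f) (a b : ℝ) : ∃ C : ℝ, 0 ≤ C ∧ ∀ y ∈ Icc a b, |f y| ≤ C := by
  obtain ⟨C, hC⟩ := (isCompact_Icc (a := a) (b := b)).exists_bound_of_continuousOn hf.continuousOn
  exact ⟨max C 0, le_max_right _ _, fun y hy => (hC y hy).trans (le_max_left _ _)⟩

theorem geo_ex (hu : ∀ y, HasDerivAt u (u1 y) y) (hu1 : ∀ y, HasDerivAt u1 (u2 y) y)
    (hu2 : ∀ y, HasDerivAt u2 (u3 y) y) (hu3 : Continuous u3) (hyc : yc ∈ Ioo (-1:ℝ) 1) (h1 : u1 yc = 0)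
    (h2 : 0 < u2 yc) (huq : ∀ y ∈ Icc (-1:ℝ) 1, u1 y = 0 → y = yc) :
    ∃ (ρ ρ1 : ℝ → ℝ) (m M d r : ℝ), RGeo u u1 u2 u3 ρ ρ1 yc m M d r := by
  have cu1 : Continuous u1 := continuous_iff_continuousAt.2 fun y => (hu1 y).continuousAt
  have cu2 : Continuous u2 := continuous_iff_continuousAt.2 fun y => (hu2 y).continuousAt
  obtain ⟨q, cq, q0, hq⟩ : ∃ q : ℝ → ℝ, Continuous q ∧ q yc = u2 yc ∧ ∀ y, u1 y = (y - yc) * q y := by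
    refine ⟨dslope u1 yc, ?_, ?_, ?_⟩
    · have := (continuousOn_dslope (f := u1) (a := yc) (s := univ) Filter.univ_mem).2
        ⟨cu1.continuousOn, (hu1 yc).differentiableAt⟩
      rwa [← continuousOn_univ]
    · rw [dslope_same, (hu1 yc).deriv]
    · intro y
      have := sub_smul_dslope u1 yc y
      rw [h1, sub_zero, smul_eq_mul] at this
      exact this.symm
  have qp := q_pos cq ⟨hyc.1.le, hyc.2.le⟩ (q0 ▸ h2) (by
    intro y hy h0
    have : u1 y = 0 := by rw [hq, h0, mul_zero]
    have := huq y hy this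
    rw [this, q0] at h0
    exact h2.ne' h0)
  obtain ⟨d, m1, d0, m10, hm1⟩ := q_ext cq qp
  have ho : IsOpen {y | u2 yc / 2 < u2 y ∧ u2 y < 2 * q y} :=
    (isOpen_lt continuous_const cu2).inter (isOpen_lt cu2 (by fun_prop))
  obtain ⟨r0, r00, hr0⟩ := Metric.isOpen_iff.1 ho yc ⟨by linarith, by rw [q0]; linarith⟩
  obtain ⟨r, hr⟩ : ∃ r, r = min (r0 / 4) (min ((1 - yc) / 2) ((1 + yc) / 2)) := ⟨_, rfl⟩
  have rp : 0 < r := by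
    rw [hr]
    exact lt_min (by linarith) (lt_min (by linarith [hyc.2]) (by linarith [hyc.1]))
  have r1 : r ≤ r0 / 4 := by rw [hr]; exact min_le_left _ _
  have r2 : r ≤ (1 - yc) / 2 := by rw [hr]; exact (min_le_right _ _).trans (min_le_left _ _)
  have r3 : r ≤ (1 + yc) / 2 := by rw [hr]; exact (min_le_right _ _).trans (min_le_right _ _)
  have near : ∀ y, |y - yc| ≤ 2 * r → u2 yc / 2 < u2 y ∧ u2 y < 2 * q y := by
    intro y hy
    exact hr0 (by rw [Metric.mem_ball, Real.dist_eq]; linarith)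
  obtain ⟨ρ, ρ1, hρ, hρ1, rone, rz⟩ := rho_ex hu2 hu3 rp (fun y hy => by linarith [(near y hy).1])
  have cρ : Continuous ρ := continuous_iff_continuousAt.2 fun y => (hρ y).continuousAt
  obtain ⟨K1, K10, hK1⟩ := bdd_ex cq (-1 - d) (1 + d)
  obtain ⟨K2, K20, hK2⟩ := bdd_ex cu2 (-1 - d) (1 + d)
  obtain ⟨K3, K30, hK3⟩ := bdd_ex hu3 (-1) 1
  obtain ⟨K4, K40, hK4⟩ := bdd_ex cρ (-1) 1
  obtain ⟨K5, K50, hK5⟩ := bdd_ex hρ1 (-1) 1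
  obtain ⟨m, hm⟩ : ∃ m, m = min 1 (min m1 (u2 yc / 2)) := ⟨_, rfl⟩
  have mp : 0 < m := by rw [hm]; positivity
  have ma : m ≤ 1 := by rw [hm]; exact min_le_left _ _
  have mb : m ≤ m1 := by rw [hm]; exact (min_le_right _ _).trans (min_le_left _ _)
  have mc : m ≤ u2 yc / 2 := by rw [hm]; exact (min_le_right _ _).trans (min_le_right _ _)
  refine ⟨ρ, ρ1, m, 1 + K1 + K2 + K3 + K4 + K5, d, r, ?_⟩
  constructor
  · exact hu
  · exact hu1
  · exact hu2
  · exact hu3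
  · exact hρ
  · exact hρ1
  · exact mp
  · exact ma
  · linarith
  · exact d0
  · exact rp
  · linarith
  · linarith
  · intro y hy
    have := mul_le_mul_of_nonneg_right (mb.trans (hm1 y hy)) (sq_nonneg (y - yc))
    rw [hq y]; linarith
  · intro y hy
    rw [hq y, abs_mul, mul_comm]
    gcongr
    linarith [hK1 y hy]
  · intro y hy; linarith [hK2 y hy]
  · intro y hy; linarith [hK3 y hy]
  · intro y hy; linarith [(near y hy).1]
  · intro y hy
    have := mul_le_mul_of_nonneg_right (near y hy).2.le (sq_nonneg (y - yc))
    rw [hq y]; linarith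
  · exact rone
  · apply rz; rw [le_abs]; right; linarith
  · apply rz; rw [le_abs]; left; linarith
  · intro y hy; linarith [hK4 y hy]
  · intro y hy; linarith [hK5 y hy]

end AuxQ

section AuxR
open Set

theorem l2_lo (k : ℝ) (hk : 0 ≤ k) (φ φ1 : ℝ → ℂ) : l2 φ1 + k * l2 φ ≤ 2 * √(rN k φ φ1) := by
  have h1 : l2 φ1 ≤ √(rN k φ φ1) := Real.sqrt_le_sqrt (rN_d k φ φ1)
  have h2 : k * l2 φ ≤ √(rN k φ φ1) := by
    have := Real.sqrt_le_sqrt (rN_0 k φ φ1)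
    rw [Real.sqrt_mul (sq_nonneg k), Real.sqrt_sq hk] at this
    exact this
  linarith

theorem l2_hi (k : ℝ) (hk : 0 ≤ k) (φ φ1 : ℝ → ℂ) : √(rN k φ φ1) ≤ l2 φ1 + k * l2 φ := by
  have i1 : 0 ≤ ∫ y in (-1:ℝ)..1, ‖φ1 y‖ ^ 2 :=
    intervalIntegral.integral_nonneg (by norm_num) fun _ _ => sq_nonneg _
  have i0 : 0 ≤ ∫ y in (-1:ℝ)..1, ‖φ y‖ ^ 2 :=
    intervalIntegral.integral_nonneg (by norm_num) fun _ _ => sq_nonneg _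
  have a1 : 0 ≤ l2 φ1 := Real.sqrt_nonneg _
  have a0 : 0 ≤ l2 φ := Real.sqrt_nonneg _
  have e1 : l2 φ1 ^ 2 = ∫ y in (-1:ℝ)..1, ‖φ1 y‖ ^ 2 := Real.sq_sqrt i1
  have e0 : l2 φ ^ 2 = ∫ y in (-1:ℝ)..1, ‖φ y‖ ^ 2 := Real.sq_sqrt i0
  apply Real.sqrt_le_iff.2 ⟨by positivity, ?_⟩
  have : rN k φ φ1 = l2 φ1 ^ 2 + k ^ 2 * l2 φ ^ 2 := by rw [e1, e0]; rfl
  rw [this]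
  nlinarith [mul_nonneg a1 (mul_nonneg hk a0)]

theorem cd_d {E : Type*} [NormedAddCommGroup E] [NormedSpace ℝ E] {f : ℝ → E} {n : ℕ}
    (h : ContDiff ℝ (n + 1) f) : (∀ y, HasDerivAt f (deriv f y) y) ∧ ContDiff ℝ n (deriv f) := by
  have := (contDiff_succ_iff_deriv (n := (n : WithTop ℕ∞))).1 h
  exact ⟨fun y => (this.1 y).hasDerivAt, this.2.2⟩

theorem ray_pos (u : ℝ → ℝ) (yc : ℝ) (hu : ContDiff ℝ 3 u) (hyc : yc ∈ Ioo (-1:ℝ) 1)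
    (h1 : deriv u yc = 0) (h2 : 0 < deriv (deriv u) yc)
    (huq : ∀ y ∈ Icc (-1:ℝ) 1, deriv u y = 0 → y = yc) :
      ∃ K C : ℝ, 3 ≤ K ∧ 0 < C ∧
        ∀ (k : ℝ) (c : ℂ) (g ψ : ℝ → ℂ),
          K ≤ k →
          (∃ y ∈ Icc (-1:ℝ) 1, u y = c.re) →
          c.im ≠ 0 → |c.im| ≤ 1 →
          ContDiff ℝ 1 g → ContDiff ℝ 2 ψ →
          (∀ y ∈ Icc (-1:ℝ) 1,
            ((u y : ℂ) - c) *
                (deriv (deriv ψ) y - (k : ℂ) ^ 2 * ψ y) -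
              ((deriv (deriv u) y : ℝ) : ℂ) * ψ y = g y) →
          ψ (-1) = 0 → ψ 1 = 0 →
          l2 (deriv ψ) + k * l2 ψ ≤
            C * (l2 (deriv g) + k * l2 g) := by
  obtain ⟨d1, c1⟩ := cd_d (n := 2) (f := u) (by exact_mod_cast hu)
  obtain ⟨d2, c2⟩ := cd_d (n := 1) (f := deriv u) (by exact_mod_cast c1)
  obtain ⟨d3, c3⟩ := cd_d (n := 0) (f := deriv (deriv u)) (by exact_mod_cast c2)
  obtain ⟨ρ, ρ1, m, M, d, r, G⟩ := geo_ex d1 d2 d3 c3.continuous hyc h1 h2 huq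
  obtain ⟨K, C, hK, hC, H⟩ := G.main
  refine ⟨K, 2 * C, hK, by linarith, ?_⟩
  intro k c g ψ hk ⟨y, hy, hyu⟩ ci ci1 hg hψ heq bl br
  obtain ⟨dg, cg⟩ := cd_d (n := 0) (f := g) (by exact_mod_cast hg)
  obtain ⟨dψ, cψ⟩ := cd_d (n := 1) (f := ψ) (by exact_mod_cast hψ)
  obtain ⟨dψ2, cψ2⟩ := cd_d (n := 0) (f := deriv ψ) (by exact_mod_cast cψ)
  have k0 : 0 ≤ k := by linarith
  have S : RSol u (deriv (deriv u)) c.re c.im k ψ (deriv ψ) (deriv (deriv ψ)) g (deriv g) := by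
    refine ⟨dψ, dψ2, cψ2.continuous, dg, cg.continuous, ?_, bl, br, ci, hK.trans hk⟩
    intro x hx
    rw [eq_div_iff (rf_ne ci x)]
    have e := heq x hx
    have e2 : rf u c.re c.im x = (u x : ℂ) - c := by
      unfold rf
      apply Complex.ext <;> simp
    rw [e2, ← e]
    ring
  have M1 := G.M1
  have d0 := G.d0
  have hub : u y - u yc ≤ 2 * M := by
    rcases le_total yc y with hh | hh
    · have := G.right.2.1 0 (y - yc) le_rfl (by linarith) (by linarith [hy.2])
      rw [add_sub_cancel, add_zero] at this
      nlinarith [hy.1, hy.2, hyc.1, hyc.2, mul_nonneg (by linarith : 0 ≤ y - yc) (by linarith [hy.2, hyc.1] : 0 ≤ 2 - (y - yc))]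
    · have := G.left.2.1 0 (yc - y) le_rfl (by linarith) (by linarith [hy.1])
      rw [sub_sub_cancel, sub_zero] at this
      nlinarith [hy.1, hy.2, hyc.1, hyc.2, mul_nonneg (by linarith : 0 ≤ yc - y) (by linarith [hy.1, hyc.2] : 0 ≤ 2 - (yc - y))]
  have := H c.re c.im k ψ _ _ g _ S hk (by rw [← hyu]; linarith [G.umin hy]) (by rw [← hyu]; exact hub) ci1
  calc _ ≤ 2 * √(rN k ψ (deriv ψ)) := l2_lo k k0 _ _
    _ ≤ 2 * (C * √(rN k g (deriv g))) := by linarith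
    _ ≤ 2 * (C * (l2 (deriv g) + k * l2 g)) := by
      have := l2_hi k k0 g (deriv g)
      gcongr
    _ = _ := by ring

end AuxR

/-- **Uniform resolvent estimate for the Rayleigh equation of a shear flow
with one non-degenerate critical point** (Proposition C.1): for `u ∈ H³`
with a unique critical point `y_c ∈ (-1,1)`, `u''(y_c) ≠ 0`, `u'(±1) ≠ 0`,
there are `ε₂ > 0`, `K ≥ 3`, `C > 0` such that for `|k| ≥ K`, `Re c ∈ Ran u`,
`0 < |Im c| ≤ ε₂`, `g ∈ H¹` and every solution `ψ` of
`(u - c)(∂_y² - |k|²)ψ - u''ψ = g`, `ψ(±1) = 0`: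
`‖∂_yψ‖_{L²} + |k|‖ψ‖_{L²} ≤ C(‖∂_y g‖_{L²} + |k|‖g‖_{L²})`. -/
theorem rayleigh_uniform_resolvent :
    ∀ (u : ℝ → ℝ) (y_c : ℝ),
      ContDiff ℝ 3 u →
      y_c ∈ Set.Ioo (-1:ℝ) 1 →
      deriv u y_c = 0 →
      deriv (deriv u) y_c ≠ 0 →
      (∀ y ∈ Set.Icc (-1:ℝ) 1, deriv u y = 0 → y = y_c) →
      deriv u (-1) ≠ 0 → deriv u 1 ≠ 0 →
      ∃ ε₂ K C : ℝ, 0 < ε₂ ∧ 3 ≤ K ∧ 0 < C ∧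
        ∀ (k₁ k₃ : ℤ) (c : ℂ) (g ψ : ℝ → ℂ),
          K ≤ kabs k₁ k₃ →
          (∃ y ∈ Set.Icc (-1:ℝ) 1, u y = c.re) →
          c.im ≠ 0 → |c.im| ≤ ε₂ →
          ContDiff ℝ 1 g → ContDiff ℝ 2 ψ →
          (∀ y ∈ Set.Icc (-1:ℝ) 1,
            ((u y : ℂ) - c) *
                (deriv (deriv ψ) y - ((kabs k₁ k₃ : ℝ) : ℂ) ^ 2 * ψ y) -
              ((deriv (deriv u) y : ℝ) : ℂ) * ψ y = g y) →
          ψ (-1) = 0 → ψ 1 = 0 →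
          l2 (deriv ψ) + kabs k₁ k₃ * l2 ψ ≤
            C * (l2 (deriv g) + kabs k₁ k₃ * l2 g) := by
  intro u yc hu hyc h1 h2 huq _ _
  rcases lt_or_gt_of_ne h2 with h2 | h2
  · have n1 : deriv (fun y => - u y) = fun y => - deriv u y := by
      funext y; exact deriv.fun_neg
    have n2 : deriv (deriv (fun y => - u y)) = fun y => - deriv (deriv u) y := by
      rw [n1]; funext y; exact deriv.fun_neg
    obtain ⟨K, C, hK, hC, H⟩ := ray_pos (fun y => - u y) yc hu.neg hyc (by rw [n1]; simp [h1])
      (by rw [n2]; simpa using h2)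
      (by rw [n1]; intro y hy h; exact huq y hy (by simpa using h))
    refine ⟨1, K, C, one_pos, hK, hC, ?_⟩
    intro k₁ k₃ c g ψ hk ⟨y, hy, hyu⟩ ci ci1 hg hψ heq bl br
    have := H (kabs k₁ k₃) (-c) (fun y => - g y) ψ hk ⟨y, hy, by simp [hyu]⟩ (by simpa using ci)
      (by simpa using ci1) hg.neg hψ (by
        intro x hx
        rw [n2, ← heq x hx]
        push_cast
        ring) bl br
    have e1 : l2 (fun y => - g y) = l2 g := by unfold l2; simp
    have e2 : l2 (deriv fun y => - g y) = l2 (deriv g) := by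
      have : deriv (fun y => - g y) = fun y => - deriv g y := by
        funext y; exact deriv.fun_neg
      rw [this]; unfold l2; simp
    rwa [e1, e2] at this
  · obtain ⟨K, C, hK, hC, H⟩ := ray_pos u yc hu hyc h1 h2 huq
    refine ⟨1, K, C, one_pos, hK, hC, ?_⟩
    intro k₁ k₃ c g ψ hk hy ci ci1 hg hψ heq bl br
    exact H (kabs k₁ k₃) c g ψ hk hy ci ci1 hg hψ heq bl br

end
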